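/- Fix an integer d ≥ 4 and set β = d/2 − 2. Call an extreme point v of Qₙ an upper vertex if there exists u ∈ ℝ² with u₂ > 0 such that ⟨w, u⟩ ≤ ⟨v, u⟩ for all w ∈ Qₙ, and let Uₙ be the number of upper vertices of Qₙ; set Eₙ = E[Uₙ] and Vₙ = Var(Uₙ). Then: (i) sup_{z ∈ ℝ} | μ_β^{⊗n}( (Uₙ − Eₙ)/√Vₙ ≤ z ) − Φ(z) | → 0 as n → ∞, where Φ is the cumulative distribution function of the standard Gaussian; (ii) there exists c > 0 such that Eₙ / n^{1/(d−1)} → c as n → ∞; (iii) for every a > 0 there exist c′ > 0 and N with Vₙ ≥ c′·n^{1/(d−1) − a} for all n ≥ N, and there exist c″ > 0 and N′ with Vₙ ≤ c″·(log n)^{3 − 1/(d−1)}·n^{1/(d−1)} for all n ≥ N′. -/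

import Mathlib

open MeasureTheory

/-- The `β`-distribution on the closed unit disk of `ℝ²`. -/
noncomputable def betaMeasure (β : ℝ) : Measure (EuclideanSpace ℝ (Fin 2)) :=
  volume.withDensity fun x =>
    ENNReal.ofReal (if ‖x‖ ≤ 1 then (β + 1) / Real.pi * (1 - ‖x‖ ^ 2) ^ β else 0)

instance (β : ℝ) : SigmaFinite (betaMeasure β) :=
  SigmaFinite.withDensity_ofReal _

/-- The joint law of `n` i.i.d. points with law `μ_β`, realized on `(ℝ²)ⁿ`. -/
noncomputable def betaPi (β : ℝ) (n : ℕ) :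
    Measure (Fin n → EuclideanSpace ℝ (Fin 2)) :=
  Measure.pi fun _ => betaMeasure β

/-- The number of upper vertices of `Qₙ`: extreme points admitting an outer normal
vector with positive second coordinate. -/
noncomputable def upCount {n : ℕ} (ω : Fin n → EuclideanSpace ℝ (Fin 2)) : ℝ :=
  Nat.card {v : EuclideanSpace ℝ (Fin 2) |
    v ∈ Set.extremePoints ℝ (convexHull ℝ (Set.range ω)) ∧
    ∃ u : EuclideanSpace ℝ (Fin 2), 0 < u 1 ∧
      ∀ w ∈ convexHull ℝ (Set.range ω), (inner ℝ w u : ℝ) ≤ inner ℝ v u}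

/-- `Eₙ = E[Uₙ]`, the expected number of upper vertices. -/
noncomputable def meanUp (β : ℝ) (n : ℕ) : ℝ :=
  ∫ ω, upCount ω ∂ betaPi β n

/-- `Vₙ = Var(Uₙ) = E[Uₙ²] - (E[Uₙ])²`. -/
noncomputable def varUp (β : ℝ) (n : ℕ) : ℝ :=
  (∫ ω, upCount ω ^ 2 ∂ betaPi β n) - meanUp β n ^ 2


set_option linter.unusedSectionVars false
namespace CP
open MeasureTheory

def mix {n : ℕ} {α : Type*} (S : Finset (Fin n)) (z : Fin n → α × α) : Fin n → α :=
  fun i => if i ∈ S then (z i).2 else (z i).1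

def ltS (n j : ℕ) : Finset (Fin n) := Finset.univ.filter (fun i => i.val < j)

def swp {n : ℕ} {α : Type*} (j : Fin n) (z : Fin n → α × α) : Fin n → α × α :=
  fun i => if i = j then (z i).swap else z i

section abs
variable {n : ℕ} {α : Type*} [MeasurableSpace α] (ν : Measure α) [IsProbabilityMeasure ν]

lemma mix_mp (S : Finset (Fin n)) : MeasurePreserving (mix (α := α) S)
    (Measure.pi fun _ : Fin n => ν.prod ν) (Measure.pi fun _ : Fin n => ν) := by
  refine measurePreserving_pi (fun _ : Fin n => ν.prod ν) (fun _ => ν)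
    (f := fun i p => if i ∈ S then p.2 else p.1) (fun i => ?_)
  by_cases h : i ∈ S
  · simp only [h, if_true]; exact measurePreserving_snd
  · simp only [h, if_false]; exact measurePreserving_fst

lemma swp_mp (j : Fin n) : MeasurePreserving (swp (α := α) j)
    (Measure.pi fun _ : Fin n => ν.prod ν) (Measure.pi fun _ : Fin n => ν.prod ν) := by
  refine measurePreserving_pi (fun _ : Fin n => ν.prod ν) (fun _ => ν.prod ν)
    (f := fun i p => if i = j then p.swap else p) (fun i => ?_)
  by_cases h : i = j
  · simp only [h, if_true]; exact Measure.measurePreserving_swap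
  · simp only [h, if_false]; exact MeasurePreserving.id _

lemma mix_swp_lt (j : Fin n) (z : Fin n → α × α) :
    mix (ltS n j) (swp j z) = mix (ltS n (j+1)) z := by
  funext i
  rcases lt_trichotomy i j with h | h | h
  · have : i.val < j.val := h
    have h2 : i.val < j.val + 1 := by omega
    simp only [mix, ltS, swp, h.ne, this, h2, Finset.mem_filter, Finset.mem_univ, true_and, if_true, if_false]
  · subst h; simp [mix, ltS, swp]
  · have : j.val < i.val := h
    have h2 : ¬ i.val < j.val + 1 := by omega
    have h3 : ¬ i.val < j.val := by omega
    simp only [mix, ltS, swp, h.ne', h2, h3, Finset.mem_filter, Finset.mem_univ, true_and, if_false]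

lemma swp_swp (j : Fin n) (z : Fin n → α × α) : swp j (swp j z) = z := by
  funext i
  by_cases h : i = j <;> simp [swp, h]

lemma mix_swp_lt2 (j : Fin n) (z : Fin n → α × α) :
    mix (ltS n (j+1)) (swp j z) = mix (ltS n j) z := by
  rw [← mix_swp_lt, swp_swp]

lemma mix_swp_empty (j : Fin n) (z : Fin n → α × α) :
    mix ∅ (swp j z) = mix {j} z := by
  funext i
  by_cases h : i = j <;> simp [mix, swp, h]

lemma indep_mix {F : Type*} [NormedAddCommGroup F] [NormedSpace ℝ F]
    (f : (Fin n → α) → ℝ) (h : (Fin n → α) → F) :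
    ∫ z, f (mix Finset.univ z) • h (mix ∅ z) ∂(Measure.pi fun _ : Fin n => ν.prod ν)
      = (∫ x, f x ∂(Measure.pi fun _ : Fin n => ν)) • ∫ x, h x ∂(Measure.pi fun _ : Fin n => ν) := by
  have hm := measurePreserving_arrowProdEquivProdArrow α α (Fin n) (fun _ => ν) (fun _ => ν)
  have h1 := hm.integral_comp' (g := fun p : (Fin n → α) × (Fin n → α) => f p.2 • h p.1)
  have h2 : (fun z => f (mix Finset.univ z) • h (mix ∅ z)) = fun z : Fin n → α × α =>
    f ((MeasurableEquiv.arrowProdEquivProdArrow α α (Fin n)) z).2 •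
      h ((MeasurableEquiv.arrowProdEquivProdArrow α α (Fin n)) z).1 := by
    funext z
    congr 2
    funext i; simp [mix]; rfl
  rw [h2, h1, ← integral_prod_smul]
  exact (Measure.measurePreserving_swap (μ := Measure.pi fun _ : Fin n => ν)
    (ν := Measure.pi fun _ : Fin n => ν)).integral_comp
      MeasurableEquiv.prodComm.measurableEmbedding
      (fun p : (Fin n → α) × (Fin n → α) => f p.1 • h p.2)

lemma bdd_int {Ω F : Type*} [MeasurableSpace Ω] {P : Measure Ω} [IsFiniteMeasure P]
    [NormedAddCommGroup F] {f : Ω → F} (hf : AEStronglyMeasurable f P) (C : ℝ)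
    (hC : ∀ x, ‖f x‖ ≤ C) : Integrable f P :=
  Integrable.of_bound hf C (Filter.Eventually.of_forall hC)

theorem cov_identity {F : Type*} [NormedAddCommGroup F] [NormedSpace ℝ F] 
    (f : (Fin n → α) → ℝ) (hf : Measurable f) (Cf : ℝ) (hfb : ∀ x, |f x| ≤ Cf)
    (h : (Fin n → α) → F) (hh : StronglyMeasurable h) (Ch : ℝ) (hhb : ∀ x, ‖h x‖ ≤ Ch) :
    ∫ x, (f x - ∫ y, f y ∂(Measure.pi fun _ : Fin n => ν)) • h x ∂(Measure.pi fun _ : Fin n => ν)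
    = (1/2:ℝ) • ∑ j : Fin n, ∫ z, (f (mix (ltS n j) z) - f (mix (ltS n (j+1)) z)) •
        (h (mix ∅ z) - h (mix {j} z)) ∂(Measure.pi fun _ : Fin n => ν.prod ν) := by
  have hfm : ∀ S, Measurable (fun z : Fin n → α × α => f (mix S z)) :=
    fun S => hf.comp (mix_mp ν S).measurable
  have hhm : ∀ S, StronglyMeasurable (fun z : Fin n → α × α => h (mix S z)) :=
    fun S => hh.comp_measurable (mix_mp ν S).measurable
  have hint : ∀ S S', Integrable (fun z : Fin n → α × α => f (mix S z) • h (mix S' z))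
      (Measure.pi fun _ : Fin n => ν.prod ν) := by
    intro S S'
    refine bdd_int ((hfm S).stronglyMeasurable.smul (hhm S')).aestronglyMeasurable (Cf * Ch) ?_
    intro z
    rw [norm_smul]
    exact mul_le_mul (hfb _) (hhb _) (norm_nonneg _) ((abs_nonneg _).trans (hfb (mix S z)))
  have hintx : Integrable (fun x => f x • h x) (Measure.pi fun _ : Fin n => ν) := by
    refine bdd_int (hf.stronglyMeasurable.smul hh).aestronglyMeasurable (Cf * Ch) ?_
    intro z
    rw [norm_smul]
    exact mul_le_mul (hfb _) (hhb _) (norm_nonneg _) ((abs_nonneg _).trans (hfb z))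
  have hinth : Integrable h (Measure.pi fun _ : Fin n => ν) :=
    bdd_int hh.aestronglyMeasurable Ch hhb
  have e1 : ∫ x, (f x - ∫ y, f y ∂(Measure.pi fun _ : Fin n => ν)) • h x
        ∂(Measure.pi fun _ : Fin n => ν)
      = ∫ z, (f (mix ∅ z) - f (mix Finset.univ z)) • h (mix ∅ z)
        ∂(Measure.pi fun _ : Fin n => ν.prod ν) := by
    simp only [sub_smul]
    rw [integral_sub (hint _ _) (hint _ _), indep_mix,
      integral_sub (g := fun x => (∫ (y : Fin n → α), f y ∂Measure.pi fun x => ν) • h x)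
        hintx (hinth.smul _), integral_smul]
    congr 1
    conv_lhs => rw [← (mix_mp ν (∅ : Finset (Fin n))).map_eq]
    rw [integral_map (mix_mp ν _).measurable.aemeasurable]
    exact (hf.stronglyMeasurable.smul hh).aestronglyMeasurable
  have e2 : ∀ z : Fin n → α × α, f (mix ∅ z) - f (mix Finset.univ z)
      = ∑ j : Fin n, (f (mix (ltS n j) z) - f (mix (ltS n (j+1)) z)) := by
    intro z
    rw [Fin.sum_univ_eq_sum_range (fun j => f (mix (ltS n j) z) - f (mix (ltS n (j+1)) z)) n,
      Finset.sum_range_sub']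
    congr 3
    · simp [ltS]
    · ext i; simp [ltS]
  have hint2 : ∀ S S' S'', Integrable (fun z : Fin n → α × α =>
      (f (mix S z) - f (mix S' z)) • h (mix S'' z)) (Measure.pi fun _ : Fin n => ν.prod ν) := by
    intro S S' S''
    simp only [sub_smul]
    exact (hint _ _).sub (hint _ _)
  rw [e1, Finset.smul_sum]
  simp only [e2, Finset.sum_smul]
  rw [integral_finsetSum _ (fun j _ => hint2 _ _ _)]
  refine Finset.sum_congr rfl fun j _ => ?_
  have e3 : ∫ z, (f (mix (ltS n j) z) - f (mix (ltS n (j+1)) z)) • h (mix {j} z)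
        ∂(Measure.pi fun _ : Fin n => ν.prod ν)
      = - ∫ z, (f (mix (ltS n j) z) - f (mix (ltS n (j+1)) z)) • h (mix ∅ z)
        ∂(Measure.pi fun _ : Fin n => ν.prod ν) := by
    conv_rhs => rw [← (swp_mp ν j).map_eq]
    rw [integral_map (swp_mp ν j).measurable.aemeasurable, ← integral_neg]
    · congr 1
      funext z
      rw [mix_swp_lt, mix_swp_lt2, mix_swp_empty, ← neg_smul, neg_sub]
    · exact (((hfm _).sub (hfm _)).stronglyMeasurable.smul (hhm _)).aestronglyMeasurable
  simp only [smul_sub]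
  rw [integral_sub (hint2 _ _ _) (hint2 _ _ _), e3, sub_neg_eq_add, ← two_smul ℝ, smul_smul]
  norm_num

theorem var_eq (f : (Fin n → α) → ℝ) (hf : Measurable f) (Cf : ℝ) (hfb : ∀ x, |f x| ≤ Cf) :
    ∫ x, f x ^ 2 ∂(Measure.pi fun _ : Fin n => ν) - (∫ x, f x ∂(Measure.pi fun _ : Fin n => ν)) ^ 2
    = (1/2:ℝ) * ∑ j : Fin n, ∫ z, (f (mix (ltS n j) z) - f (mix (ltS n (j+1)) z)) *
        (f (mix ∅ z) - f (mix {j} z)) ∂(Measure.pi fun _ : Fin n => ν.prod ν) := by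
  have h := cov_identity ν f hf Cf hfb f hf.stronglyMeasurable Cf hfb
  simp only [smul_eq_mul] at h
  rw [← h]
  have i1 : Integrable f (Measure.pi fun _ : Fin n => ν) :=
    bdd_int hf.aestronglyMeasurable Cf hfb
  have i2 : Integrable (fun x => f x ^ 2) (Measure.pi fun _ : Fin n => ν) := by
    refine bdd_int (hf.pow_const 2).aestronglyMeasurable (Cf ^ 2) fun x => ?_
    rw [norm_pow]
    exact pow_le_pow_left₀ (norm_nonneg _) (hfb x) 2
  simp only [sub_mul, ← pow_two]
  rw [integral_sub i2 (i1.const_mul _), integral_const_mul]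
  ring

lemma int_mix2 (j : Fin n) (f : (Fin n → α) → ℝ) (hf : Measurable f) :
    ∫ z, (f (mix (ltS n j) z) - f (mix (ltS n (j+1)) z)) ^ 2
      ∂(Measure.pi fun _ : Fin n => ν.prod ν)
    = ∫ z, (f (mix ∅ z) - f (mix {j} z)) ^ 2 ∂(Measure.pi fun _ : Fin n => ν.prod ν) := by
  have hm : MeasurePreserving (fun (z : Fin n → α × α) i => if i.val < j.val then (z i).swap else z i)
      (Measure.pi fun _ : Fin n => ν.prod ν) (Measure.pi fun _ : Fin n => ν.prod ν) := by
    refine measurePreserving_pi (fun _ : Fin n => ν.prod ν) (fun _ => ν.prod ν)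
      (f := fun i p => if i.val < j.val then p.swap else p) (fun i => ?_)
    by_cases h : i.val < j.val
    · simp only [h, if_true]; exact Measure.measurePreserving_swap
    · simp only [h, if_false]; exact MeasurePreserving.id _
  conv_rhs => rw [← hm.map_eq]
  rw [integral_map hm.measurable.aemeasurable]
  · congr 1
    funext z
    congr 3
    · funext i
      by_cases h : i.val < j.val
      · simp only [mix, ltS, h, Finset.mem_filter, Finset.mem_univ, true_and, if_true]; simp
      · simp only [mix, ltS, h, Finset.mem_filter, Finset.mem_univ, true_and, if_false]; simp
    · funext i
      by_cases h : i.val < j.val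
      · have h2 : i.val < j.val + 1 := by omega
        have h3 : i ≠ j := by rintro rfl; omega
        simp only [mix, ltS, h, h2, h3, Finset.mem_filter, Finset.mem_univ, true_and, if_true,
          Finset.mem_singleton, if_false]; simp
      · by_cases h4 : i = j
        · subst h4; simp [mix, ltS]
        · have h2 : ¬ i.val < j.val + 1 := by
            intro h5; exact h4 (Fin.ext (by omega))
          simp only [mix, ltS, h, h2, h4, Finset.mem_filter, Finset.mem_univ, true_and,
            Finset.mem_singleton, if_false]
  · exact (((hf.comp (mix_mp ν _).measurable).sub (hf.comp (mix_mp ν _).measurable)).pow_const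
      2).aestronglyMeasurable

theorem efron_stein (f : (Fin n → α) → ℝ) (hf : Measurable f) (Cf : ℝ) (hfb : ∀ x, |f x| ≤ Cf) :
    ∫ x, f x ^ 2 ∂(Measure.pi fun _ : Fin n => ν) - (∫ x, f x ∂(Measure.pi fun _ : Fin n => ν)) ^ 2
    ≤ (1/2:ℝ) * ∑ j : Fin n, ∫ z, (f (mix ∅ z) - f (mix {j} z)) ^ 2
        ∂(Measure.pi fun _ : Fin n => ν.prod ν) := by
  rw [var_eq ν f hf Cf hfb]
  refine mul_le_mul_of_nonneg_left (Finset.sum_le_sum fun j _ => ?_) (by norm_num)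
  have hfm : ∀ S, Measurable (fun z : Fin n → α × α => f (mix S z)) :=
    fun S => hf.comp (mix_mp ν S).measurable
  have hsq : ∀ S S', Integrable (fun z : Fin n → α × α => (f (mix S z) - f (mix S' z)) ^ 2)
      (Measure.pi fun _ : Fin n => ν.prod ν) := by
    intro S S'
    refine bdd_int (((hfm S).sub (hfm S')).pow_const 2).aestronglyMeasurable ((Cf + Cf) ^ 2) ?_
    intro z
    rw [norm_pow]
    exact pow_le_pow_left₀ (norm_nonneg _) ((norm_sub_le _ _).trans (add_le_add (hfb _) (hfb _))) 2
  have hle : ∫ z, (f (mix (ltS n j) z) - f (mix (ltS n (j+1)) z)) * (f (mix ∅ z) - f (mix {j} z))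
      ∂(Measure.pi fun _ : Fin n => ν.prod ν)
      ≤ ∫ z, (1/2:ℝ) * ((f (mix (ltS n j) z) - f (mix (ltS n (j+1)) z)) ^ 2 +
        (f (mix ∅ z) - f (mix {j} z)) ^ 2) ∂(Measure.pi fun _ : Fin n => ν.prod ν) := by
    refine integral_mono ?_ (((hsq _ _).add (hsq _ _)).const_mul _) ?_
    · refine bdd_int (((hfm _).sub (hfm _)).mul ((hfm _).sub (hfm _))).aestronglyMeasurable
        ((Cf + Cf) * (Cf + Cf)) ?_
      intro z
      rw [norm_mul]
      exact mul_le_mul ((norm_sub_le _ _).trans (add_le_add (hfb _) (hfb _)))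
        ((norm_sub_le _ _).trans (add_le_add (hfb _) (hfb _))) (norm_nonneg _)
        (by linarith [(abs_nonneg _).trans (hfb (mix ∅ z))])
    · intro z
      dsimp only
      nlinarith [sq_nonneg ((f (mix (ltS n j) z) - f (mix (ltS n (j+1)) z)) -
        (f (mix ∅ z) - f (mix {j} z)))]
  refine hle.trans (le_of_eq ?_)
  rw [integral_const_mul, integral_add (hsq _ _) (hsq _ _), int_mix2 ν j f hf]
  ring

end abs
end CP

set_option linter.unusedSectionVars false
namespace CP
open MeasureTheory Complex

lemma exp_taylor (s : ℝ) : ‖(1 : ℂ) - exp (-(I * s)) - I * s‖ ≤ 3 * s ^ 2 := by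
  rcases le_or_gt |s| 1 with h | h
  · have h1 : ‖-(I * s : ℂ)‖ ≤ 1 := by simpa using h
    have h2 := Complex.norm_exp_sub_one_sub_id_le h1
    have h3 : (1 : ℂ) - exp (-(I * s)) - I * s = -(exp (-(I * s)) - 1 - (-(I * s))) := by ring
    rw [h3, norm_neg]
    refine h2.trans ?_
    simp
    nlinarith [sq_nonneg s]
  · have h1 : ‖exp (-(I * s : ℂ))‖ = 1 := by
      have : -(I * s : ℂ) = ((-s : ℝ) : ℂ) * I := by push_cast; ring
      rw [this, Complex.norm_exp_ofReal_mul_I]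
    have h2 : ‖(1 : ℂ) - exp (-(I * s)) - I * s‖ ≤ 1 + 1 + |s| := by
      refine (norm_sub_le _ _).trans (add_le_add ((norm_sub_le _ _).trans ?_) ?_)
      · rw [h1]; simp
      · simp
    nlinarith [sq_abs s]

lemma norm_e (x : ℝ) : ‖exp (I * x : ℂ)‖ = 1 := by
  rw [mul_comm, Complex.norm_exp_ofReal_mul_I]

lemma sq_int_le {Ω : Type*} [MeasurableSpace Ω] {P : Measure Ω} [IsProbabilityMeasure P]
    {g : Ω → ℝ} (hg : Integrable g P) (hg2 : Integrable (fun x => g x ^ 2) P) :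
    (∫ x, |g x| ∂P) ^ 2 ≤ ∫ x, g x ^ 2 ∂P := by
  set c := ∫ x, |g x| ∂P with hc
  have i1 : Integrable (fun x => 2 * c * |g x|) P := hg.abs.const_mul _
  have h6 := integral_mono (f := fun x => 2 * c * |g x| - c ^ 2) (i1.sub (integrable_const _)) hg2
    (fun z => by
      dsimp only
      rw [← sq_abs (g z)]
      nlinarith [sq_nonneg (|g z| - c)])
  rw [integral_sub i1 (integrable_const _), integral_const_mul, ← hc] at h6
  simp at h6
  nlinarith

section abs
variable {n : ℕ} {α : Type*} [MeasurableSpace α] (ν : Measure α) [IsProbabilityMeasure ν]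

noncomputable def da (f : (Fin n → α) → ℝ) (j : Fin n) (z : Fin n → α × α) : ℝ :=
  f (mix (ltS n j) z) - f (mix (ltS n (j+1)) z)
noncomputable def db (f : (Fin n → α) → ℝ) (j : Fin n) (z : Fin n → α × α) : ℝ :=
  f (mix ∅ z) - f (mix {j} z)
noncomputable def TT (f : (Fin n → α) → ℝ) (z : Fin n → α × α) : ℝ :=
  (1/2:ℝ) * ∑ j : Fin n, da f j z * db f j z

lemma mix_meas (S : Finset (Fin n)) : Measurable (mix S : (Fin n → α × α) → (Fin n → α)) := by
  refine measurable_pi_iff.2 fun i => ?_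
  by_cases h : i ∈ S
  · simp only [mix, h, if_true]; exact measurable_snd.comp (measurable_pi_apply i)
  · simp only [mix, h, if_false]; exact measurable_fst.comp (measurable_pi_apply i)

lemma da_meas {f : (Fin n → α) → ℝ} (hf : Measurable f) (j : Fin n) : Measurable (da f j) :=
  (hf.comp (mix_meas _)).sub (hf.comp (mix_meas _))

lemma db_meas {f : (Fin n → α) → ℝ} (hf : Measurable f) (j : Fin n) : Measurable (db f j) :=
  (hf.comp (mix_meas _)).sub (hf.comp (mix_meas _))

lemma TT_meas {f : (Fin n → α) → ℝ} (hf : Measurable f) : Measurable (TT f) :=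
  measurable_const.mul (Finset.measurable_fun_sum _ fun j _ => (da_meas hf j).mul (db_meas hf j))

lemma da_bdd {f : (Fin n → α) → ℝ} {Cf : ℝ} (hfb : ∀ x, |f x| ≤ Cf) (j : Fin n)
    (z : Fin n → α × α) : |da f j z| ≤ 2 * Cf := by
  rw [da, two_mul]
  exact (abs_sub _ _).trans (add_le_add (hfb _) (hfb _))

lemma db_bdd {f : (Fin n → α) → ℝ} {Cf : ℝ} (hfb : ∀ x, |f x| ≤ Cf) (j : Fin n)
    (z : Fin n → α × α) : |db f j z| ≤ 2 * Cf := by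
  rw [db, two_mul]
  exact (abs_sub _ _).trans (add_le_add (hfb _) (hfb _))

lemma TT_bdd {f : (Fin n → α) → ℝ} {Cf : ℝ} (hfb : ∀ x, |f x| ≤ Cf)
    (z : Fin n → α × α) : |TT f z| ≤ 2 * n * Cf ^ 2 := by
  have h0 : 0 ≤ Cf := (abs_nonneg _).trans (hfb (mix ∅ z))
  rw [TT, abs_mul]
  have h1 : |∑ j : Fin n, da f j z * db f j z| ≤ ∑ j : Fin n, (2 * Cf) * (2 * Cf) := by
    refine (Finset.abs_sum_le_sum_abs _ _).trans (Finset.sum_le_sum fun j _ => ?_)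
    rw [abs_mul]
    exact mul_le_mul (da_bdd hfb j z) (db_bdd hfb j z) (abs_nonneg _) (by positivity)
  simp at h1
  rw [abs_of_pos (by norm_num : (0:ℝ) < 1/2)]
  nlinarith

theorem key_stein (f : (Fin n → α) → ℝ) (hf : Measurable f) (Cf : ℝ) (hfb : ∀ x, |f x| ≤ Cf)
    (σ v e : ℝ) (hσ : 0 < σ)
    (hvar : ∫ x, f x ^ 2 ∂(Measure.pi fun _ : Fin n => ν)
      - (∫ x, f x ∂(Measure.pi fun _ : Fin n => ν)) ^ 2 = σ ^ 2)
    (hv : ∫ z, TT f z ^ 2 ∂(Measure.pi fun _ : Fin n => ν.prod ν)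
      - (∫ z, TT f z ∂(Measure.pi fun _ : Fin n => ν.prod ν)) ^ 2 ≤ v)
    (he : ∑ j : Fin n, ∫ z, |da f j z| * db f j z ^ 2 ∂(Measure.pi fun _ : Fin n => ν.prod ν) ≤ e)
    (m : ℝ) (hm : m = ∫ x, f x ∂(Measure.pi fun _ : Fin n => ν)) (t : ℝ) :
    ‖∫ x, (((f x - m) / σ : ℝ) : ℂ) * exp (I * ((t * ((f x - m) / σ) : ℝ) : ℂ))
        ∂(Measure.pi fun _ : Fin n => ν)
      - I * t * ∫ x, exp (I * ((t * ((f x - m) / σ) : ℝ) : ℂ)) ∂(Measure.pi fun _ : Fin n => ν)‖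
    ≤ |t| * √v / σ ^ 2 + 3 / 2 * t ^ 2 * e / σ ^ 3 := by
  set P := Measure.pi fun _ : Fin n => ν with hP
  set P2 := Measure.pi fun _ : Fin n => ν.prod ν with hP2
  set h : (Fin n → α) → ℂ := fun x => exp (I * ((t * ((f x - m) / σ) : ℝ) : ℂ)) with hh
  have hhm : Measurable h := by
    refine Complex.measurable_exp.comp (measurable_const.mul (Complex.measurable_ofReal.comp ?_))
    exact measurable_const.mul ((hf.sub_const m).div_const σ)
  have hhn : ∀ x, ‖h x‖ = 1 := fun x => norm_e _
  have hcov := cov_identity ν f hf Cf hfb h hhm.stronglyMeasurable 1 (fun x => (hhn x).le)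
  rw [← hP, ← hP2, ← hm] at hcov
  have hmixm : ∀ S, Measurable (mix S : (Fin n → α × α) → (Fin n → α)) :=
    fun S => (mix_mp ν S).measurable
  have hda := fun j => da_meas hf j
  have hdb := fun j => db_meas hf j
  have hT := TT_meas hf
  have hCf : 0 ≤ Cf := by
    have : Nonempty α := nonempty_of_isProbabilityMeasure ν
    exact (abs_nonneg _).trans (hfb (Classical.arbitrary _))
  -- difference of h
  have hR : ∀ j z, ‖h (mix ∅ z) - h (mix {j} z) - h (mix ∅ z) * (I * ((t * db f j z / σ : ℝ) : ℂ))‖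
      ≤ 3 * (t * db f j z / σ) ^ 2 := by
    intro j z
    have e1 : h (mix {j} z) = h (mix ∅ z) * exp (-(I * ((t * db f j z / σ : ℝ) : ℂ))) := by
      simp only [hh]
      rw [← Complex.exp_add]
      congr 1
      simp only [db]
      push_cast
      field_simp
      ring
    rw [e1]
    have e2 : h (mix ∅ z) - h (mix ∅ z) * exp (-(I * ((t * db f j z / σ : ℝ) : ℂ)))
        - h (mix ∅ z) * (I * ((t * db f j z / σ : ℝ) : ℂ))
        = h (mix ∅ z) * (1 - exp (-(I * ((t * db f j z / σ : ℝ) : ℂ)))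
          - I * ((t * db f j z / σ : ℝ) : ℂ)) := by ring
    rw [e2, norm_mul, hhn, one_mul]
    exact exp_taylor _
  -- integrability
  have iA : ∀ j, Integrable (fun z => da f j z • (h (mix ∅ z) - h (mix {j} z))) P2 := by
    intro j
    refine bdd_int ((hda j).stronglyMeasurable.smul ((hhm.comp (hmixm _)).sub
      (hhm.comp (hmixm _))).stronglyMeasurable).aestronglyMeasurable (2 * Cf * (1 + 1)) fun z => ?_
    rw [norm_smul]
    refine mul_le_mul (da_bdd hfb j z) ((norm_sub_le _ _).trans ?_) (norm_nonneg _) (by positivity)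
    rw [hhn, hhn]
  have iB : ∀ j, Integrable (fun z => da f j z • (h (mix ∅ z) * (I * ((t * db f j z / σ : ℝ) : ℂ)))) P2 := by
    intro j
    refine bdd_int ((hda j).stronglyMeasurable.smul ((hhm.comp (hmixm _)).mul (measurable_const.mul
      (Complex.measurable_ofReal.comp (((hdb j).const_mul t).div_const
        σ)))).stronglyMeasurable).aestronglyMeasurable (2 * Cf * (|t| * (2 * Cf) / σ)) fun z => ?_
    rw [norm_smul, norm_mul, hhn, one_mul, norm_mul, Complex.norm_I, one_mul, Complex.norm_real,
      Real.norm_eq_abs, Real.norm_eq_abs, abs_div, abs_mul, abs_of_pos hσ]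
    have := da_bdd hfb j z
    have := db_bdd hfb j z
    gcongr
  have iC : ∀ j, Integrable (fun z => |da f j z| * db f j z ^ 2) P2 := by
    intro j
    refine bdd_int (((hda j).norm).mul ((hdb j).pow_const 2)).aestronglyMeasurable
      (2 * Cf * (2 * Cf) ^ 2) fun z => ?_
    rw [norm_mul, norm_pow, Real.norm_eq_abs, Real.norm_eq_abs, abs_abs]
    have := da_bdd hfb j z
    have := db_bdd hfb j z
    gcongr
  have iT : Integrable (TT f) P2 :=
    bdd_int hT.aestronglyMeasurable _ (fun z => TT_bdd hfb z)
  have iT2 : Integrable (fun z => TT f z ^ 2) P2 := by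
    refine bdd_int (hT.pow_const 2).aestronglyMeasurable ((2 * n * Cf ^ 2) ^ 2) fun z => ?_
    rw [norm_pow]
    exact pow_le_pow_left₀ (norm_nonneg _) (TT_bdd hfb z) 2
  have iTh : Integrable (fun z => TT f z • h (mix ∅ z)) P2 := by
    refine bdd_int (hT.stronglyMeasurable.smul (hhm.comp
      (hmixm _)).stronglyMeasurable).aestronglyMeasurable (2 * n * Cf ^ 2) fun z => ?_
    rw [norm_smul, hhn, mul_one]
    exact TT_bdd hfb z
  have ih : Integrable (fun z => h (mix ∅ z)) P2 :=
    bdd_int (hhm.comp (hmixm _)).aestronglyMeasurable 1 fun z => (hhn _).le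
  have ET : ∫ z, TT f z ∂P2 = σ ^ 2 := by
    have h1 := var_eq ν f hf Cf hfb
    rw [← hP, ← hP2, hvar] at h1
    rw [h1]
    simp only [TT]
    rw [integral_const_mul, integral_finsetSum]
    · rfl
    · intro j _
      refine bdd_int ((hda j).mul (hdb j)).aestronglyMeasurable (2 * Cf * (2 * Cf)) fun z => ?_
      rw [norm_mul, Real.norm_eq_abs, Real.norm_eq_abs]
      have := da_bdd hfb j z
      have := db_bdd hfb j z
      gcongr
  -- main
  have m1 : ∑ j : Fin n, ∫ z, da f j z • (h (mix ∅ z) * (I * ((t * db f j z / σ : ℝ) : ℂ))) ∂P2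
      = (2 : ℂ) * (I * (t / σ : ℝ)) * ∫ z, TT f z • h (mix ∅ z) ∂P2 := by
    rw [← integral_finsetSum _ (fun j _ => iB j), ← integral_const_mul]
    congr 1
    funext z
    simp only [TT, Complex.real_smul]
    push_cast
    rw [show (2:ℂ) * (I * (t / σ)) * ((1/2 * ∑ i, (da f i z : ℂ) * (db f i z : ℂ)) * h (mix ∅ z))
      = (∑ i, (da f i z : ℂ) * (db f i z : ℂ)) * (I * (t / σ) * h (mix ∅ z)) by ring, Finset.sum_mul]
    refine Finset.sum_congr rfl fun j _ => ?_
    ring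
  have m2 : ‖∑ j : Fin n, ∫ z, da f j z • (h (mix ∅ z) - h (mix {j} z)) ∂P2
      - (2 : ℂ) * (I * (t / σ : ℝ)) * ∫ z, TT f z • h (mix ∅ z) ∂P2‖ ≤ 3 * t ^ 2 / σ ^ 2 * e := by
    rw [← m1, ← Finset.sum_sub_distrib]
    refine (norm_sum_le _ _).trans ?_
    have : ∀ j : Fin n, ‖∫ z, da f j z • (h (mix ∅ z) - h (mix {j} z)) ∂P2
        - ∫ z, da f j z • (h (mix ∅ z) * (I * ((t * db f j z / σ : ℝ) : ℂ))) ∂P2‖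
        ≤ 3 * t ^ 2 / σ ^ 2 * ∫ z, |da f j z| * db f j z ^ 2 ∂P2 := by
      intro j
      rw [← integral_sub (iA j) (iB j), ← integral_const_mul]
      refine norm_integral_le_of_norm_le ((iC j).const_mul _) (Filter.Eventually.of_forall fun z => ?_)
      rw [← smul_sub, norm_smul, Real.norm_eq_abs]
      refine (mul_le_mul_of_nonneg_left (hR j z) (abs_nonneg _)).trans (le_of_eq ?_)
      field_simp
    refine (Finset.sum_le_sum fun j _ => this j).trans ?_
    rw [← Finset.mul_sum]
    exact mul_le_mul_of_nonneg_left he (by positivity)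
  have m3 : ‖∫ z, TT f z • h (mix ∅ z) ∂P2 - (σ ^ 2 : ℝ) * ∫ z, h (mix ∅ z) ∂P2‖ ≤ √v := by
    have i5 : Integrable (fun z => (TT f z - σ ^ 2) ^ 2) P2 := by
      have : (fun z => (TT f z - σ ^ 2) ^ 2) = fun z => TT f z ^ 2 - 2 * σ ^ 2 * TT f z + (σ ^ 2) ^ 2 := by
        funext z; ring
      rw [this]
      exact (iT2.sub (iT.const_mul _)).add (integrable_const _)
    have e5 : ∫ z, (TT f z - σ ^ 2) ^ 2 ∂P2 ≤ v := by
      have : (fun z => (TT f z - σ ^ 2) ^ 2) = fun z => TT f z ^ 2 - 2 * σ ^ 2 * TT f z + (σ ^ 2) ^ 2 := by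
        funext z; ring
      have j1 : Integrable (fun z => TT f z ^ 2 - 2 * σ ^ 2 * TT f z) P2 := iT2.sub (iT.const_mul _)
      rw [this, integral_add j1 (integrable_const _),
        integral_sub iT2 (iT.const_mul _), integral_const_mul, ET]
      rw [ET] at hv
      simp
      nlinarith
    rw [← integral_const_mul, ← integral_sub iTh (ih.const_mul _)]
    refine (norm_integral_le_of_norm_le (g := fun z => |TT f z - σ ^ 2|)
      (iT.sub (integrable_const _)).abs (Filter.Eventually.of_forall fun z => ?_)).trans ?_
    · rw [Complex.real_smul, ← sub_mul, norm_mul, hhn, mul_one, ← Complex.ofReal_sub,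
        Complex.norm_real, Real.norm_eq_abs]
    · exact Real.le_sqrt_of_sq_le (le_trans (sq_int_le (iT.sub (integrable_const _)) i5) e5)
  have hx : ∫ x, h x ∂P = ∫ z, h (mix ∅ z) ∂P2 := by
    conv_lhs => rw [hP, ← (mix_mp ν (∅ : Finset (Fin n))).map_eq]
    rw [integral_map (mix_mp ν _).measurable.aemeasurable hhm.aestronglyMeasurable]
  have hl : ∫ x, (((f x - m) / σ : ℝ) : ℂ) * h x ∂P
      = (1 / σ : ℝ) * ∫ x, (f x - m) • h x ∂P := by
    rw [← integral_const_mul]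
    congr 1
    funext x
    rw [Complex.real_smul]
    push_cast
    ring
  rw [hl, hcov, hx]
  have hsplit : ((1 / σ : ℝ) : ℂ) * (1/2 : ℝ) • ∑ j : Fin n, ∫ z, (f (mix (ltS n j) z) - f (mix (ltS n (j+1)) z)) • (h (mix ∅ z) - h (mix {j} z)) ∂P2
      - I * t * ∫ z, h (mix ∅ z) ∂P2
      = ((1 / (2 * σ) : ℝ) : ℂ) * (∑ j : Fin n, ∫ z, da f j z • (h (mix ∅ z) - h (mix {j} z)) ∂P2
      - (2 : ℂ) * (I * (t / σ : ℝ)) * ∫ z, TT f z • h (mix ∅ z) ∂P2)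
      + I * ((t / σ ^ 2 : ℝ) : ℂ) * (∫ z, TT f z • h (mix ∅ z) ∂P2 - (σ ^ 2 : ℝ) * ∫ z, h (mix ∅ z) ∂P2) := by
    have hs : (σ : ℂ) ≠ 0 := by exact_mod_cast hσ.ne'
    simp only [Complex.real_smul, da]
    push_cast
    field_simp
    ring
  rw [hsplit]
  refine (norm_add_le _ _).trans ?_
  rw [norm_mul, norm_mul, norm_mul, Complex.norm_I, Complex.norm_real, Complex.norm_real,
    Real.norm_eq_abs, Real.norm_eq_abs, abs_of_pos (by positivity : 0 < 1 / (2 * σ)), abs_div,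
    abs_of_pos (by positivity : 0 < σ ^ 2), one_mul, add_comm]
  refine add_le_add ?_ ?_
  · refine (mul_le_mul_of_nonneg_left m3 (by positivity)).trans (le_of_eq ?_)
    ring
  · refine (mul_le_mul_of_nonneg_left m2 (by positivity)).trans (le_of_eq ?_)
    field_simp

theorem char_bound (f : (Fin n → α) → ℝ) (hf : Measurable f) (Cf : ℝ) (hfb : ∀ x, |f x| ≤ Cf)
    (σ v e : ℝ) (hσ : 0 < σ)
    (hvar : ∫ x, f x ^ 2 ∂(Measure.pi fun _ : Fin n => ν)
      - (∫ x, f x ∂(Measure.pi fun _ : Fin n => ν)) ^ 2 = σ ^ 2)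
    (hv : ∫ z, TT f z ^ 2 ∂(Measure.pi fun _ : Fin n => ν.prod ν)
      - (∫ z, TT f z ∂(Measure.pi fun _ : Fin n => ν.prod ν)) ^ 2 ≤ v)
    (he : ∑ j : Fin n, ∫ z, |da f j z| * db f j z ^ 2 ∂(Measure.pi fun _ : Fin n => ν.prod ν) ≤ e)
    (m : ℝ) (hm : m = ∫ x, f x ∂(Measure.pi fun _ : Fin n => ν)) (t : ℝ) :
    ‖∫ x, exp (I * ((t * ((f x - m) / σ) : ℝ) : ℂ)) ∂(Measure.pi fun _ : Fin n => ν)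
      - exp (-(t ^ 2 / 2 : ℝ))‖
    ≤ (|t| * √v / σ ^ 2 + 3 / 2 * t ^ 2 * e / σ ^ 3) * |t| := by
  have hks := key_stein ν f hf Cf hfb σ v e hσ hvar hv he m hm
  have he0 : 0 ≤ e := le_trans (Finset.sum_nonneg fun j _ => integral_nonneg fun z => by
    simp only [Pi.zero_apply]; positivity) he
  set P := Measure.pi fun _ : Fin n => ν with hP
  set W : (Fin n → α) → ℝ := fun x => (f x - m) / σ with hW
  have hWm : Measurable W := (hf.sub_const m).div_const σ
  set CW := (Cf + |m|) / σ with hCW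
  have hWb : ∀ x, |W x| ≤ CW := fun x => by
    rw [hW, hCW]; simp only
    rw [abs_div, abs_of_pos hσ]
    gcongr
    exact (abs_sub _ _).trans (by gcongr; exact hfb x)
  set φ : ℝ → ℂ := fun t => ∫ x, exp (I * ((t * W x : ℝ) : ℂ)) ∂P with hφ
  have hder : ∀ s : ℝ, HasDerivAt φ (I * ∫ x, (W x : ℂ) * exp (I * ((s * W x : ℝ) : ℂ)) ∂P) s := by
    intro s
    have hmeas : ∀ s : ℝ, Measurable fun x => exp (I * ((s * W x : ℝ) : ℂ)) := fun s =>
      Complex.measurable_exp.comp (measurable_const.mul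
        (Complex.measurable_ofReal.comp (measurable_const.mul hWm)))
    have h := hasDerivAt_integral_of_dominated_loc_of_deriv_le (μ := P) (𝕜 := ℝ) (x₀ := s)
      (F := fun (t : ℝ) x => exp (I * ((t * W x : ℝ) : ℂ)))
      (F' := fun (t : ℝ) x => I * ((W x : ℂ) * exp (I * ((t * W x : ℝ) : ℂ))))
      (bound := fun _ => CW) (s := Set.univ) Filter.univ_mem
      (Filter.Eventually.of_forall fun t => (hmeas t).aestronglyMeasurable)
      (bdd_int (hmeas s).aestronglyMeasurable 1 fun x => (norm_e _).le)
      ((measurable_const.mul ((Complex.measurable_ofReal.comp hWm).mul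
        (hmeas s))).aestronglyMeasurable)
      (Filter.Eventually.of_forall fun x t _ => by
        rw [norm_mul, norm_mul, norm_e, Complex.norm_I, one_mul, mul_one, Complex.norm_real]
        exact hWb x)
      (integrable_const _)
      (Filter.Eventually.of_forall fun x t _ => by
        have h1 : HasDerivAt (fun t : ℝ => I * ((t * W x : ℝ) : ℂ)) (I * (W x : ℂ)) t := by
          have := ((hasDerivAt_id t).mul_const (W x)).ofReal_comp.const_mul I
          simpa using this
        have h2 := h1.cexp
        exact h2.congr_deriv (by ring))
    rw [← integral_const_mul]
    exact h.2
  set B := |t| * √v / σ ^ 2 + 3 / 2 * t ^ 2 * e / σ ^ 3 with hB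
  have hB0 : 0 ≤ B := by positivity
  have hE : ∀ s : ℝ, HasDerivAt (fun s : ℝ => exp ((s ^ 2 / 2 : ℝ) : ℂ)) (s * exp ((s ^ 2 / 2 : ℝ) : ℂ)) s := by
    intro s
    have h1 : HasDerivAt (fun s : ℝ => s ^ 2 / 2) s s := by
      have := (hasDerivAt_pow 2 s).div_const 2
      simpa using this
    have h2 := h1.ofReal_comp.cexp
    rwa [mul_comm] at h2
  have hψ : ∀ s : ℝ, HasDerivAt (fun s => φ s * exp ((s ^ 2 / 2 : ℝ) : ℂ))
      (I * (∫ x, (W x : ℂ) * exp (I * ((s * W x : ℝ) : ℂ)) ∂P - I * s * φ s)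
        * exp ((s ^ 2 / 2 : ℝ) : ℂ)) s := by
    intro s
    refine ((hder s).mul (hE s)).congr_deriv ?_
    linear_combination (φ s * s * exp ((s ^ 2 / 2 : ℝ) : ℂ)) * Complex.I_mul_I
  have hmv := (convex_uIcc (0:ℝ) t).norm_image_sub_le_of_norm_hasDerivWithin_le
    (f := fun s => φ s * exp ((s ^ 2 / 2 : ℝ) : ℂ))
    (C := B * Real.exp (t ^ 2 / 2)) (x := 0) (y := t)
    (fun s _ => (hψ s).hasDerivWithinAt) (fun s hs => by
      have hst : |s| ≤ |t| := by
        have := Set.abs_sub_left_of_mem_uIcc hs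
        simpa using this
      have hst2 : s ^ 2 ≤ t ^ 2 := sq_le_sq.2 hst
      rw [norm_mul, norm_mul, Complex.norm_I, one_mul]
      have h3 : ‖exp ((s ^ 2 / 2 : ℝ) : ℂ)‖ = Real.exp (s ^ 2 / 2) := by
        rw [Complex.norm_exp, Complex.ofReal_re]
      rw [h3]
      refine mul_le_mul ((hks s).trans ?_) (Real.exp_le_exp.2 (by linarith)) (Real.exp_pos _).le hB0
      rw [hB]
      gcongr) Set.left_mem_uIcc Set.right_mem_uIcc
  have hφ0 : φ 0 = 1 := by simp [hφ]
  simp only [hφ0, sub_zero, Real.norm_eq_abs] at hmv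
  have hfin : φ t - exp (-(t ^ 2 / 2 : ℝ)) = (φ t * exp ((t ^ 2 / 2 : ℝ) : ℂ)
      - 1 * exp (((0:ℝ) ^ 2 / 2 : ℝ) : ℂ)) * exp (-(t ^ 2 / 2 : ℝ)) := by
    rw [sub_mul, mul_assoc, ← Complex.exp_add, add_neg_cancel]
    simp
  rw [hfin, norm_mul]
  have h4 : ‖exp (-(t ^ 2 / 2 : ℝ) : ℂ)‖ = Real.exp (-(t ^ 2 / 2)) := by
    rw [← Complex.ofReal_neg, Complex.norm_exp, Complex.ofReal_re]
  rw [h4]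
  refine (mul_le_mul_of_nonneg_right hmv (Real.exp_pos _).le).trans (le_of_eq ?_)
  rw [show B * Real.exp (t ^ 2 / 2) * |t| * Real.exp (-(t ^ 2 / 2))
    = B * |t| * (Real.exp (t ^ 2 / 2) * Real.exp (-(t ^ 2 / 2))) by ring, ← Real.exp_add]
  simp

end abs
end CP

namespace CP
open MeasureTheory ProbabilityTheory Filter Topology

lemma polya (F : ℕ → ℝ → ℝ) (G : ℝ → ℝ) (hF : ∀ n, Monotone (F n)) (h0 : ∀ n z, 0 ≤ F n z)
    (h1 : ∀ n z, F n z ≤ 1) (hG : Monotone G) (hGc : Continuous G)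
    (hb : Tendsto G atBot (𝓝 0)) (ht : Tendsto G atTop (𝓝 1))
    (hp : ∀ z, Tendsto (fun n => F n z) atTop (𝓝 (G z))) :
    Tendsto (fun n => ⨆ z, |F n z - G z|) atTop (𝓝 0) := by
  have hG0 : ∀ z, 0 ≤ G z := fun z => hG.le_of_tendsto hb z
  have hG1 : ∀ z, G z ≤ 1 := fun z => hG.ge_of_tendsto ht z
  have key : ∀ N : ℕ, 0 < N → ∀ᶠ n in atTop, ∀ z, |F n z - G z| ≤ 3 / N := by
    intro N hN
    have hN' : (0:ℝ) < N := by exact_mod_cast hN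
    have hz : ∀ k : ℕ, ∃ z, (0 < k ∧ k < N) → G z = (k:ℝ) / N := by
      intro k
      by_cases hk : 0 < k ∧ k < N
      · have a1 : (0:ℝ) < (k:ℝ) / N := by have : (0:ℝ) < k := by exact_mod_cast hk.1
                                          positivity
        have a2 : (k:ℝ) / N < 1 := by rw [div_lt_one hN']; exact_mod_cast hk.2
        obtain ⟨z1, hz1⟩ := (hb.eventually_lt_const a1).exists
        obtain ⟨z2, hz2⟩ := (ht.eventually_const_lt a2).exists
        obtain ⟨z, hz⟩ := mem_range_of_exists_le_of_exists_ge hGc ⟨z1, hz1.le⟩ ⟨z2, hz2.le⟩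
        exact ⟨z, fun _ => hz⟩
      · exact ⟨0, fun h => absurd h hk⟩
    choose Z hZ using hz
    have hev : ∀ᶠ n in atTop, ∀ k ∈ Finset.range N, |F n (Z k) - G (Z k)| < 1 / N := by
      rw [Filter.eventually_all_finset]
      intro k _
      have := Metric.tendsto_nhds.1 (hp (Z k)) (1 / N) (by positivity)
      exact this
    filter_upwards [hev] with n hn z
    set k := ⌊(N:ℝ) * G z⌋₊ with hk
    have k1 : (k:ℝ) ≤ N * G z := Nat.floor_le (by have := hG0 z; positivity)
    have k2 : (N:ℝ) * G z < k + 1 := Nat.lt_floor_add_one _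
    rw [abs_le]
    have kd : (k:ℝ) / N ≤ G z := by rw [div_le_iff₀ hN']; linarith
    have kd2 : G z < ((k:ℝ) + 1) / N := by rw [lt_div_iff₀ hN']; linarith
    have e1 : ((k:ℝ) + 1) / N = (k:ℝ) / N + 1 / N := by ring
    have e3 : (3:ℝ) / N = 1 / N + 1 / N + 1 / N := by ring
    have p1 : (0:ℝ) < 1 / N := by positivity
    constructor
    · by_cases hk2 : 2 ≤ k
      · have hkN : k - 1 < N := by
          have : (k:ℝ) ≤ N := k1.trans (by nlinarith [hG1 z])
          have : k ≤ N := by exact_mod_cast this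
          omega
        have hval := hZ (k-1) ⟨by omega, hkN⟩
        have hc : ((k - 1 : ℕ) : ℝ) = (k:ℝ) - 1 := by push_cast [show 1 ≤ k by omega]; ring
        rw [hc, sub_div] at hval
        have hlt : Z (k-1) ≤ z := by
          by_contra hcon
          have := hG (not_le.1 hcon).le
          linarith
        have := hF n hlt
        have h5 := (abs_lt.1 (hn (k-1) (Finset.mem_range.2 hkN))).1
        linarith
      · have : (k:ℝ) ≤ 1 := by exact_mod_cast (by omega : k ≤ 1)
        have h6 : (k:ℝ) / N ≤ 1 / N := by gcongr
        linarith [h0 n z]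
    · by_cases hkN : k + 1 < N
      · have hval := hZ (k+1) ⟨by omega, hkN⟩
        push_cast at hval
        have hlt : z ≤ Z (k+1) := by
          by_contra hcon
          have := hG (not_le.1 hcon).le
          linarith
        have := hF n hlt
        have h5 := (abs_lt.1 (hn (k+1) (Finset.mem_range.2 hkN))).2
        linarith
      · have : (N:ℝ) ≤ k + 1 := by exact_mod_cast (by omega : N ≤ k + 1)
        have h6 : (1:ℝ) ≤ ((k:ℝ) + 1) / N := by rw [le_div_iff₀ hN']; linarith
        linarith [h1 n z]
  rw [Metric.tendsto_nhds]
  intro ε hε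
  obtain ⟨N, hN⟩ := exists_nat_gt (3 / ε)
  have hN0 : (0:ℝ) < N := lt_trans (by positivity) hN
  filter_upwards [key N (by exact_mod_cast hN0)] with n hn
  have hle : (⨆ z, |F n z - G z|) ≤ 3 / N := ciSup_le hn
  have hge : 0 ≤ ⨆ z, |F n z - G z| := Real.iSup_nonneg fun z => abs_nonneg _
  rw [Real.dist_eq, sub_zero, abs_of_nonneg hge]
  refine hle.trans_lt ?_
  rw [div_lt_iff₀ hε] at hN
  rw [div_lt_iff₀ hN0]
  linarith

theorem clt_of_char {Ω : ℕ → Type*} [∀ n, MeasurableSpace (Ω n)] (P : ∀ n, Measure (Ω n))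
    [∀ n, IsProbabilityMeasure (P n)] (W : ∀ n, Ω n → ℝ) (hW : ∀ n, Measurable (W n))
    (h : ∀ t : ℝ, Tendsto (fun n => ∫ x, Complex.exp (Complex.I * ((t * W n x : ℝ) : ℂ)) ∂(P n)) atTop
      (𝓝 (Complex.exp (-(t ^ 2 / 2 : ℝ))))) :
    Tendsto (fun n => ⨆ z : ℝ, |(P n {x | W n x ≤ z}).toReal - (gaussianReal 0 1 (Set.Iic z)).toReal|)
      atTop (𝓝 0) := by
  have hpm : ∀ n, IsProbabilityMeasure ((P n).map (W n)) := fun n =>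
    Measure.isProbabilityMeasure_map (hW n).aemeasurable
  let μ : ℕ → ProbabilityMeasure ℝ := fun n => ⟨(P n).map (W n), hpm n⟩
  let μ0 : ProbabilityMeasure ℝ := ⟨gaussianReal 0 1, inferInstance⟩
  have hconv : Tendsto μ atTop (𝓝 μ0) := by
    refine ProbabilityMeasure.tendsto_of_tendsto_charFun fun t => ?_
    have e0 : charFun (μ0 : Measure ℝ) t = Complex.exp (-(t ^ 2 / 2 : ℝ)) := by
      simp only [μ0, ProbabilityMeasure.coe_mk, charFun_gaussianReal]
      congr 1
      push_cast
      simp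
    rw [e0]
    refine (h t).congr fun n => ?_
    simp only [μ, ProbabilityMeasure.coe_mk, charFun_apply_real]
    rw [integral_map (hW n).aemeasurable (by fun_prop)]
    congr 1
    funext x
    congr 1
    push_cast
    ring
  have hG : ∀ z, (gaussianReal 0 1 (Set.Iic z)).toReal = cdf (gaussianReal 0 1) z := fun z => by
    rw [cdf_eq_real]; rfl
  have hFF : ∀ n z, (P n {x | W n x ≤ z}).toReal = cdf ((P n).map (W n)) z := fun n z => by
    rw [cdf_eq_real, Measure.real, Measure.map_apply (hW n) measurableSet_Iic]; rfl
  simp only [hG, hFF]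
  have hna : ∀ z : ℝ, (gaussianReal 0 1) {z} = 0 := fun z => by
    have := nullSingletonClass_gaussianReal (μ := 0) (v := 1) (by norm_num)
    exact measure_singleton z
  refine polya _ _ (fun n => monotone_cdf _) (fun n z => cdf_nonneg _ _) (fun n z => cdf_le_one _ _)
    (monotone_cdf _) ?_ (tendsto_cdf_atBot _) (tendsto_cdf_atTop _) ?_
  · rw [continuous_iff_continuousAt]
    intro x
    rw [(monotone_cdf _).continuousAt_iff_leftLim_eq_rightLim, StieltjesFunction.rightLim_eq]
    have h1 := hna x
    have h3 := StieltjesFunction.measure_singleton (cdf (gaussianReal 0 1)) x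
    rw [measure_cdf, h1] at h3
    have h4 := ENNReal.ofReal_eq_zero.1 h3.symm
    have h5 := (monotone_cdf (gaussianReal 0 1)).leftLim_le (le_refl x)
    linarith
  · intro z
    have := ProbabilityMeasure.tendsto_measure_of_null_frontier_of_tendsto' hconv (E := Set.Iic z)
      (by simp [μ0, hna])
    have h2 := (ENNReal.tendsto_toReal (measure_ne_top (gaussianReal 0 1) (Set.Iic z))).comp this
    refine (h2.congr fun n => ?_).trans (le_of_eq ?_)
    · rw [cdf_eq_real]; rfl
    · rw [cdf_eq_real]; rfl

end CP

namespace CP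
open MeasureTheory Filter Topology

abbrev EE := EuclideanSpace ℝ (Fin 2)

def Vert {n : ℕ} (x : Fin n → EE) (i : Fin n) : Prop :=
  ∃ u : EE, 0 < u 1 ∧ ∀ j, j ≠ i → (inner ℝ (x j) u : ℝ) < inner ℝ (x i) u

open Classical in
noncomputable def vf {n : ℕ} (x : Fin n → EE) (i : Fin n) : ℝ := if Vert x i then 1 else 0

noncomputable def ff {n : ℕ} (x : Fin n → EE) : ℝ := ∑ i, vf x i

lemma upSet_eq {n : ℕ} (x : Fin n → EE) (hx : Function.Injective x) :
    {v : EE | v ∈ Set.extremePoints ℝ (convexHull ℝ (Set.range x)) ∧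
    ∃ u : EE, 0 < u 1 ∧
      ∀ w ∈ convexHull ℝ (Set.range x), (inner ℝ w u : ℝ) ≤ inner ℝ v u} = x '' {i | Vert x i} := by
  ext v
  constructor
  · rintro ⟨hv, u, hu, huw⟩
    obtain ⟨i, rfl⟩ := extremePoints_convexHull_subset hv
    refine ⟨i, ?_, rfl⟩
    have h2 : x i ∉ convexHull ℝ (Set.range x \ {x i}) := by
      intro hc
      have h1 := (convex_convexHull ℝ (Set.range x)).mem_extremePoints_iff_mem_sdiff_convexHull_sdiff.1 hv
      refine h1.2 (convexHull_mono ?_ hc)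
      exact Set.sdiff_subset_sdiff_left (subset_convexHull ℝ _)
    have hcl : IsClosed (convexHull ℝ (Set.range x \ {x i})) :=
      ((Set.finite_range x).subset Set.sdiff_subset).isClosed_convexHull _
    obtain ⟨g, s, hg1, hg2⟩ := geometric_hahn_banach_closed_point (convex_convexHull ℝ _) hcl h2
    set w := (InnerProductSpace.toDual ℝ EE).symm g with hw
    have hgw : ∀ y, g y = inner ℝ y w := by
      intro y
      rw [real_inner_comm, hw, InnerProductSpace.toDual_symm_apply]
    obtain ⟨ε, hε, hε2⟩ : ∃ ε : ℝ, 0 < ε ∧ 0 < u 1 + ε * w 1 := by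
      refine ⟨u 1 / (2 * (|w 1| + 1)), by positivity, ?_⟩
      have h1 : u 1 / (2 * (|w 1| + 1)) * |w 1| ≤ u 1 / 2 := by
        rw [div_mul_eq_mul_div, div_le_div_iff₀ (by positivity) (by positivity)]
        nlinarith [abs_nonneg (w 1)]
      have h2 : -(u 1 / (2 * (|w 1| + 1)) * |w 1|) ≤ u 1 / (2 * (|w 1| + 1)) * w 1 := by
        rw [← mul_neg]
        exact mul_le_mul_of_nonneg_left (neg_abs_le _) (by positivity)
      linarith
    refine ⟨u + ε • w, by simpa using hε2, fun j hj => ?_⟩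
    rw [inner_add_right, inner_add_right, inner_smul_right, inner_smul_right]
    have h3 := huw (x j) (subset_convexHull ℝ _ ⟨j, rfl⟩)
    have h4 : g (x j) < g (x i) :=
      (hg1 (x j) (subset_convexHull ℝ _ ⟨⟨j, rfl⟩, fun h => hj (hx h)⟩)).trans hg2
    rw [hgw, hgw] at h4
    nlinarith
  · rintro ⟨i, ⟨u, hu, hui⟩, rfl⟩
    have hle : ∀ w ∈ convexHull ℝ (Set.range x), (inner ℝ w u : ℝ) < inner ℝ (x i) u ∨ w = x i := by
      have hc : Convex ℝ {w : EE | (inner ℝ w u : ℝ) < inner ℝ (x i) u ∨ w = x i} := by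
        intro p hp q hq a b ha hb hab
        simp only [Set.mem_ofPred_eq] at hp hq ⊢
        by_cases hpq : p = x i ∧ q = x i
        · right; rw [hpq.1, hpq.2, ← add_smul, hab, one_smul]
        · by_cases ha0 : a = 0
          · have : b = 1 := by linarith
            simpa [ha0, this] using hq
          by_cases hb0 : b = 0
          · have : a = 1 := by linarith
            simpa [hb0, this] using hp
          left
          have ha' := lt_of_le_of_ne ha (Ne.symm ha0)
          have hb' := lt_of_le_of_ne hb (Ne.symm hb0)
          rw [inner_add_left, real_inner_smul_left, real_inner_smul_left]
          have hb1 : b = 1 - a := by linarith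
          subst hb1
          rcases hp with hp | hp <;> rcases hq with hq | hq
          · nlinarith
          · rw [hq]; nlinarith
          · rw [hp]; nlinarith
          · exact absurd ⟨hp, hq⟩ hpq
      refine fun w hw => convexHull_min ?_ hc hw
      rintro _ ⟨j, rfl⟩
      by_cases hj : j = i
      · right; rw [hj]
      · left; exact hui j hj
    refine ⟨?_, u, hu, fun w hw => ?_⟩
    · rw [mem_extremePoints]
      refine ⟨subset_convexHull ℝ _ ⟨i, rfl⟩, fun p hp q hq hpq => ?_⟩
      obtain ⟨a, b, ha, hb, hab, he⟩ := hpq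
      have h1 := hle p hp
      have h2 := hle q hq
      have h3 : a * inner ℝ p u + b * inner ℝ q u = inner ℝ (x i) u := by
        rw [← he, inner_add_left, real_inner_smul_left, real_inner_smul_left]
      have h1' : (inner ℝ p u : ℝ) ≤ inner ℝ (x i) u := by
        rcases h1 with h | h; exacts [h.le, by rw [h]]
      have h2' : (inner ℝ q u : ℝ) ≤ inner ℝ (x i) u := by
        rcases h2 with h | h; exacts [h.le, by rw [h]]
      have hb1 : b = 1 - a := by linarith
      subst hb1
      constructor
      · rcases h1 with h | h
        · nlinarith
        · exact h
      · rcases h2 with h | h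
        · nlinarith
        · exact h
    · rcases hle w hw with h | h; exacts [h.le, by rw [h]]

lemma upCount_eq {n : ℕ} (x : Fin n → EE) (hx : Function.Injective x) : upCount x = ff x := by
  classical
  unfold upCount ff vf
  rw [upSet_eq x hx, Nat.card_image_of_injective hx, Finset.sum_boole]
  congr 1
  rw [Nat.card_eq_fintype_card, Fintype.card_subtype]
  congr 1

lemma vert_open {n : ℕ} (i : Fin n) : IsOpen {x : Fin n → EE | Vert x i} := by
  have : {x : Fin n → EE | Vert x i} = ⋃ u : EE, ⋃ (_ : 0 < u 1), ⋂ j : Fin n, ⋂ (_ : j ≠ i),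
      {x | (inner ℝ (x j) u : ℝ) < inner ℝ (x i) u} := by
    ext x; simp [Vert]
  rw [this]
  refine isOpen_iUnion fun u => isOpen_iUnion fun _ => isOpen_iInter_of_finite fun j =>
    isOpen_iInter_of_finite fun _ => ?_
  exact isOpen_lt (by fun_prop) (by fun_prop)

lemma vf_meas {n : ℕ} (i : Fin n) : Measurable fun x : Fin n → EE => vf x i := by
  unfold vf
  exact Measurable.ite (vert_open i).measurableSet measurable_const measurable_const

lemma ff_meas {n : ℕ} : Measurable (ff : (Fin n → EE) → ℝ) := by
  unfold ff
  exact Finset.measurable_fun_sum _ fun i _ => vf_meas i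

lemma vf_nonneg {n : ℕ} (x : Fin n → EE) (i) : 0 ≤ vf x i := by
  unfold vf; split_ifs <;> norm_num
lemma vf_le {n : ℕ} (x : Fin n → EE) (i) : vf x i ≤ 1 := by
  unfold vf; split_ifs <;> norm_num

lemma ff_nonneg {n : ℕ} (x : Fin n → EE) : 0 ≤ ff x := Finset.sum_nonneg fun i _ => vf_nonneg x i
lemma ff_le {n : ℕ} (x : Fin n → EE) : ff x ≤ n := by
  have := Finset.sum_le_sum fun i (_ : i ∈ Finset.univ) => vf_le x i
  simpa [ff] using this

lemma ff_abs {n : ℕ} (x : Fin n → EE) : |ff x| ≤ n := by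
  rw [abs_of_nonneg (ff_nonneg x)]; exact ff_le x

end CP

namespace CP
open MeasureTheory Filter Topology
open scoped ENNReal

lemma lint_affine (g : ℝ → ℝ≥0∞) (m c : ℝ) (hm : m ≠ 0) :
    ∫⁻ y, g y = ∫⁻ s, ENNReal.ofReal |m| * g (c + m * s) := by
  have h := lintegral_image_eq_lintegral_abs_deriv_mul (s := Set.univ) (f := fun s => c + m * s)
    (f' := fun _ => m) MeasurableSet.univ (fun x _ => by
      simpa using (((hasDerivAt_id x).const_mul m).const_add c).hasDerivWithinAt (s := Set.univ))
    (fun a _ b _ hab => by simpa [hm] using hab) g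
  have hs : (fun s => c + m * s) '' Set.univ = Set.univ := by
    rw [Set.image_univ, Set.range_eq_univ]
    intro y
    exact ⟨(y - c) / m, by field_simp; ring⟩
  rw [hs] at h
  simpa using h

lemma lint_E (f : EE → ℝ≥0∞) (hf : Measurable f) :
    ∫⁻ x, f x = ∫⁻ a : ℝ, ∫⁻ b : ℝ, f !₂[a, b] := by
  rw [← (PiLp.volume_preserving_toLp (Fin 2)).lintegral_comp hf]
  have := (volume_preserving_finTwoArrow ℝ).symm.lintegral_comp
      (hf.comp (PiLp.volume_preserving_toLp (Fin 2)).measurable)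
  simp only [Function.comp_apply] at this
  rw [← this]
  rw [Measure.volume_eq_prod, lintegral_prod]
  · rfl
  · exact ((hf.comp (PiLp.volume_preserving_toLp (Fin 2)).measurable).comp
      (volume_preserving_finTwoArrow ℝ).symm.measurable).aemeasurable

noncomputable def rden (β s : ℝ) : ℝ := if s ≤ 1 then (β + 1) / Real.pi * (1 - s) ^ β else 0

lemma rden_meas (β : ℝ) : Measurable (rden β) := by
  unfold rden
  exact Measurable.ite measurableSet_Iic (by fun_prop) measurable_const

lemma rden_nonneg {β : ℝ} (hβ : 0 ≤ β) (s) : 0 ≤ rden β s := by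
  unfold rden
  split_ifs with h
  · have : 0 ≤ 1 - s := by linarith
    positivity
  · exact le_rfl

lemma bm_eq (β : ℝ) : betaMeasure β = volume.withDensity fun x : EE => ENNReal.ofReal (rden β (‖x‖ ^ 2)) := by
  unfold betaMeasure rden
  congr 1
  funext x
  have : ‖x‖ ^ 2 ≤ 1 ↔ ‖x‖ ≤ 1 := by
    rw [sq_le_one_iff_abs_le_one, abs_of_nonneg (norm_nonneg x)]
  simp only [this]

lemma dens_meas (β : ℝ) : Measurable fun x : EE => ENNReal.ofReal (rden β (‖x‖ ^ 2)) :=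
  ((rden_meas β).comp (by fun_prop)).ennreal_ofReal

lemma normsq (x : EE) : ‖x‖ ^ 2 = x 0 ^ 2 + x 1 ^ 2 := by
  rw [EuclideanSpace.norm_sq_eq]; simp

lemma inner2 (x u : EE) : (inner ℝ x u : ℝ) = x 0 * u 0 + x 1 * u 1 := by
  rw [PiLp.inner_apply]; simp [mul_comm]

lemma bm_lint (β : ℝ) (f : EE → ℝ≥0∞) (hf : Measurable f) :
    ∫⁻ x, f x ∂betaMeasure β
      = ∫⁻ a : ℝ, ∫⁻ b : ℝ, ENNReal.ofReal (rden β (a ^ 2 + b ^ 2)) * f !₂[a, b] := by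
  rw [bm_eq, lintegral_withDensity_eq_lintegral_mul _ (dens_meas β) hf,
    lint_E _ ((dens_meas β).mul hf)]
  simp [normsq]

lemma bm_isom (β : ℝ) (e : EE ≃ₗᵢ[ℝ] EE) : MeasurePreserving e (betaMeasure β) (betaMeasure β) := by
  refine ⟨e.continuous.measurable, ?_⟩
  ext s hs
  rw [Measure.map_apply e.continuous.measurable hs, bm_eq,
    withDensity_apply _ (e.continuous.measurable hs), withDensity_apply _ hs,
    ← (e.measurePreserving).setLIntegral_comp_preimage hs (dens_meas β)]
  simp

/-- tail of the norm -/
lemma annulus {β : ℝ} (hβ : 0 ≤ β) (ρ : ℝ) (h0 : 0 ≤ ρ) (h1 : ρ ≤ 1) :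
    betaMeasure β {x | ρ ≤ ‖x‖} = ENNReal.ofReal ((1 - ρ ^ 2) ^ (β + 1)) := by
  have hms : MeasurableSet {x : EE | ρ ≤ ‖x‖} := measurableSet_le measurable_const measurable_norm
  rw [bm_eq, withDensity_apply _ hms, ← lintegral_indicator hms]
  have e1 : ∀ x : EE, ({x : EE | ρ ≤ ‖x‖}).indicator (fun x => ENNReal.ofReal (rden β (‖x‖ ^ 2))) x
     = ENNReal.ofReal ((fun y : ℝ => if ρ ≤ y then rden β (y ^ 2) else 0) ‖x‖) := by
    intro x
    by_cases hx : ρ ≤ ‖x‖ <;> simp [Set.indicator, hx]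
  simp only [e1]
  set F : ℝ → ℝ := fun y : ℝ => if ρ ≤ y then rden β (y ^ 2) else 0 with hF
  have hF0 : ∀ y, 0 ≤ F y := fun y => by
    simp only [hF]; split_ifs; exacts [rden_nonneg hβ _, le_rfl]
  set c : ℝ → ℝ := fun y => y * ((β + 1) / Real.pi * (1 - y ^ 2) ^ β) with hc
  have hcc : Continuous c := by
    have : Continuous fun y : ℝ => (1 - y ^ 2) ^ β :=
      Continuous.rpow_const (by fun_prop) fun _ => Or.inr hβ
    fun_prop
  have hd : Module.finrank ℝ EE = 2 := by simp
  have hEq : Set.EqOn (fun y : ℝ => y ^ (Module.finrank ℝ EE - 1) • F y) ((Set.Icc ρ 1).indicator c)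
      (Set.Ioi 0) := by
    intro y hy
    have hy0 : (0:ℝ) < y := hy
    have hy1 : y ^ 2 ≤ 1 ↔ y ≤ 1 := by
      rw [sq_le_one_iff_abs_le_one, abs_of_pos hy0]
    simp only [hd, hF, hc, Set.indicator, Set.mem_Icc, rden, hy1]
    by_cases a1 : ρ ≤ y <;> by_cases a2 : y ≤ 1 <;> simp [a1, a2]
  have hint : Integrable ((Set.Icc ρ 1).indicator c) := by
    rw [integrable_indicator_iff measurableSet_Icc]
    exact hcc.continuousOn.integrableOn_compact isCompact_Icc
  have hI : Integrable fun x : EE => F ‖x‖ := by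
    rw [integrable_fun_norm_addHaar, integrableOn_congr_fun hEq measurableSet_Ioi]
    exact hint.integrableOn
  rw [← ofReal_integral_eq_lintegral_ofReal hI (Eventually.of_forall fun x => hF0 _)]
  congr 1
  rw [integral_fun_norm_addHaar, setIntegral_congr_fun measurableSet_Ioi hEq,
    setIntegral_indicator measurableSet_Icc]
  have hs : (Set.Ioi 0 ∩ Set.Icc ρ 1 : Set ℝ) =ᵐ[volume] Set.Ioc ρ 1 := by
    rw [ae_eq_set]
    constructor
    · refine measure_mono_null (t := {ρ}) ?_ (by simp)
      rintro y ⟨⟨_, hy⟩, hn⟩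
      simp only [Set.mem_Icc, Set.mem_Ioc, not_and, not_le] at hy hn
      by_contra hne
      have : ρ < y := lt_of_le_of_ne hy.1 (fun h => hne h.symm)
      linarith [hn this]
    · convert measure_empty (μ := (volume : Measure ℝ))
      rw [Set.sdiff_eq_empty]
      intro y hy
      exact ⟨lt_of_le_of_lt h0 hy.1, hy.1.le, hy.2⟩
  rw [setIntegral_congr_set hs, ← intervalIntegral.integral_of_le h1]
  have hder : ∀ y ∈ Set.uIcc ρ 1, HasDerivAt (fun y : ℝ => -(1 / (2 * Real.pi)) * (1 - y ^ 2) ^ (β + 1))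
      (c y) y := by
    intro y _
    have h2 : HasDerivAt (fun y : ℝ => 1 - y ^ 2) (-(2 * y)) y := by
      simpa using ((hasDerivAt_id y).pow 2).const_sub 1
    have h3 := (h2.rpow_const (p := β + 1) (Or.inr (by linarith))).const_mul (-(1 / (2 * Real.pi)))
    refine h3.congr_deriv ?_
    simp only [hc]
    rw [add_sub_cancel_right]
    field_simp
  rw [intervalIntegral.integral_eq_sub_of_hasDerivAt hder (hcc.intervalIntegrable _ _)]
  have hv : (volume : Measure EE).real (Metric.ball 0 1) = Real.pi := by
    rw [Measure.real, EuclideanSpace.volume_ball_fin_two]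
    simp [ENNReal.toReal_ofReal Real.pi_pos.le]
  rw [hv, hd]
  have : (1 - (1:ℝ) ^ 2) ^ (β + 1) = 0 := by
    rw [one_pow, sub_self, Real.zero_rpow (by linarith)]
  rw [this]
  simp only [nsmul_eq_mul, smul_eq_mul]
  push_cast
  field_simp
  ring

lemma bm_prob {β : ℝ} (hβ : 0 ≤ β) : IsProbabilityMeasure (betaMeasure β) := by
  have := annulus hβ 0 le_rfl zero_le_one
  refine ⟨?_⟩
  simpa using this

lemma bm_disk (β : ℝ) : ∀ᵐ x ∂betaMeasure β, ‖x‖ ≤ 1 := by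
  have hm : MeasurableSet {a : EE | ¬ ‖a‖ ≤ 1} :=
    (measurableSet_le measurable_norm measurable_const).compl
  rw [ae_iff, bm_eq, withDensity_apply _ hm]
  rw [setLIntegral_congr_fun (g := fun _ => 0) hm]
  · simp
  · intro x hx
    have : ¬ ‖x‖ ^ 2 ≤ 1 := by
      rw [sq_le_one_iff_abs_le_one, abs_of_nonneg (norm_nonneg x)]; exact hx
    simp [rden, this]

lemma bm_ac (β : ℝ) : betaMeasure β ≪ volume := by
  rw [bm_eq]; exact withDensity_absolutelyContinuous _ _


lemma cap_rot (β t : ℝ) (e : EE) (he : ‖e‖ = 1) :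
    betaMeasure β {x | t ≤ inner ℝ x e} = betaMeasure β {x | t ≤ x 1} := by
  set e2 : EE := !₂[0, 1] with he2
  have h2 : ‖e2‖ = 1 := by
    have : ‖e2‖ ^ 2 = 1 := by rw [normsq]; simp [he2]
    nlinarith [norm_nonneg e2]
  have h3 := Submodule.reflection_sub (v := e2) (w := e) (by rw [he, h2])
  set ρ := (ℝ ∙ (e2 - e))ᗮ.reflection with hρ
  have hm : MeasurableSet {x : EE | t ≤ inner ℝ x e} :=
    measurableSet_le measurable_const (by fun_prop)
  rw [← (bm_isom β ρ).measure_preimage hm.nullMeasurableSet]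
  congr 1
  ext x
  simp only [Set.mem_preimage, Set.mem_ofPred_eq]
  rw [← h3, LinearIsometryEquiv.inner_map_map, inner2]
  simp [he2]

lemma rden_slice {β R : ℝ} (hR : 0 < R) (s : ℝ) :
    rden β (1 - R + R * s ^ 2) = R ^ β * rden β (s ^ 2) := by
  unfold rden
  have : 1 - R + R * s ^ 2 ≤ 1 ↔ s ^ 2 ≤ 1 := by
    constructor <;> intro h <;> nlinarith
  simp only [this]
  split_ifs with h
  · rw [show 1 - (1 - R + R * s ^ 2) = R * (1 - s ^ 2) by ring,
      Real.mul_rpow hR.le (by linarith)]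
    ring
  · simp

noncomputable def kk (β : ℝ) : ℝ≥0∞ := ∫⁻ s : ℝ, ENNReal.ofReal (rden β (s ^ 2))

lemma inner_slice (β b : ℝ) (hb : b ^ 2 < 1) :
    ∫⁻ a : ℝ, ENNReal.ofReal (rden β (a ^ 2 + b ^ 2)) = ENNReal.ofReal ((1 - b ^ 2) ^ (β + 1 / 2)) * kk β := by
  have hR : 0 < 1 - b ^ 2 := by linarith
  rw [lint_affine _ (Real.sqrt (1 - b ^ 2)) 0 (Real.sqrt_pos.2 hR).ne']
  have : ∀ s, rden β ((0 + √(1 - b ^ 2) * s) ^ 2 + b ^ 2) = (1 - b ^ 2) ^ β * rden β (s ^ 2) := by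
    intro s
    rw [← rden_slice hR]
    congr 1
    rw [zero_add, mul_pow, Real.sq_sqrt hR.le]; ring
  simp only [this]
  rw [kk, ← lintegral_const_mul _ (by exact ((rden_meas β).comp (by fun_prop)).ennreal_ofReal)]
  refine lintegral_congr fun s => ?_
  rw [ENNReal.ofReal_mul (by positivity), ← mul_assoc, ← ENNReal.ofReal_mul (by positivity),
    abs_of_nonneg (Real.sqrt_nonneg _), Real.sqrt_eq_rpow, ← Real.rpow_add hR, add_comm β]

lemma cap_lint {β : ℝ} (t : ℝ) (ht : -1 ≤ t) :
    betaMeasure β {x | t ≤ x 1} = (∫⁻ b in Set.Icc t 1, ENNReal.ofReal ((1 - b ^ 2) ^ (β + 1 / 2))) * kk β := by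
  have hm : MeasurableSet {x : EE | t ≤ x 1} := measurableSet_le measurable_const (by fun_prop)
  have hmd : Measurable fun p : ℝ × ℝ => ENNReal.ofReal (rden β (p.1 ^ 2 + p.2 ^ 2)) :=
    ((rden_meas β).comp (by fun_prop)).ennreal_ofReal
  rw [← lintegral_indicator_one hm, bm_lint β _ (measurable_one.indicator hm),
    lintegral_lintegral_swap, ← lintegral_mul_const _ (by fun_prop),
    ← lintegral_indicator measurableSet_Icc]
  · refine lintegral_congr_ae ?_
    have hne : ∀ᵐ b : ℝ, b ≠ 1 := by simp [ae_iff]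
    have hne' : ∀ᵐ b : ℝ, b ≠ -1 := by simp [ae_iff]
    filter_upwards [hne, hne'] with b h1 h2
    by_cases htb : t ≤ b
    · by_cases hb1 : b ≤ 1
      · have hb : b ^ 2 < 1 := by
          have h3 : b < 1 := lt_of_le_of_ne hb1 h1
          have h4 : -1 < b := lt_of_le_of_ne (ht.trans htb) (Ne.symm h2)
          nlinarith
        rw [Set.indicator_of_mem (Set.mem_Icc.2 ⟨htb, hb1⟩), ← inner_slice β b hb]
        simp [Set.indicator, htb]
      · have : ∀ a : ℝ, rden β (a ^ 2 + b ^ 2) = 0 := by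
          intro a
          unfold rden
          rw [if_neg]
          nlinarith [sq_nonneg a]
        rw [Set.indicator_of_notMem (fun h => hb1 h.2)]
        simp [this]
    · rw [Set.indicator_of_notMem (fun h => htb h.1)]
      simp [Set.indicator, htb]
  · refine (hmd.mul ?_).aemeasurable
    refine (measurable_one.indicator hm).comp ?_
    have h1 := (PiLp.volume_preserving_toLp (Fin 2)).measurable
    exact h1.comp (volume_preserving_finTwoArrow ℝ).symm.measurable

noncomputable def cdI (β t : ℝ) : ℝ := ∫ b in t..1, (1 - b ^ 2) ^ (β + 1 / 2)

lemma cdI_cont {β : ℝ} (hβ : 0 ≤ β) : Continuous fun b : ℝ => (1 - b ^ 2) ^ (β + 1 / 2) :=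
  Continuous.rpow_const (by fun_prop) fun _ => Or.inr (by positivity)

lemma cap_lint' {β : ℝ} (hβ : 0 ≤ β) (t : ℝ) (ht : -1 ≤ t) (ht1 : t ≤ 1) :
    betaMeasure β {x | t ≤ x 1} = ENNReal.ofReal (cdI β t) * kk β := by
  rw [cap_lint t ht, cdI, intervalIntegral.integral_of_le ht1, ← integral_Icc_eq_integral_Ioc,
    ofReal_integral_eq_lintegral_ofReal]
  · exact (cdI_cont hβ).continuousOn.integrableOn_compact isCompact_Icc
  · refine (ae_restrict_iff' measurableSet_Icc).2 (Eventually.of_forall fun b hb => ?_)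
    have : 0 ≤ 1 - b ^ 2 := by nlinarith [hb.1, hb.2]
    simp only [Pi.zero_apply]; positivity

lemma rp_int {q : ℝ} (hq : 0 ≤ q) (s : ℝ) (hs : 0 ≤ s) :
    ∫ b in (1 - s)..1, (1 - b) ^ q = s ^ (q + 1) / (q + 1) := by
  rw [intervalIntegral.integral_comp_sub_left (fun w => w ^ q) 1, integral_rpow (Or.inl (by linarith))]
  rw [sub_self, Real.zero_rpow (by linarith), sub_zero]
  congr 2; ring

lemma cdI_le {β : ℝ} (hβ : 0 ≤ β) (s : ℝ) (hs : 0 ≤ s) (hs2 : s ≤ 2) :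
    cdI β (1 - s) ≤ 2 ^ (β + 1 / 2) * (s ^ (β + 3 / 2) / (β + 3 / 2)) := by
  rw [show β + 3 / 2 = (β + 1 / 2) + 1 by ring, ← rp_int (by positivity) s hs, cdI,
    ← intervalIntegral.integral_const_mul]
  refine intervalIntegral.integral_mono_on (by linarith) ((cdI_cont hβ).intervalIntegrable _ _) ?_ ?_
  · exact (continuous_const.mul (Continuous.rpow_const (by fun_prop) fun _ =>
      Or.inr (by positivity))).intervalIntegrable _ _
  · intro b hb
    rw [← Real.mul_rpow (by norm_num) (by linarith [hb.2])]
    refine Real.rpow_le_rpow ?_ ?_ (by positivity)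
    · nlinarith [hb.1, hb.2]
    · nlinarith [hb.1, hb.2]

lemma cdI_ge {β : ℝ} (hβ : 0 ≤ β) (s : ℝ) (hs : 0 ≤ s) (hs2 : s ≤ 2) :
    (2 - s) ^ (β + 1 / 2) * (s ^ (β + 3 / 2) / (β + 3 / 2)) ≤ cdI β (1 - s) := by
  rw [show β + 3 / 2 = (β + 1 / 2) + 1 by ring, ← rp_int (by positivity) s hs, cdI,
    ← intervalIntegral.integral_const_mul]
  refine intervalIntegral.integral_mono_on (by linarith) ?_ ((cdI_cont hβ).intervalIntegrable _ _) ?_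
  · exact (continuous_const.mul (Continuous.rpow_const (by fun_prop) fun _ =>
      Or.inr (by positivity))).intervalIntegrable _ _
  · intro b hb
    rw [← Real.mul_rpow (by linarith) (by linarith [hb.2])]
    refine Real.rpow_le_rpow ?_ ?_ (by positivity)
    · exact mul_nonneg (by linarith) (by linarith [hb.2])
    · nlinarith [hb.1, hb.2]

lemma abs_coord (x : EE) (i : Fin 2) : |x i| ≤ ‖x‖ := by
  simpa using PiLp.norm_apply_le x i

lemma kk_pos {β : ℝ} (hβ : 0 ≤ β) : 0 < kk β := by
  by_contra h
  have h0 : kk β = 0 := by simpa using h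
  have := bm_prob hβ
  have h2 := cap_lint' hβ (-1) le_rfl (by norm_num)
  rw [h0, mul_zero] at h2
  have h3 : betaMeasure β {x | -1 ≤ x 1} = betaMeasure β Set.univ := by
    refine measure_congr (eventuallyEq_univ.2 ?_)
    filter_upwards [bm_disk β] with x hx
    have := abs_le.1 (abs_coord x 1)
    show -1 ≤ x 1
    linarith
  rw [h3, measure_univ] at h2
  exact one_ne_zero h2

lemma kk_lt_top {β : ℝ} (hβ : 0 ≤ β) : kk β < ⊤ := by
  have := bm_prob hβ
  have h2 := cap_lint' hβ 0 (by norm_num) (by norm_num)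
  by_contra h
  have h0 : kk β = ⊤ := by simpa using h
  have h3 := cdI_ge hβ 1 (by norm_num) (by norm_num)
  rw [show (2:ℝ) - 1 = 1 by norm_num, Real.one_rpow, Real.one_rpow, sub_self] at h3
  have h4 : 0 < cdI β 0 := lt_of_lt_of_le (by positivity) h3
  rw [h0, ENNReal.mul_top (by simpa using h4)] at h2
  exact measure_ne_top _ _ h2

/-- mass of the cap of height `s` -/
noncomputable def capm (β s : ℝ) : ℝ := (betaMeasure β).real {x | 1 - s ≤ x 1}

lemma capm_eq {β : ℝ} (hβ : 0 ≤ β) (s : ℝ) (hs : 0 ≤ s) (hs2 : s ≤ 2) :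
    capm β s = cdI β (1 - s) * (kk β).toReal := by
  have h3 := (cdI_ge hβ s hs hs2)
  have h4 : 0 ≤ cdI β (1 - s) := le_trans (by have : 0 ≤ 2 - s := by linarith
                                              positivity) h3
  rw [capm, Measure.real, cap_lint' hβ _ (by linarith) (by linarith), ENNReal.toReal_mul,
    ENNReal.toReal_ofReal h4]

noncomputable def k1 (β : ℝ) : ℝ := (kk β).toReal / (β + 3 / 2)

lemma k1_pos {β : ℝ} (hβ : 0 ≤ β) : 0 < k1 β := by
  have := ENNReal.toReal_pos (kk_pos hβ).ne' (kk_lt_top hβ).ne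
  unfold k1; positivity

lemma capm_le {β : ℝ} (hβ : 0 ≤ β) (s : ℝ) (hs : 0 ≤ s) (hs2 : s ≤ 2) :
    capm β s ≤ 2 ^ (β + 1 / 2) * k1 β * s ^ (β + 3 / 2) := by
  rw [capm_eq hβ s hs hs2, k1]
  have := mul_le_mul_of_nonneg_right (cdI_le hβ s hs hs2) (ENNReal.toReal_nonneg (a := kk β))
  calc _ ≤ _ := this
    _ = _ := by ring

lemma capm_ge {β : ℝ} (hβ : 0 ≤ β) (s : ℝ) (hs : 0 ≤ s) (hs2 : s ≤ 2) :
    (2 - s) ^ (β + 1 / 2) * k1 β * s ^ (β + 3 / 2) ≤ capm β s := by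
  rw [capm_eq hβ s hs hs2, k1]
  have := mul_le_mul_of_nonneg_right (cdI_ge hβ s hs hs2) (ENNReal.toReal_nonneg (a := kk β))
  calc _ = _ := by ring
    _ ≤ _ := this

lemma capm_mono {β : ℝ} (hβ : 0 ≤ β) : Monotone (capm β) := by
  intro a b hab
  have := bm_prob hβ
  refine measureReal_mono fun x hx => ?_
  have : 1 - a ≤ x 1 := hx
  show 1 - b ≤ x 1
  linarith

lemma capm_nonneg (β s : ℝ) : 0 ≤ capm β s := measureReal_nonneg
lemma capm_le_one {β : ℝ} (hβ : 0 ≤ β) (s : ℝ) : capm β s ≤ 1 := by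
  have := bm_prob hβ
  exact measureReal_le_one

noncomputable def c0 (β : ℝ) : ℝ := k1 β * 2 ^ (-(β + 3 / 2))

lemma c0_pos {β : ℝ} (hβ : 0 ≤ β) : 0 < c0 β := by
  have := k1_pos hβ
  unfold c0; positivity

lemma capm_lb {β : ℝ} (hβ : 0 ≤ β) (s : ℝ) (hs : 0 ≤ s) (hs2 : s ≤ 2) :
    c0 β * s ^ (β + 3 / 2) ≤ capm β s := by
  have hk := k1_pos hβ
  by_cases h1 : s ≤ 1
  · refine le_trans ?_ (capm_ge hβ s hs hs2)
    refine mul_le_mul_of_nonneg_right ?_ (by positivity)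
    have a1 : (2:ℝ) ^ (-(β + 3 / 2)) ≤ 1 := Real.rpow_le_one_of_one_le_of_nonpos (by norm_num) (by linarith)
    have a2 : 1 ≤ (2 - s) ^ (β + 1 / 2) := Real.one_le_rpow (by linarith) (by positivity)
    unfold c0
    nlinarith
  · have h2 := capm_ge hβ 1 (by norm_num) (by norm_num)
    rw [show (2:ℝ) - 1 = 1 by norm_num, Real.one_rpow, Real.one_rpow, one_mul, mul_one] at h2
    refine le_trans ?_ (h2.trans (capm_mono hβ (not_le.1 h1).le))
    unfold c0
    have a3 : s ^ (β + 3 / 2) ≤ 2 ^ (β + 3 / 2) := Real.rpow_le_rpow hs hs2 (by positivity)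
    have a4 : (2:ℝ) ^ (-(β + 3 / 2)) * 2 ^ (β + 3 / 2) = 1 := by
      rw [← Real.rpow_add (by norm_num)]; simp
    calc k1 β * 2 ^ (-(β + 3 / 2)) * s ^ (β + 3 / 2) ≤ k1 β * 2 ^ (-(β + 3 / 2)) * 2 ^ (β + 3 / 2) := by
          gcongr
      _ = k1 β := by rw [mul_assoc, a4, mul_one]

end CP

namespace CP
open MeasureTheory Filter Topology

lemma cap_diam {h r : ℝ} (h1 : h ≤ 1) (hr0 : 0 ≤ r) (hr : 8 * h ≤ r ^ 2) {p q u : EE} (hp : ‖p‖ ≤ 1)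
    (hq : ‖q‖ ≤ 1) (hu : ‖u‖ = 1) (hpu : 1 - h ≤ inner ℝ p u) (hqu : 1 - h ≤ inner ℝ q u) :
    dist p q ≤ r := by
  have hpar := parallelogram_law_with_norm ℝ p q
  have h2 : 2 - 2 * h ≤ ‖p + q‖ := by
    have := real_inner_le_norm (p + q) u
    rw [hu, mul_one, inner_add_left] at this
    linarith
  rw [dist_eq_norm]
  refine abs_le_of_sq_le_sq' ?_ hr0 |>.2
  have h3 : (2 - 2 * h) ^ 2 ≤ ‖p + q‖ ^ 2 := pow_le_pow_left₀ (by linarith) h2 2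
  have h4 : ‖p‖ ^ 2 ≤ 1 := pow_le_one₀ (norm_nonneg p) hp
  have h5 : ‖q‖ ^ 2 ≤ 1 := pow_le_one₀ (norm_nonneg q) hq
  nlinarith [sq_nonneg h]

structure Nice {n : ℕ} (h r L : ℝ) (x : Fin n → EE) : Prop where
  disk : ∀ i, ‖x i‖ ≤ 1
  hit : ∀ u : EE, ‖u‖ = 1 → ∀ i j, ∃ l, l ≠ i ∧ l ≠ j ∧ 1 - h ≤ inner ℝ (x l) u
  loc : ∀ p : EE, ‖p‖ ≤ 1 → 1 - h ≤ ‖p‖ → ∀ s : Finset (Fin n),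
    (∀ i ∈ s, 1 - h ≤ ‖x i‖ ∧ dist (x i) p ≤ 2 * r) → (s.card : ℝ) ≤ L

def Near (h r : ℝ) (p q : EE) : Prop := 1 - h ≤ ‖p‖ ∧ 1 - h ≤ ‖q‖ ∧ dist p q ≤ r

lemma inner_norm {h : ℝ} {p u : EE} (hu : ‖u‖ = 1) (hpu : 1 - h ≤ inner ℝ p u) : 1 - h ≤ ‖p‖ := by
  have := real_inner_le_norm p u
  rw [hu, mul_one] at this
  linarith

lemma vert_loc {n : ℕ} {h r L : ℝ} {x : Fin n → EE} (hx : Nice h r L x) {i : Fin n} (hv : Vert x i) :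
    ∃ u : EE, 0 < u 1 ∧ ‖u‖ = 1 ∧ (∀ j, j ≠ i → (inner ℝ (x j) u : ℝ) < inner ℝ (x i) u) ∧
      1 - h ≤ inner ℝ (x i) u := by
  obtain ⟨u, hu, huj⟩ := hv
  have hu0 : u ≠ 0 := by rintro rfl; simp at hu
  have hn : 0 < ‖u‖ := norm_pos_iff.2 hu0
  have h1 : ‖(‖u‖⁻¹) • u‖ = 1 := by rw [norm_smul, norm_inv, norm_norm, inv_mul_cancel₀ hn.ne']
  have h3 : ∀ j, j ≠ i → (inner ℝ (x j) ((‖u‖⁻¹) • u) : ℝ) < inner ℝ (x i) ((‖u‖⁻¹) • u) := by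
    intro j hj
    rw [inner_smul_right, inner_smul_right]
    exact mul_lt_mul_of_pos_left (huj j hj) (by positivity)
  refine ⟨(‖u‖⁻¹) • u, ?_, h1, h3, ?_⟩
  · simp only [PiLp.smul_apply, smul_eq_mul]; positivity
  · obtain ⟨l, hl, _, hl2⟩ := hx.hit _ h1 i i
    exact hl2.trans (h3 l hl).le

lemma vert_A {n : ℕ} {h r L : ℝ} {x : Fin n → EE} (hx : Nice h r L x) {i : Fin n} (hv : Vert x i) :
    1 - h ≤ ‖x i‖ := by
  obtain ⟨u, _, hu, _, hi⟩ := vert_loc hx hv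
  exact inner_norm hu hi

structure HR (h r : ℝ) : Prop where
  h1 : h ≤ 1
  hr0 : 0 ≤ r
  hr : 8 * h ≤ r ^ 2

lemma vert_change {n : ℕ} {h r L : ℝ} (H : HR h r) {x y : Fin n → EE} (hx : Nice h r L x) (hy : Nice h r L y) {i j : Fin n} (hij : i ≠ j)
    (hxy : ∀ k, k ≠ j → x k = y k) (hv : Vert x i) (hn : ¬ Vert y i) : Near h r (x i) (y j) := by
  obtain ⟨u, hu0, hu, hui, hi⟩ := vert_loc hx hv
  have : ∃ k, k ≠ i ∧ (inner ℝ (y i) u : ℝ) ≤ inner ℝ (y k) u := by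
    by_contra hcon
    push Not at hcon
    exact hn ⟨u, hu0, hcon⟩
  obtain ⟨k, hk, hk2⟩ := this
  have hkj : k = j := by
    by_contra hkj
    rw [← hxy i hij, ← hxy k hkj] at hk2
    exact absurd (hui k hk) (not_lt.2 hk2)
  subst hkj
  rw [← hxy i hij] at hk2
  have hk3 := hi.trans hk2
  exact ⟨inner_norm hu hi, inner_norm hu hk3, cap_diam H.h1 H.hr0 H.hr (hx.disk i) (hy.disk k) hu hi hk3⟩

lemma vf_change {n : ℕ} {h r L : ℝ} (H : HR h r) {x y : Fin n → EE} (hx : Nice h r L x) (hy : Nice h r L y) {i j : Fin n} (hij : i ≠ j)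
    (hxy : ∀ k, k ≠ j → x k = y k) (hne : vf x i ≠ vf y i) :
    Near h r (x i) (x j) ∨ Near h r (x i) (y j) := by
  by_cases hv : Vert x i <;> by_cases hw : Vert y i
  · simp [vf, hv, hw] at hne
  · exact Or.inr (vert_change H hx hy hij hxy hv hw)
  · left
    rw [hxy i hij]
    exact vert_change H hy hx hij (fun k hk => (hxy k hk).symm) hw hv
  · simp [vf, hv, hw] at hne

lemma near_card {n : ℕ} {h r L : ℝ} (H : HR h r) {x : Fin n → EE} (hx : Nice h r L x) (p : EE) (hp : ‖p‖ ≤ 1) (hL : 0 ≤ L)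
    (s : Finset (Fin n)) (hs : ∀ i ∈ s, Near h r (x i) p) : (s.card : ℝ) ≤ L := by
  rcases s.eq_empty_or_nonempty with rfl | ⟨i, hi⟩
  · simpa using hL
  · exact hx.loc p hp (hs i hi).2.1 s fun k hk => ⟨(hs k hk).1, (hs k hk).2.2.trans (by linarith [H.hr0])⟩

lemma first_diff {n : ℕ} {h r L : ℝ} (H : HR h r) {x y : Fin n → EE} (hx : Nice h r L x) (hy : Nice h r L y) (hL : 1 ≤ L) {j : Fin n}
    (hxy : ∀ k, k ≠ j → x k = y k) : |ff x - ff y| ≤ 3 * L := by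
  classical
  have e : ff x - ff y = ∑ i, (vf x i - vf y i) := by simp [ff, Finset.sum_sub_distrib]
  have hb : ∀ i, |vf x i - vf y i| ≤ (if i = j then 1 else 0) + (if Near h r (x i) (x j) then 1 else 0)
      + (if Near h r (x i) (y j) then (1:ℝ) else 0) := by
    intro i
    have hle : |vf x i - vf y i| ≤ 1 := by
      rw [abs_le]
      constructor <;> linarith [vf_le x i, vf_le y i, vf_nonneg x i, vf_nonneg y i]
    by_cases hij : i = j
    · rw [if_pos hij]; split_ifs <;> linarith
    · by_cases hne : vf x i = vf y i
      · rw [hne, sub_self, abs_zero]; positivity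
      · rcases vf_change H hx hy hij hxy hne with hh | hh
        · rw [if_pos hh]; split_ifs <;> linarith
        · rw [if_pos hh]; split_ifs <;> linarith
  rw [e]
  refine (Finset.abs_sum_le_sum_abs _ _).trans ((Finset.sum_le_sum fun i _ => hb i).trans ?_)
  rw [Finset.sum_add_distrib, Finset.sum_add_distrib, Finset.sum_boole, Finset.sum_boole, Finset.sum_boole]
  have b1 := near_card H hx (x j) (hx.disk j) (by linarith) (Finset.univ.filter fun i => Near h r (x i) (x j))
    (by simp)
  have b2 := near_card H hx (y j) (hy.disk j) (by linarith) (Finset.univ.filter fun i => Near h r (x i) (y j))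
    (by simp)
  have b3 : (((Finset.univ.filter fun i => i = j).card : ℕ) : ℝ) = 1 := by
    rw [Finset.filter_eq' Finset.univ j]; simp
  linarith

lemma first_zero {n : ℕ} {h r L : ℝ} (H : HR h r) {x y : Fin n → EE} (hx : Nice h r L x) (hy : Nice h r L y) {j : Fin n}
    (hxy : ∀ k, k ≠ j → x k = y k) (hj : ¬ (1 - h ≤ ‖x j‖)) (hj' : ¬ (1 - h ≤ ‖y j‖)) : ff x = ff y := by
  unfold ff
  refine Finset.sum_congr rfl fun i _ => ?_
  by_cases hij : i = j
  · subst hij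
    have a : ¬ Vert x i := fun h => hj (vert_A hx h)
    have b : ¬ Vert y i := fun h => hj' (vert_A hy h)
    simp [vf, a, b]
  · by_contra hne
    rcases vf_change H hx hy hij hxy hne with hh | hh
    exacts [hj hh.2.1, hj' hh.2.1]

lemma near_tri {h r : ℝ} (H : HR h r) {p q w : EE} (a : Near h r p q) (b : Near h r p w) : Near h (2 * r) q w :=
  ⟨a.2.1, b.2.1, by
    have := dist_triangle q p w
    rw [dist_comm q p] at this
    linarith [a.2.2, b.2.2]⟩

lemma near_sym2 {h r : ℝ} (H : HR h r) {p q : EE} (a : Near h r p q) : Near h (2 * r) q p :=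
  ⟨a.2.1, a.1, by rw [dist_comm]; linarith [a.2.2, H.hr0]⟩

lemma near_two {h r : ℝ} (H : HR h r) {p q : EE} (a : Near h r p q) : Near h (2 * r) p q :=
  ⟨a.1, a.2.1, by linarith [a.2.2, H.hr0]⟩

lemma second_zero {n : ℕ} {h r L : ℝ} (H : HR h r) {x y x' y' : Fin n → EE} (hx : Nice h r L x) (hy : Nice h r L y)
    (hx' : Nice h r L x') (hy' : Nice h r L y') {i j : Fin n} (hij : i ≠ j)
    (hxy : ∀ k, k ≠ j → x k = y k) (hxy' : ∀ k, k ≠ j → x' k = y' k)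
    (hxx : ∀ k, k ≠ i → x k = x' k) (hyy : ∀ k, k ≠ i → y k = y' k)
    (n1 : ¬ Near h (2 * r) (x j) (x i)) (n2 : ¬ Near h (2 * r) (x j) (x' i))
    (n3 : ¬ Near h (2 * r) (y j) (x i)) (n4 : ¬ Near h (2 * r) (y j) (x' i)) :
    ff x - ff y = ff x' - ff y' := by
  have key : ∀ k, vf x k - vf y k = vf x' k - vf y' k := by
    intro k
    by_cases hki : k = i
    · subst hki
      have e1 : vf x k = vf y k := by
        by_contra hne
        rcases vf_change H hx hy hij hxy hne with hh | hh
        exacts [n1 (near_sym2 H hh), n3 (near_sym2 H hh)]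
      have e2 : vf x' k = vf y' k := by
        by_contra hne
        rcases vf_change H hx' hy' hij hxy' hne with hh | hh
        · rw [← hxx j hij.symm] at hh; exact n2 (near_sym2 H hh)
        · rw [← hyy j hij.symm] at hh; exact n4 (near_sym2 H hh)
      rw [e1, e2]; ring
    by_cases hkj : k = j
    · subst hkj
      have e1 : vf x k = vf x' k := by
        by_contra hne
        rcases vf_change H hx hx' hki hxx hne with hh | hh
        exacts [n1 (near_two H hh), n2 (near_two H hh)]
      have e2 : vf y k = vf y' k := by
        by_contra hne
        rcases vf_change H hy hy' hki hyy hne with hh | hh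
        · rw [← hxy i hij] at hh; exact n3 (near_two H hh)
        · rw [← hxy' i hij] at hh; exact n4 (near_two H hh)
      rw [e1, e2]
    by_cases c1 : vf x k = vf y k ∧ vf x' k = vf y' k
    · rw [c1.1, c1.2]; ring
    by_cases c2 : vf x k = vf x' k ∧ vf y k = vf y' k
    · rw [c2.1, c2.2]
    have d1 : Near h r (x k) (x j) ∨ Near h r (x k) (y j) := by
      by_contra hcon
      refine c1 ⟨?_, ?_⟩
      · by_contra hne
        exact hcon (vf_change H hx hy hkj hxy hne)
      · by_contra hne
        have := vf_change H hx' hy' hkj hxy' hne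
        rw [← hxx k hki, ← hxx j hij.symm, ← hyy j hij.symm] at this
        exact hcon this
    have d2 : Near h r (x k) (x i) ∨ Near h r (x k) (x' i) := by
      by_contra hcon
      refine c2 ⟨?_, ?_⟩
      · by_contra hne
        exact hcon (vf_change H hx hx' hki hxx hne)
      · by_contra hne
        have := vf_change H hy hy' hki hyy hne
        rw [← hxy k hkj, ← hxy i hij, ← hxy' i hij] at this
        exact hcon this
    exfalso
    rcases d1 with d1 | d1 <;> rcases d2 with d2 | d2
    exacts [n1 (near_tri H d1 d2), n2 (near_tri H d1 d2),
      n3 (near_tri H d1 d2), n4 (near_tri H d1 d2)]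
  have := Finset.sum_congr rfl fun k (_ : k ∈ Finset.univ) => key k
  simpa [ff, Finset.sum_sub_distrib] using this

end CP

namespace CP
open MeasureTheory Filter Topology

structure AllNice {n : ℕ} (h r L : ℝ) (z : Fin n → EE × EE) : Prop where
  a : ∀ m : ℕ, m ≤ n → Nice h r L (mix (ltS n m) z)
  b : ∀ j : Fin n, Nice h r L (mix {j} z)

lemma mix_app {n : ℕ} {α : Type*} (S : Finset (Fin n)) (z : Fin n → α × α) (i : Fin n) :
    mix S z i = if i ∈ S then (z i).2 else (z i).1 := rfl

lemma lt0 (n : ℕ) : ltS n 0 = ∅ := by simp [ltS]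
lemma ltn (n : ℕ) : ltS n n = Finset.univ := by simp [ltS]
lemma mem_ltS {n m : ℕ} {i : Fin n} : i ∈ ltS n m ↔ i.val < m := by simp [ltS]

lemma AllNice.e {n : ℕ} {h r L : ℝ} {z : Fin n → EE × EE} (hz : AllNice h r L z) :
    Nice h r L (mix ∅ z) := by simpa [lt0] using hz.a 0 (Nat.zero_le _)
lemma AllNice.u {n : ℕ} {h r L : ℝ} {z : Fin n → EE × EE} (hz : AllNice h r L z) :
    Nice h r L (mix Finset.univ z) := by simpa [ltn] using hz.a n le_rfl

lemma lt_off {n : ℕ} {α : Type*} (z : Fin n → α × α) (j k : Fin n) (hk : k ≠ j) :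
    mix (ltS n j) z k = mix (ltS n (j+1)) z k := by
  have : k.val ≠ j.val := fun h => hk (Fin.ext h)
  have : k.val < j.val ↔ k.val < j.val + 1 := by omega
  simp only [mix_app, mem_ltS, this]

lemma lt_at1 {n : ℕ} {α : Type*} (z : Fin n → α × α) (j : Fin n) : mix (ltS n j) z j = (z j).1 := by
  simp [mix_app, mem_ltS]
lemma lt_at2 {n : ℕ} {α : Type*} (z : Fin n → α × α) (j : Fin n) : mix (ltS n (j+1)) z j = (z j).2 := by
  simp [mix_app, mem_ltS]
lemma sg_off {n : ℕ} {α : Type*} (z : Fin n → α × α) (j k : Fin n) (hk : k ≠ j) :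
    mix ∅ z k = mix {j} z k := by simp [mix_app, hk]
lemma sg_at1 {n : ℕ} {α : Type*} (z : Fin n → α × α) (j : Fin n) : mix ∅ z j = (z j).1 := by simp [mix_app]
lemma sg_at2 {n : ℕ} {α : Type*} (z : Fin n → α × α) (j : Fin n) : mix {j} z j = (z j).2 := by simp [mix_app]

lemma mix_mem {n : ℕ} {α : Type*} (S : Finset (Fin n)) (z : Fin n → α × α) (i : Fin n) :
    mix S z i = (z i).1 ∨ mix S z i = (z i).2 := by
  rw [mix_app]; split_ifs <;> simp

lemma mix_agree {n : ℕ} {α : Type*} (S : Finset (Fin n)) {z z' : Fin n → α × α} {k : Fin n}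
    (h : z k = z' k) : mix S z k = mix S z' k := by rw [mix_app, mix_app, h]

lemma da_bound {n : ℕ} {h r L : ℝ} (H : HR h r) (hL : 1 ≤ L) {z : Fin n → EE × EE} (hz : AllNice h r L z)
    (j : Fin n) : |da ff j z| ≤ 3 * L :=
  first_diff H (hz.a _ j.2.le) (hz.a _ j.2) hL (lt_off z j)

lemma db_bound {n : ℕ} {h r L : ℝ} (H : HR h r) (hL : 1 ≤ L) {z : Fin n → EE × EE} (hz : AllNice h r L z)
    (j : Fin n) : |db ff j z| ≤ 3 * L :=
  first_diff H hz.e (hz.b _) hL (sg_off z j)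

lemma da_zero {n : ℕ} {h r L : ℝ} (H : HR h r) {z : Fin n → EE × EE} (hz : AllNice h r L z)
    (j : Fin n) (h1 : ¬ (1 - h ≤ ‖(z j).1‖)) (h2 : ¬ (1 - h ≤ ‖(z j).2‖)) : da ff j z = 0 :=
  sub_eq_zero.2 (first_zero H (hz.a _ j.2.le) (hz.a _ j.2) (lt_off z j) (by rwa [lt_at1]) (by rwa [lt_at2]))

lemma db_zero {n : ℕ} {h r L : ℝ} (H : HR h r) {z : Fin n → EE × EE} (hz : AllNice h r L z)
    (j : Fin n) (h1 : ¬ (1 - h ≤ ‖(z j).1‖)) (h2 : ¬ (1 - h ≤ ‖(z j).2‖)) : db ff j z = 0 :=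
  sub_eq_zero.2 (first_zero H hz.e (hz.b _) (sg_off z j) (by rwa [sg_at1]) (by rwa [sg_at2]))

def Close (h r : ℝ) (p : EE × EE) (q : EE) : Prop := Near h (2 * r) p.1 q ∨ Near h (2 * r) p.2 q
def Close4 (h r : ℝ) (p : EE × EE) (q q' : EE × EE) : Prop :=
  (Close h r p q.1 ∨ Close h r p q.2) ∨ (Close h r p q'.1 ∨ Close h r p q'.2)

lemma not_close {h r : ℝ} {p q q' : EE × EE} (hc : ¬ Close4 h r p q q') {s w : EE}
    (hs : s = p.1 ∨ s = p.2) (hw : (w = q.1 ∨ w = q.2) ∨ (w = q'.1 ∨ w = q'.2)) : ¬ Near h (2 * r) s w := by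
  intro hn
  apply hc
  unfold Close4 Close
  rcases hs with rfl | rfl <;> rcases hw with (rfl | rfl) | (rfl | rfl) <;> simp [hn]

lemma diff_eq {n : ℕ} {h r L : ℝ} (H : HR h r) {z z' : Fin n → EE × EE} {i j : Fin n} (hij : i ≠ j)
    (hzz : ∀ k, k ≠ i → z k = z' k) (hc : ¬ Close4 h r (z j) (z i) (z' i)) (S S' : Finset (Fin n))
    (hS : ∀ w : Fin n → EE × EE, ∀ k, k ≠ j → mix S w k = mix S' w k)
    (n1 : Nice h r L (mix S z)) (n2 : Nice h r L (mix S' z)) (n3 : Nice h r L (mix S z'))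
    (n4 : Nice h r L (mix S' z')) :
    ff (mix S z) - ff (mix S' z) = ff (mix S z') - ff (mix S' z') := by
  refine second_zero H n1 n2 n3 n4 hij (hS z) (hS z') (fun k hk => mix_agree S (hzz k hk))
    (fun k hk => mix_agree S' (hzz k hk)) ?_ ?_ ?_ ?_
  · exact not_close hc (mix_mem S z j) (Or.inl (mix_mem S z i))
  · exact not_close hc (mix_mem S z j) (Or.inr (mix_mem S z' i))
  · exact not_close hc (mix_mem S' z j) (Or.inl (mix_mem S z i))
  · exact not_close hc (mix_mem S' z j) (Or.inr (mix_mem S z' i))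

lemma close_card {n : ℕ} {h r L : ℝ} (H : HR h r) (hL : 1 ≤ L) {z : Fin n → EE × EE} (hz : AllNice h r L z)
    (q : EE) (hq : ‖q‖ ≤ 1) (s : Finset (Fin n)) (hs : ∀ j ∈ s, Close h r (z j) q) : (s.card : ℝ) ≤ 2 * L := by
  classical
  have hone : ∀ (S : Finset (Fin n)) (_ : Nice h r L (mix S z)),
      (((s.filter fun j => Near h (2 * r) (mix S z j) q).card : ℕ) : ℝ) ≤ L := by
    intro S hN
    rcases (s.filter fun j => Near h (2 * r) (mix S z j) q).eq_empty_or_nonempty with h0 | ⟨j, hj⟩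
    · rw [h0]; simp; linarith
    · have := (Finset.mem_filter.1 hj).2
      refine hN.loc q hq this.2.1 _ fun k hk => ?_
      have := (Finset.mem_filter.1 hk).2
      exact ⟨this.1, this.2.2⟩
  have a := hone ∅ hz.e
  have b := hone Finset.univ hz.u
  have hsub : s ⊆ (s.filter fun j => Near h (2 * r) (mix ∅ z j) q)
      ∪ (s.filter fun j => Near h (2 * r) (mix Finset.univ z j) q) := by
    intro j hj
    rw [Finset.mem_union, Finset.mem_filter, Finset.mem_filter]
    rcases hs j hj with hh | hh
    · left; exact ⟨hj, by simpa [mix_app] using hh⟩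
    · right; exact ⟨hj, by simpa [mix_app] using hh⟩
  have hc := (Finset.card_le_card hsub).trans (Finset.card_union_le _ _)
  have hc' := (Nat.cast_le (α := ℝ)).2 hc
  push_cast at hc'
  linarith

lemma TT_diff {n : ℕ} {h r L : ℝ} (H : HR h r) (hL : 1 ≤ L) {z z' : Fin n → EE × EE} {i : Fin n}
    (hzz : ∀ k, k ≠ i → z k = z' k) (hz : AllNice h r L z) (hz' : AllNice h r L z') :
    |TT ff z - TT ff z'| ≤ 200 * L ^ 3 := by
  classical
  have hb : ∀ j, |da ff j z * db ff j z - da ff j z' * db ff j z'| ≤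
      (if j = i then 18 * L ^ 2 else 0) + (if j ≠ i ∧ Close4 h r (z j) (z i) (z' i) then 18 * L ^ 2 else 0) := by
    intro j
    have a1 := da_bound H hL hz j
    have a2 := db_bound H hL hz j
    have a3 := da_bound H hL hz' j
    have a4 := db_bound H hL hz' j
    have hall : |da ff j z * db ff j z - da ff j z' * db ff j z'| ≤ 18 * L ^ 2 := by
      refine (abs_sub _ _).trans ?_
      rw [abs_mul, abs_mul]
      have b1 : |da ff j z| * |db ff j z| ≤ (3 * L) * (3 * L) := mul_le_mul a1 a2 (abs_nonneg _) (by linarith)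
      have b2 : |da ff j z'| * |db ff j z'| ≤ (3 * L) * (3 * L) := mul_le_mul a3 a4 (abs_nonneg _) (by linarith)
      nlinarith
    by_cases hji : j = i
    · rw [if_pos hji, if_neg (by simp [hji])]; simpa using hall
    · by_cases hc : Close4 h r (z j) (z i) (z' i)
      · rw [if_neg hji, if_pos ⟨hji, hc⟩]; simpa using hall
      · have e1 : da ff j z = da ff j z' :=
          diff_eq H (Ne.symm hji) hzz hc _ _ (fun w => lt_off w j) (hz.a _ j.2.le) (hz.a _ j.2)
            (hz'.a _ j.2.le) (hz'.a _ j.2)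
        have e2 : db ff j z = db ff j z' :=
          diff_eq H (Ne.symm hji) hzz hc _ _ (fun w => sg_off w j) hz.e (hz.b _) hz'.e (hz'.b _)
        rw [e1, e2, sub_self, abs_zero, if_neg hji, if_neg (fun h => hc h.2)]
        simp
  have e : TT ff z - TT ff z' = (1/2) * ∑ j, (da ff j z * db ff j z - da ff j z' * db ff j z') := by
    rw [Finset.sum_sub_distrib, TT, TT]; ring
  have hs := (Finset.abs_sum_le_sum_abs (fun j => da ff j z * db ff j z - da ff j z' * db ff j z') Finset.univ).trans
    (Finset.sum_le_sum fun j _ => hb j)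
  rw [Finset.sum_add_distrib, ← Finset.sum_filter, ← Finset.sum_filter, Finset.sum_const, Finset.sum_const,
    nsmul_eq_mul, nsmul_eq_mul] at hs
  have b3 : (((Finset.univ.filter fun j => j = i).card : ℕ) : ℝ) = 1 := by
    rw [Finset.filter_eq' Finset.univ i]; simp
  have hcard : (((Finset.univ.filter fun j => j ≠ i ∧ Close4 h r (z j) (z i) (z' i)).card : ℕ) : ℝ) ≤ 8 * L := by
    set s := Finset.univ.filter fun j => j ≠ i ∧ Close4 h r (z j) (z i) (z' i) with hsdef
    have d1 := hz.e.disk i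
    have d2 := hz.u.disk i
    have d3 := hz'.e.disk i
    have d4 := hz'.u.disk i
    simp only [mix_app, Finset.notMem_empty, Finset.mem_univ, if_true, if_false] at d1 d2 d3 d4
    have c1 := close_card H hL hz _ d1 (s.filter fun j => Close h r (z j) (z i).1) (by simp)
    have c2 := close_card H hL hz _ d2 (s.filter fun j => Close h r (z j) (z i).2) (by simp)
    have c3 := close_card H hL hz _ d3 (s.filter fun j => Close h r (z j) (z' i).1) (by simp)
    have c4 := close_card H hL hz _ d4 (s.filter fun j => Close h r (z j) (z' i).2) (by simp)
    have hsub : s ⊆ ((s.filter fun j => Close h r (z j) (z i).1) ∪ (s.filter fun j => Close h r (z j) (z i).2))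
      ∪ ((s.filter fun j => Close h r (z j) (z' i).1) ∪ (s.filter fun j => Close h r (z j) (z' i).2)) := by
      intro j hj
      have hj2 := (Finset.mem_filter.1 hj).2.2
      simp only [Finset.mem_union, Finset.mem_filter, hj, true_and]
      exact hj2
    have hc := (Finset.card_le_card hsub).trans ((Finset.card_union_le _ _).trans
      (add_le_add (Finset.card_union_le _ _) (Finset.card_union_le _ _)))
    have hc' := (Nat.cast_le (α := ℝ)).2 hc
    push_cast at hc'
    linarith
  rw [b3, one_mul] at hs
  rw [e, abs_mul, abs_of_pos (by norm_num : (0:ℝ) < 1/2)]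
  have hL2 : 0 ≤ L ^ 2 := sq_nonneg L
  have h23 : L ^ 2 ≤ L ^ 3 := by nlinarith
  have h4 := mul_le_mul_of_nonneg_right hcard (by positivity : (0:ℝ) ≤ 18 * L ^ 2)
  have h5 : 8 * L * (18 * L ^ 2) = 144 * L ^ 3 := by ring
  rw [h5] at h4
  have h6 := hs.trans (add_le_add_right h4 _)
  linarith

lemma TT_zero {n : ℕ} {h r L : ℝ} (H : HR h r) {z z' : Fin n → EE × EE} {i : Fin n}
    (hzz : ∀ k, k ≠ i → z k = z' k) (hz : AllNice h r L z) (hz' : AllNice h r L z')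
    (h1 : ¬ (1 - h ≤ ‖(z i).1‖)) (h2 : ¬ (1 - h ≤ ‖(z i).2‖)) (h3 : ¬ (1 - h ≤ ‖(z' i).1‖))
    (h4 : ¬ (1 - h ≤ ‖(z' i).2‖)) : TT ff z = TT ff z' := by
  unfold TT
  congr 1
  refine Finset.sum_congr rfl fun j _ => ?_
  by_cases hji : j = i
  · subst hji
    rw [da_zero H hz j h1 h2, da_zero H hz' j h3 h4]; simp
  · have hc : ¬ Close4 h r (z j) (z i) (z' i) := by
      unfold Close4 Close
      rintro (((hc | hc) | (hc | hc)) | ((hc | hc) | (hc | hc)))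
      all_goals first | exact h1 hc.2.1 | exact h2 hc.2.1 | exact h3 hc.2.1 | exact h4 hc.2.1
    have e1 : da ff j z = da ff j z' :=
      diff_eq H (Ne.symm hji) hzz hc _ _ (fun w => lt_off w j) (hz.a _ j.2.le) (hz.a _ j.2)
        (hz'.a _ j.2.le) (hz'.a _ j.2)
    have e2 : db ff j z = db ff j z' :=
      diff_eq H (Ne.symm hji) hzz hc _ _ (fun w => sg_off w j) hz.e (hz.b _) hz'.e (hz'.b _)
    rw [e1, e2]

end CP

namespace CP
open MeasureTheory Filter Topology

noncomputable def net (n k : ℕ) : EE := !₂[Real.cos (2 * Real.pi * k / n - Real.pi), Real.sin (2 * Real.pi * k / n - Real.pi)]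

lemma nsq (x : EE) (h : x 0 ^ 2 + x 1 ^ 2 = 1) : ‖x‖ = 1 := by
  have := normsq x
  rw [h] at this
  have h2 := norm_nonneg x
  nlinarith

lemma net_norm (n k : ℕ) : ‖net n k‖ = 1 := by
  apply nsq
  simp [net]

lemma net_close {n : ℕ} (hn : 0 < n) (u : EE) (hu : ‖u‖ = 1) : ∃ k ∈ Finset.range (n+1), ‖u - net n k‖ ≤ 2 * Real.pi / n := by
  have hz : ‖(⟨u 0, u 1⟩ : ℂ)‖ = 1 := by
    have h1 := normsq u
    rw [hu] at h1
    rw [Complex.norm_def, Complex.normSq_mk, show u 0 * u 0 + u 1 * u 1 = 1 by nlinarith, Real.sqrt_one]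
  set z : ℂ := ⟨u 0, u 1⟩ with hzd
  have hz0 : z ≠ 0 := by rw [← norm_pos_iff, hz]; norm_num
  have hc : Real.cos z.arg = u 0 := by rw [Complex.cos_arg hz0, hz]; simp [hzd]
  have hs : Real.sin z.arg = u 1 := by rw [Complex.sin_arg, hz]; simp [hzd]
  have hpi := Real.pi_pos
  have hn' : (0:ℝ) < n := by exact_mod_cast hn
  set w := (z.arg + Real.pi) * n / (2 * Real.pi) with hw
  have ha1 := Complex.neg_pi_lt_arg z
  have ha2 := Complex.arg_le_pi z
  have hw0 : 0 ≤ w := by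
    have : 0 ≤ z.arg + Real.pi := by linarith
    positivity
  have hwn : w ≤ n := by
    rw [hw, div_le_iff₀ (by positivity)]
    nlinarith
  refine ⟨⌊w⌋₊, ?_, ?_⟩
  · rw [Finset.mem_range, Nat.lt_succ_iff]
    exact Nat.floor_le_of_le hwn
  set k := ⌊w⌋₊
  have hk1 : (k:ℝ) ≤ w := Nat.floor_le hw0
  have hk2 : w < k + 1 := Nat.lt_floor_add_one w
  set θ := 2 * Real.pi * k / n - Real.pi with hθ
  have hd : |z.arg - θ| ≤ 2 * Real.pi / n := by
    have e : z.arg - θ = (w - k) * (2 * Real.pi / n) := by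
      rw [hw, hθ]; field_simp; ring
    rw [e, abs_mul, abs_of_nonneg (by positivity : 0 ≤ 2 * Real.pi / n), abs_of_nonneg (by linarith)]
    have : 0 ≤ 2 * Real.pi / n := by positivity
    nlinarith
  refine le_trans ?_ hd
  refine abs_le_of_sq_le_sq' ?_ (abs_nonneg _) |>.2
  rw [normsq, sq_abs]
  simp only [PiLp.sub_apply]
  have e0 : net n k 0 = Real.cos θ := by simp [net, hθ]
  have e1 : net n k 1 = Real.sin θ := by simp [net, hθ]
  rw [e0, e1, ← hc, ← hs]
  have h1 := Real.one_sub_sq_div_two_le_cos (x := z.arg - θ)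
  rw [Real.cos_sub] at h1
  nlinarith [Real.sin_sq_add_cos_sq z.arg, Real.sin_sq_add_cos_sq θ]

structure Good {n : ℕ} (t L : ℝ) (x : Fin n → EE) : Prop where
  disk : ∀ i, ‖x i‖ ≤ 1
  hit : ∀ k ∈ Finset.range (n+1), ∀ i j, ∃ l, l ≠ i ∧ l ≠ j ∧ 1 - t ≤ inner ℝ (x l) (net n k)
  loc : ∀ k ∈ Finset.range (n+1), ∑ i, Set.indicator {p : EE | 1 - 185 * t ≤ inner ℝ p (net n k)} (fun _ => (1:ℝ)) (x i) ≤ L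

lemma good_nice {n : ℕ} {t L : ℝ} {x : Fin n → EE} (hn : 0 < n) (ht : 0 < t) (ht1 : 5 * t ≤ 1/2)
    (hnt : (2 * Real.pi / n) ^ 2 ≤ 2 * t) (hx : Good t L x) : Nice (5 * t) (2 * √(10 * t)) L x := by
  set q := √(10 * t) with hq
  have hq0 : 0 < q := Real.sqrt_pos.2 (by linarith)
  have hq2 : q ^ 2 = 10 * t := Real.sq_sqrt (by linarith)
  have hcl : ∀ u : EE, ‖u‖ = 1 → ∃ k ∈ Finset.range (n+1), ‖u - net n k‖ ^ 2 ≤ 2 * t := by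
    intro u hu
    obtain ⟨k, hk, h⟩ := net_close hn u hu
    exact ⟨k, hk, (pow_le_pow_left₀ (norm_nonneg _) h 2).trans hnt⟩
  refine ⟨hx.disk, ?_, ?_⟩
  · intro u hu i j
    obtain ⟨k, hk, h⟩ := hcl u hu
    obtain ⟨l, hli, hlj, hl⟩ := hx.hit k hk i j
    refine ⟨l, hli, hlj, ?_⟩
    have hd := hx.disk l
    have hl2 := inner_norm (net_norm n k) hl
    have h1 := norm_sub_sq_real (x l) (net n k)
    rw [net_norm] at h1
    have h0 := norm_nonneg (x l)
    have h2 : ‖x l - net n k‖ ^ 2 ≤ 2 * t := by nlinarith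
    have h3 : ‖x l - u‖ ≤ ‖x l - net n k‖ + ‖u - net n k‖ := by
      rw [norm_sub_rev u]; exact norm_sub_le_norm_sub_add_norm_sub _ _ _
    have h4 : ‖x l - u‖ ^ 2 ≤ 8 * t := by
      have := pow_le_pow_left₀ (norm_nonneg _) h3 2
      nlinarith [sq_nonneg (‖x l - net n k‖ - ‖u - net n k‖)]
    have h5 := norm_sub_sq_real (x l) u
    rw [hu] at h5
    nlinarith
  · intro p hp1 hp s hs
    have hp0 : 0 < ‖p‖ := by linarith
    set u := (‖p‖⁻¹) • p with hu
    have hu1 : ‖u‖ = 1 := by rw [hu, norm_smul, norm_inv, norm_norm, inv_mul_cancel₀ hp0.ne']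
    have hpu : ‖p - u‖ ≤ 5 * t := by
      have : p - u = (‖p‖ - 1) • u := by
        rw [sub_smul, one_smul, hu, smul_smul, mul_inv_cancel₀ hp0.ne', one_smul]
      rw [this, norm_smul, hu1, mul_one, Real.norm_eq_abs, abs_le]
      constructor <;> linarith
    obtain ⟨k, hk, h⟩ := hcl u hu1
    refine le_trans ?_ (hx.loc k hk)
    have hin : ∀ i ∈ s, x i ∈ {p : EE | 1 - 185 * t ≤ inner ℝ p (net n k)} := by
      intro i hi
      obtain ⟨h1, h2⟩ := hs i hi
      have h3 : ‖x i - net n k‖ ≤ dist (x i) p + ‖p - u‖ + ‖u - net n k‖ := by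
        rw [dist_eq_norm]
        have := norm_add₃_le (a := x i - p) (b := p - u) (c := u - net n k)
        simpa using this
      have h4 : ‖u - net n k‖ ≤ q := abs_le_of_sq_le_sq' (by nlinarith) hq0.le |>.2
      have h5 : 5 * t ≤ q := abs_le_of_sq_le_sq' (by nlinarith) hq0.le |>.2
      have h6 : ‖x i - net n k‖ ≤ 6 * q := by linarith
      have h7 := pow_le_pow_left₀ (norm_nonneg _) h6 2
      have h8 := norm_sub_sq_real (x i) (net n k)
      rw [net_norm] at h8
      simp only [Set.mem_ofPred_eq]
      nlinarith [norm_nonneg (x i)]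
    calc (s.card : ℝ) = ∑ i ∈ s, Set.indicator {p : EE | 1 - 185 * t ≤ inner ℝ p (net n k)} (fun _ => (1:ℝ)) (x i) := by
          rw [Finset.sum_congr rfl fun i hi => Set.indicator_of_mem (hin i hi) _]; simp
      _ ≤ _ := Finset.sum_le_univ_sum_of_nonneg fun i => Set.indicator_nonneg (by simp) _

end CP

namespace CP
open MeasureTheory Filter Topology

section gen
variable {n : ℕ} {α : Type*} [MeasurableSpace α] (ν : Measure α) [IsProbabilityMeasure ν]

lemma hit_bound (C : Set α) (hC : MeasurableSet C) (i j : Fin n) :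
    (Measure.pi fun _ : Fin n => ν).real {x | ∀ l, l ≠ i → l ≠ j → x l ∉ C} ≤ Real.exp (-(ν.real C * (n - 2))) := by
  classical
  have e : {x : Fin n → α | ∀ l, l ≠ i → l ≠ j → x l ∉ C} =
      Set.pi Set.univ (fun l => if l = i ∨ l = j then Set.univ else Cᶜ) := by
    ext x
    simp only [Set.mem_ofPred_eq, Set.mem_pi, Set.mem_univ, true_imp_iff]
    refine forall_congr' fun l => ?_
    by_cases h1 : l = i <;> by_cases h2 : l = j <;> simp [h1, h2] <;> simp_all
  have hp1 : ν.real C ≤ 1 := measureReal_le_one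
  have hp0 : 0 ≤ ν.real C := measureReal_nonneg
  rw [measureReal_def, e, Measure.pi_pi, ENNReal.toReal_prod]
  have e2 : ∀ l : Fin n, (ν (if l = i ∨ l = j then Set.univ else Cᶜ)).toReal = if l ∈ ({i, j} : Finset (Fin n)) then 1 else (1 - ν.real C) := by
    intro l
    by_cases h : l = i ∨ l = j
    · simp [h]
    · rw [if_neg h, if_neg (by simpa using h), ← measureReal_def, measureReal_compl hC]; simp
  rw [Finset.prod_congr rfl fun l _ => e2 l, Finset.prod_ite, Finset.prod_const_one, one_mul, Finset.prod_const]
  have hcard : (n:ℝ) - 2 ≤ ((Finset.univ.filter fun l => l ∉ ({i, j} : Finset (Fin n))).card : ℝ) := by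
    have h1 := Finset.card_filter_add_card_filter_not (s := (Finset.univ : Finset (Fin n))) (fun l => l ∈ ({i, j} : Finset (Fin n)))
    have h2 : (Finset.univ.filter fun l => l ∈ ({i, j} : Finset (Fin n))).card ≤ 2 :=
      (Finset.card_le_card (fun l hl => (Finset.mem_filter.1 hl).2)).trans Finset.card_le_two
    have h3 : n ≤ 2 + (Finset.univ.filter fun l => l ∉ ({i, j} : Finset (Fin n))).card := by
      simp only [Finset.card_univ, Fintype.card_fin] at h1
      omega
    have h4 : (n:ℝ) ≤ 2 + ((Finset.univ.filter fun l => l ∉ ({i, j} : Finset (Fin n))).card : ℝ) := by exact_mod_cast h3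
    linarith
  refine (pow_le_pow_left₀ (by linarith) (Real.one_sub_le_exp_neg _) _).trans ?_
  rw [← Real.exp_nat_mul]
  apply Real.exp_le_exp.2
  nlinarith

lemma count_bound (C : Set α) (hC : MeasurableSet C) (L : ℝ) :
    (Measure.pi fun _ : Fin n => ν).real {x | L < ∑ i, C.indicator (fun _ => (1:ℝ)) (x i)} ≤ Real.exp (2 * ν.real C * n - L) := by
  have hp0 : 0 ≤ ν.real C := measureReal_nonneg
  have hi : ∀ x : α, 0 ≤ C.indicator (fun _ => (1:ℝ)) x := fun x => Set.indicator_nonneg (by simp) _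
  have hi1 : ∀ x : α, C.indicator (fun _ => (1:ℝ)) x ≤ 1 := fun x => by classical rw [Set.indicator_apply]; split_ifs <;> norm_num
  have hm : Measurable (C.indicator (fun _ => (1:ℝ))) := measurable_const.indicator hC
  set g : (Fin n → α) → ℝ := fun x => Real.exp (∑ i, C.indicator (fun _ => (1:ℝ)) (x i)) with hg
  have hgm : Measurable g := by
    apply Real.measurable_exp.comp
    exact Finset.measurable_fun_sum _ fun i _ => hm.comp (measurable_pi_apply i)
  have hgi : Integrable g (Measure.pi fun _ : Fin n => ν) := by
    refine bdd_int hgm.aestronglyMeasurable (Real.exp n) fun x => ?_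
    rw [Real.norm_eq_abs, abs_of_pos (Real.exp_pos _)]
    apply Real.exp_le_exp.2
    refine (Finset.sum_le_sum fun i _ => hi1 (x i)).trans ?_
    simp
  have h1 := mul_meas_ge_le_integral_of_nonneg (μ := Measure.pi fun _ : Fin n => ν) (f := g) (ae_of_all _ fun x => (Real.exp_pos _).le) hgi (Real.exp L)
  have h2 : ∫ x, g x ∂(Measure.pi fun _ : Fin n => ν) = (∫ y, Real.exp (C.indicator (fun _ => (1:ℝ)) y) ∂ν) ^ n := by
    simp only [hg, Real.exp_sum]
    rw [integral_fintype_prod_eq_prod (fun (_ : Fin n) y => Real.exp (C.indicator (fun _ => (1:ℝ)) y))]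
    simp
  have h3 : ∫ y, Real.exp (C.indicator (fun _ => (1:ℝ)) y) ∂ν ≤ 1 + 2 * ν.real C := by
    have : ∫ y, Real.exp (C.indicator (fun _ => (1:ℝ)) y) ∂ν ≤ ∫ y, (1 + C.indicator (fun _ => (2:ℝ)) y) ∂ν := by
      refine integral_mono ?_ ?_ ?_
      · refine bdd_int (Real.measurable_exp.comp hm).aestronglyMeasurable (Real.exp 1) fun x => ?_
        rw [Real.norm_eq_abs, abs_of_pos (Real.exp_pos _)]
        exact Real.exp_le_exp.2 (hi1 x)
      · exact (integrable_const _).add ((integrable_const _).indicator hC)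
      · intro y
        by_cases hy : y ∈ C
        · simp only [Set.indicator_of_mem hy]
          have := Real.exp_one_lt_d9; linarith
        · simp [Set.indicator_of_notMem hy]
    refine this.trans ?_
    rw [integral_add (integrable_const _) ((integrable_const _).indicator hC), integral_indicator_const _ hC]
    simp [mul_comm]
  have h4 : (∫ y, Real.exp (C.indicator (fun _ => (1:ℝ)) y) ∂ν) ^ n ≤ Real.exp (2 * ν.real C * n) := by
    have h0 : 0 ≤ ∫ y, Real.exp (C.indicator (fun _ => (1:ℝ)) y) ∂ν := integral_nonneg fun y => (Real.exp_pos _).le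
    refine (pow_le_pow_left₀ h0 (h3.trans ((add_comm _ _).trans_le (Real.add_one_le_exp _))) n).trans ?_
    rw [← Real.exp_nat_mul, mul_comm]
  have h5 : (Measure.pi fun _ : Fin n => ν).real {x | L < ∑ i, C.indicator (fun _ => (1:ℝ)) (x i)} ≤
      (Measure.pi fun _ : Fin n => ν).real {x | Real.exp L ≤ g x} :=
    measureReal_mono fun x hx => Real.exp_le_exp.2 (le_of_lt hx)
  rw [h2] at h1
  rw [Real.exp_sub, le_div_iff₀ (Real.exp_pos _), mul_comm]
  exact (mul_le_mul_of_nonneg_left h5 (Real.exp_pos _).le).trans (h1.trans h4)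
end gen

lemma pi_prob {β : ℝ} (hβ : 0 ≤ β) (n : ℕ) : IsProbabilityMeasure (betaPi β n) := by
  have := bm_prob hβ
  unfold betaPi; infer_instance

lemma cap_meas (s : ℝ) (e : EE) : MeasurableSet {p : EE | s ≤ inner ℝ p e} :=
  measurableSet_le measurable_const (by fun_prop)

lemma cap_real (β s : ℝ) (n k : ℕ) : (betaMeasure β).real {p : EE | 1 - s ≤ inner ℝ p (net n k)} = capm β s := by
  rw [measureReal_def, cap_rot β _ _ (net_norm n k)]; rfl

lemma disk_ae {β : ℝ} (hβ : 0 ≤ β) (n : ℕ) : ∀ᵐ x ∂betaPi β n, ∀ i, ‖x i‖ ≤ 1 := by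
  have := bm_prob hβ
  rw [ae_all_iff]
  intro i
  exact (measurePreserving_eval (fun _ : Fin n => betaMeasure β) i).quasiMeasurePreserving.ae (bm_disk β)

lemma bad_bound {β : ℝ} (hβ : 0 ≤ β) (n : ℕ) (t L : ℝ) :
    (betaPi β n).real {x | ¬ Good t L x} ≤ (n + 1) * (n * (n * Real.exp (-(capm β t * (n - 2)))))
      + (n + 1) * Real.exp (2 * capm β (185 * t) * n - L) := by
  have := bm_prob hβ
  have := pi_prob hβ n
  set B1 : Set (Fin n → EE) := {x | ¬ ∀ i, ‖x i‖ ≤ 1}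
  set B2 : ℕ → Fin n → Fin n → Set (Fin n → EE) := fun k i j => {x | ∀ l, l ≠ i → l ≠ j → x l ∉ {p : EE | 1 - t ≤ inner ℝ p (net n k)}}
  set B3 : ℕ → Set (Fin n → EE) := fun k => {x | L < ∑ i, Set.indicator {p : EE | 1 - 185 * t ≤ inner ℝ p (net n k)} (fun _ => (1:ℝ)) (x i)}
  have hsub : {x | ¬ Good t L x} ⊆ B1 ∪ ((⋃ k ∈ Finset.range (n+1), ⋃ i ∈ (Finset.univ : Finset (Fin n)), ⋃ j ∈ (Finset.univ : Finset (Fin n)), B2 k i j) ∪ ⋃ k ∈ Finset.range (n+1), B3 k) := by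
    intro x hx
    by_contra hc
    apply hx
    simp only [Set.mem_union, not_or, Set.mem_iUnion, not_exists] at hc
    obtain ⟨c1, c2, c3⟩ := hc
    refine ⟨not_not.1 c1, fun k hk i j => ?_, fun k hk => not_lt.1 (c3 k hk)⟩
    have := c2 k hk i (Finset.mem_univ _) j (Finset.mem_univ _)
    simp only [B2, Set.mem_ofPred_eq] at this
    push Not at this
    obtain ⟨l, a, b, c⟩ := this
    exact ⟨l, a, b, c⟩
  have h1 : (betaPi β n).real B1 = 0 := by
    rw [measureReal_def]
    have : betaPi β n B1 = 0 := disk_ae hβ n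
    rw [this]; rfl
  have h2 : ∀ k i j, (betaPi β n).real (B2 k i j) ≤ Real.exp (-(capm β t * (n - 2))) := by
    intro k i j
    have := hit_bound (betaMeasure β) _ (cap_meas (1-t) (net n k)) i j
    rwa [cap_real] at this
  have h3 : ∀ k, (betaPi β n).real (B3 k) ≤ Real.exp (2 * capm β (185 * t) * n - L) := by
    intro k
    have := count_bound (n := n) (betaMeasure β) _ (cap_meas (1-185 * t) (net n k)) L
    rwa [cap_real] at this
  refine (measureReal_mono hsub).trans ((measureReal_union_le _ _).trans ?_)
  rw [h1, zero_add]
  refine (measureReal_union_le _ _).trans (add_le_add ?_ ?_)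
  · refine (measureReal_biUnion_finset_le _ _).trans ?_
    refine (Finset.sum_le_card_nsmul _ _ (n * (n * Real.exp (-(capm β t * (n - 2))))) fun k _ => ?_).trans (by simp)
    refine (measureReal_biUnion_finset_le _ _).trans ?_
    refine (Finset.sum_le_card_nsmul _ _ (n * Real.exp (-(capm β t * (n - 2)))) fun k _ => ?_).trans (by simp)
    refine (measureReal_biUnion_finset_le _ _).trans ?_
    refine (Finset.sum_le_card_nsmul _ _ (Real.exp (-(capm β t * (n - 2)))) fun k _ => h2 _ _ _).trans (by simp)
  · refine (measureReal_biUnion_finset_le _ _).trans ?_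
    refine (Finset.sum_le_card_nsmul _ _ (Real.exp (2 * capm β (185 * t) * n - L)) fun k _ => h3 k).trans (by simp)
end CP

namespace CP
open MeasureTheory Filter Topology

noncomputable def tt (β K : ℝ) (n : ℕ) : ℝ := (K * (Real.log n / n)) ^ (1 / (β + 3/2))

lemma log_div_tendsto : Tendsto (fun n : ℕ => Real.log n / (n:ℝ)) atTop (𝓝 0) := by
  have h := Real.isLittleO_log_id_atTop.tendsto_div_nhds_zero
  exact h.comp tendsto_natCast_atTop_atTop

lemma log_tendsto : Tendsto (fun n : ℕ => Real.log n) atTop atTop :=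
  Real.tendsto_log_atTop.comp tendsto_natCast_atTop_atTop

lemma tt_tendsto {β K : ℝ} (hβ : 0 ≤ β) : Tendsto (tt β K) atTop (𝓝 0) := by
  have h : Tendsto (fun n : ℕ => K * (Real.log n / (n:ℝ))) atTop (𝓝 (K * 0)) := log_div_tendsto.const_mul K
  rw [mul_zero] at h
  have h2 := h.rpow_const (p := 1 / (β + 3/2)) (Or.inr (by positivity))
  rwa [Real.zero_rpow (by positivity)] at h2

theorem nice_prob {β : ℝ} (hβ : 0 ≤ β) : ∃ K K2 : ℝ, 0 < K ∧ 0 < K2 ∧ ∀ᶠ n : ℕ in atTop,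
    0 < tt β K n ∧ 5 * tt β K n ≤ 1/2 ∧ 1 ≤ K2 * Real.log n ∧
    (betaPi β n).real {x | ¬ Nice (5 * tt β K n) (2 * √(10 * tt β K n)) (K2 * Real.log n) x} ≤ 1 / (n:ℝ) ^ 10 := by
  have hc0 := c0_pos hβ
  have hk1 := k1_pos hβ
  set K := 40 / c0 β with hK
  have hKp : 0 < K := by positivity
  set C1 := 2 ^ (β + 1/2) * k1 β * 185 ^ (β + 3/2) with hC1
  have hC1p : 0 < C1 := by positivity
  refine ⟨K, 2 * C1 * K + 20, hKp, by positivity, ?_⟩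
  have e1 := (tt_tendsto (K := K) hβ).eventually_le_const (show (0:ℝ) < 1/185 by norm_num)
  have e2 := log_tendsto.eventually_ge_atTop (1 + 1 / K)
  have e3 := log_div_tendsto.eventually_le_const (show (0:ℝ) < 1 / K by positivity)
  filter_upwards [e1, e2, e3, eventually_ge_atTop 20] with n h1 h2 h3 h4
  have hn : (20:ℝ) ≤ n := by exact_mod_cast h4
  set l := Real.log n with hl
  have hl1 : 1 ≤ l := by have : 0 < 1 / K := by positivity
                         linarith
  have hlK : 1 ≤ K * l := by
    have : 1 / K ≤ l := by linarith
    rwa [div_le_iff₀ hKp, mul_comm] at this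
  set w := K * (l / n) with hw
  have hw0 : 0 < w := by positivity
  have hw1 : w ≤ 1 := by rw [hw, mul_comm]; rwa [le_div_iff₀ hKp] at h3
  have hb : 0 < β + 3/2 := by positivity
  have ht : tt β K n = w ^ (1 / (β + 3/2)) := rfl
  set t := tt β K n with htd
  have ht0 : 0 < t := by rw [ht]; positivity
  have htb : t ^ (β + 3/2) = w := by
    rw [ht, ← Real.rpow_mul hw0.le, one_div_mul_cancel hb.ne', Real.rpow_one]
  have hwt : 1 / (n:ℝ) ≤ t := by
    have : w ≤ t := by
      rw [ht]
      calc w = w ^ (1:ℝ) := (Real.rpow_one w).symm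
        _ ≤ _ := Real.rpow_le_rpow_of_exponent_ge hw0 hw1 (by rw [div_le_one hb]; linarith)
    refine le_trans ?_ this
    rw [hw, ← mul_div_assoc]
    gcongr
  have hnt : (2 * Real.pi / n) ^ 2 ≤ 2 * t := by
    refine le_trans ?_ (mul_le_mul_of_nonneg_left hwt (by norm_num))
    have := Real.pi_lt_d2
    have := Real.pi_pos
    rw [div_pow, div_le_iff₀ (by positivity)]
    have : 2 * (1 / (n:ℝ)) * n ^ 2 = 2 * n := by field_simp
    rw [this]
    nlinarith
  refine ⟨ht0, by linarith, ?_, ?_⟩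
  · nlinarith [mul_pos hC1p hKp]
  have hsub : (betaPi β n).real {x | ¬ Nice (5 * t) (2 * √(10 * t)) ((2 * C1 * K + 20) * l) x} ≤
      (betaPi β n).real {x | ¬ Good t ((2 * C1 * K + 20) * l) x} := by
    have := pi_prob hβ n
    refine measureReal_mono fun x hx hg => hx ?_
    exact good_nice (by omega) ht0 (by linarith) hnt hg
  refine hsub.trans ((bad_bound hβ n _ _).trans ?_)
  have f1 : Real.exp (-(capm β t * (n - 2))) ≤ 1 / (n:ℝ) ^ 20 := by
    have : 1 / (n:ℝ) ^ 20 = Real.exp (-(20 * l)) := by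
      rw [Real.exp_neg, one_div, show (20:ℝ) * l = ((20:ℕ):ℝ) * l by norm_num, Real.exp_nat_mul, hl, Real.exp_log (by linarith)]
    rw [this]
    apply Real.exp_le_exp.2
    have g1 := capm_lb hβ t ht0.le (by linarith)
    rw [htb] at g1
    have g2 : c0 β * w = 40 * (l / n) := by rw [hw, hK]; field_simp
    rw [g2] at g1
    have g3 : 40 * (l / n) * (n - 2) ≤ capm β t * (n - 2) := mul_le_mul_of_nonneg_right g1 (by linarith)
    have g4 : 20 * l ≤ 40 * (l / n) * (n - 2) := by
      have : 40 * (l / n) * (n - 2) = 40 * l * (1 - 2 / n) := by field_simp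
      rw [this]
      have : 2 / (n:ℝ) ≤ 1/2 := by rw [div_le_iff₀ (by linarith)]; linarith
      nlinarith
    linarith
  have f2 : Real.exp (2 * capm β (185 * t) * n - (2 * C1 * K + 20) * l) ≤ 1 / (n:ℝ) ^ 20 := by
    have : 1 / (n:ℝ) ^ 20 = Real.exp (-(20 * l)) := by
      rw [Real.exp_neg, one_div, show (20:ℝ) * l = ((20:ℕ):ℝ) * l by norm_num, Real.exp_nat_mul, hl, Real.exp_log (by linarith)]
    rw [this]
    apply Real.exp_le_exp.2
    have g1 := capm_le hβ (185 * t) (by positivity) (by linarith)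
    rw [Real.mul_rpow (by norm_num) ht0.le, htb] at g1
    have g2 : capm β (185 * t) * n ≤ C1 * K * l := by
      refine (mul_le_mul_of_nonneg_right g1 (by linarith)).trans (le_of_eq ?_)
      rw [hC1, hw]; field_simp
    nlinarith
  have hE : 0 < 1 / (n:ℝ) ^ 20 := by positivity
  calc ((n:ℝ) + 1) * (n * (n * Real.exp (-(capm β t * (n - 2))))) + (n + 1) * Real.exp (2 * capm β (185 * t) * n - (2 * C1 * K + 20) * l)
      ≤ (n + 1) * (n * (n * (1 / (n:ℝ) ^ 20))) + (n + 1) * (1 / (n:ℝ) ^ 20) := by gcongr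
    _ = ((n + 1) * n * n + (n + 1)) * (1 / (n:ℝ) ^ 20) := by ring
    _ ≤ n ^ 10 * (1 / (n:ℝ) ^ 20) := by
        refine mul_le_mul_of_nonneg_right ?_ hE.le
        have : (n:ℝ) ^ 4 ≤ n ^ 10 := pow_le_pow_right₀ (by linarith) (by norm_num)
        nlinarith [mul_self_nonneg (n:ℝ), pow_pos (show (0:ℝ) < n by linarith) 3, mul_nonneg (sub_nonneg.2 hn) (pow_pos (show (0:ℝ) < n by linarith) 3).le]
    _ = 1 / (n:ℝ) ^ 10 := by field_simp
end CP

namespace CP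
open MeasureTheory Filter Topology

lemma pre_le {X Y : Type*} [MeasurableSpace X] [MeasurableSpace Y] {P : Measure X} {Q : Measure Y} [IsFiniteMeasure Q]
    {f : X → Y} (hf : MeasurePreserving f P Q) (s : Set Y) : P.real (f ⁻¹' s) ≤ Q.real s := by
  rw [measureReal_def, measureReal_def]
  refine ENNReal.toReal_mono (measure_ne_top _ _) ?_
  rw [← measure_toMeasurable s, ← hf.measure_preimage (measurableSet_toMeasurable _ _).nullMeasurableSet]
  exact measure_mono (Set.preimage_mono (subset_toMeasurable _ _))

lemma int_split {X : Type*} [MeasurableSpace X] {P : Measure X} [IsProbabilityMeasure P] {g : X → ℝ} (hg : Measurable g)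
    {M c : ℝ} (hM : ∀ x, |g x| ≤ M) (hc : 0 ≤ c) (B G : Set X) (hG : MeasurableSet G)
    (h1 : ∀ x, x ∉ B → x ∈ G → g x ≤ c) (h0 : ∀ x, x ∉ B → x ∉ G → g x ≤ 0) :
    ∫ x, g x ∂P ≤ c * P.real G + M * P.real B := by
  have : Nonempty X := P.nonempty_of_neZero
  have hM0 : 0 ≤ M := (abs_nonneg _).trans (hM (Classical.arbitrary X))
  set B' := toMeasurable P B
  have hB' : MeasurableSet B' := measurableSet_toMeasurable _ _
  have e : P.real B' = P.real B := by rw [measureReal_def, measure_toMeasurable]; rfl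
  calc ∫ x, g x ∂P ≤ ∫ x, (G.indicator (fun _ => c) x + B'.indicator (fun _ => M) x) ∂P := by
        refine integral_mono (bdd_int hg.aestronglyMeasurable M hM)
          (((integrable_const _).indicator hG).add ((integrable_const _).indicator hB')) fun x => ?_
        have hb0 : 0 ≤ B'.indicator (fun _ => M) x := Set.indicator_nonneg (fun _ _ => hM0) _
        have hg0 : 0 ≤ G.indicator (fun _ => c) x := Set.indicator_nonneg (fun _ _ => hc) _
        by_cases hxB : x ∈ B
        · simp only
          rw [Set.indicator_of_mem (subset_toMeasurable P B hxB : x ∈ B')]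
          linarith [le_abs_self (g x), hM x]
        · by_cases hxG : x ∈ G
          · simp only
            rw [Set.indicator_of_mem hxG]; linarith [h1 x hxB hxG]
          · simp only
            linarith [h0 x hxB hxG]
    _ = c * P.real G + M * P.real B := by
        rw [integral_add ((integrable_const _).indicator hG) ((integrable_const _).indicator hB'),
          integral_indicator_const _ hG, integral_indicator_const _ hB', e]
        simp [mul_comm]

def AA (h : ℝ) : Set EE := {p | 1 - h ≤ ‖p‖}
lemma AA_meas (h : ℝ) : MeasurableSet (AA h) := measurableSet_le measurable_const measurable_norm

section bounds
variable {n : ℕ} {ν : Measure EE} [IsProbabilityMeasure ν] {h r L δ : ℝ}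

lemma allnice_prob (hδ : (Measure.pi fun _ : Fin n => ν).real {x | ¬ Nice h r L x} ≤ δ) :
    (Measure.pi fun _ : Fin n => ν.prod ν).real {z | ¬ AllNice h r L z} ≤ (2 * n + 1) * δ := by
  set P := Measure.pi fun _ : Fin n => ν.prod ν
  have hs : ∀ S : Finset (Fin n), P.real (mix S ⁻¹' {x | ¬ Nice h r L x}) ≤ δ := fun S => (pre_le (mix_mp ν S) _).trans hδ
  have hsub : {z : Fin n → EE × EE | ¬ AllNice h r L z} ⊆ (⋃ m ∈ Finset.range (n+1), mix (ltS n m) ⁻¹' {x | ¬ Nice h r L x}) ∪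
      ⋃ j ∈ (Finset.univ : Finset (Fin n)), mix {j} ⁻¹' {x | ¬ Nice h r L x} := by
    intro z hz
    by_contra hc
    apply hz
    simp only [Set.mem_union, not_or, Set.mem_iUnion, not_exists, Set.mem_preimage, Set.mem_ofPred_eq, not_not] at hc
    exact ⟨fun m hm => hc.1 m (Finset.mem_range.2 (by omega)), fun j => hc.2 j (Finset.mem_univ _)⟩
  refine (measureReal_mono hsub).trans ((measureReal_union_le _ _).trans ?_)
  have a1 := (measureReal_biUnion_finset_le (μ := P) (Finset.range (n+1)) (fun m => mix (ltS n m) ⁻¹' {x | ¬ Nice h r L x})).trans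
    (Finset.sum_le_card_nsmul _ _ δ fun k _ => hs _)
  have a2 := (measureReal_biUnion_finset_le (μ := P) (Finset.univ) (fun j : Fin n => mix {j} ⁻¹' {x | ¬ Nice h r L x})).trans
    (Finset.sum_le_card_nsmul _ _ δ fun k _ => hs _)
  simp only [Finset.card_range, nsmul_eq_mul, Finset.card_univ, Fintype.card_fin, Nat.cast_add, Nat.cast_one] at a1 a2
  linarith

def G2 (h : ℝ) (j : Fin n) : Set (Fin n → EE × EE) := {z | (z j).1 ∈ AA h} ∪ {z | (z j).2 ∈ AA h}

lemma G2_meas (j : Fin n) : MeasurableSet (G2 (n := n) h j) :=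
  ((measurable_fst.comp (measurable_pi_apply j)) (AA_meas h)).union
    ((measurable_snd.comp (measurable_pi_apply j)) (AA_meas h))

lemma G2_prob (j : Fin n) : (Measure.pi fun _ : Fin n => ν.prod ν).real (G2 h j) ≤ 2 * ν.real (AA h) := by
  have h1 := (measurePreserving_fst (μ := ν) (ν := ν)).comp (measurePreserving_eval (fun _ : Fin n => ν.prod ν) j)
  have h2 := (measurePreserving_snd (μ := ν) (ν := ν)).comp (measurePreserving_eval (fun _ : Fin n => ν.prod ν) j)
  have a1 := pre_le h1 (AA h)
  have a2 := pre_le h2 (AA h)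
  refine (measureReal_union_le _ _).trans ?_
  rw [two_mul]
  exact add_le_add a1 a2

lemma db_sq (H : HR h r) (hL : 1 ≤ L) (hδ : (Measure.pi fun _ : Fin n => ν).real {x | ¬ Nice h r L x} ≤ δ) (j : Fin n) :
    ∫ z, db ff j z ^ 2 ∂(Measure.pi fun _ : Fin n => ν.prod ν) ≤ 9 * L ^ 2 * (2 * ν.real (AA h)) + 4 * n ^ 2 * ((2 * n + 1) * δ) := by
  refine (int_split (M := 4 * (n:ℝ) ^ 2) (c := 9 * L ^ 2) ((db_meas ff_meas j).pow_const 2) ?_ (by positivity) {z | ¬ AllNice h r L z} (G2 h j) (G2_meas j) ?_ ?_).trans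
    (add_le_add (mul_le_mul_of_nonneg_left (G2_prob j) (by positivity)) (mul_le_mul_of_nonneg_left (allnice_prob hδ) (by positivity)))
  · intro z
    have := db_bdd ff_abs j z
    rw [abs_of_nonneg (sq_nonneg _), ← sq_abs]
    nlinarith [abs_nonneg (db ff j z)]
  · intro z hz _
    have := db_bound H hL (not_not.1 hz) j
    rw [← sq_abs]
    nlinarith [abs_nonneg (db ff j z)]
  · intro z hz hG
    simp only [G2, AA, Set.mem_union, Set.mem_ofPred_eq, not_or] at hG
    rw [db_zero H (not_not.1 hz) j hG.1 hG.2]; simp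

lemma dab_bd (H : HR h r) (hL : 1 ≤ L) (hδ : (Measure.pi fun _ : Fin n => ν).real {x | ¬ Nice h r L x} ≤ δ) (j : Fin n) :
    ∫ z, |da ff j z| * db ff j z ^ 2 ∂(Measure.pi fun _ : Fin n => ν.prod ν) ≤ 27 * L ^ 3 * (2 * ν.real (AA h)) + 8 * n ^ 3 * ((2 * n + 1) * δ) := by
  refine (int_split (M := 8 * (n:ℝ) ^ 3) (c := 27 * L ^ 3) ((continuous_abs.measurable.comp (da_meas ff_meas j)).mul ((db_meas ff_meas j).pow_const 2)) ?_ (by positivity) {z | ¬ AllNice h r L z} (G2 h j) (G2_meas j) ?_ ?_).trans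
    (add_le_add (mul_le_mul_of_nonneg_left (G2_prob j) (by positivity)) (mul_le_mul_of_nonneg_left (allnice_prob hδ) (by positivity)))
  · intro z
    have h1 := db_bdd ff_abs j z
    have h2 := da_bdd ff_abs j z
    change |(|da ff j z| * db ff j z ^ 2)| ≤ _
    rw [abs_mul, abs_abs, abs_of_nonneg (sq_nonneg (db ff j z)), ← sq_abs (db ff j z)]
    calc |da ff j z| * |db ff j z| ^ 2 ≤ (2 * n) * (2 * n) ^ 2 := by gcongr
      _ = _ := by ring
  · intro z hz _
    have h1 := db_bound H hL (not_not.1 hz) j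
    have h2 := da_bound H hL (not_not.1 hz) j
    change |da ff j z| * db ff j z ^ 2 ≤ _
    rw [← sq_abs]
    calc |da ff j z| * |db ff j z| ^ 2 ≤ (3 * L) * (3 * L) ^ 2 := by gcongr
      _ = _ := by ring
  · intro z hz hG
    simp only [G2, AA, Set.mem_union, Set.mem_ofPred_eq, not_or] at hG
    change |da ff j z| * db ff j z ^ 2 ≤ _
    rw [db_zero H (not_not.1 hz) j hG.1 hG.2]; simp

lemma TT_sq (H : HR h r) (hL : 1 ≤ L) (hδ : (Measure.pi fun _ : Fin n => ν).real {x | ¬ Nice h r L x} ≤ δ) (i : Fin n) :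
    ∫ Z, (TT ff (mix ∅ Z) - TT ff (mix {i} Z)) ^ 2 ∂(Measure.pi fun _ : Fin n => (ν.prod ν).prod (ν.prod ν)) ≤
      40000 * L ^ 6 * (4 * ν.real (AA h)) + 16 * n ^ 6 * (2 * ((2 * n + 1) * δ)) := by
  set P := Measure.pi fun _ : Fin n => (ν.prod ν).prod (ν.prod ν)
  have hm0 := mix_mp (ν.prod ν) (∅ : Finset (Fin n))
  have hm1 := mix_mp (ν.prod ν) ({i} : Finset (Fin n))
  set B : Set (Fin n → (EE × EE) × (EE × EE)) := mix ∅ ⁻¹' {z | ¬ AllNice h r L z} ∪ mix {i} ⁻¹' {z | ¬ AllNice h r L z} with hBd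
  set G : Set (Fin n → (EE × EE) × (EE × EE)) := mix ∅ ⁻¹' (G2 h i) ∪ mix {i} ⁻¹' (G2 h i) with hGd
  have hGm : MeasurableSet G := (hm0.measurable (G2_meas i)).union (hm1.measurable (G2_meas i))
  have hB : P.real B ≤ 2 * ((2 * n + 1) * δ) := by
    refine (measureReal_union_le _ _).trans ?_
    have a1 := (pre_le hm0 {z | ¬ AllNice h r L z}).trans (allnice_prob hδ)
    have a2 := (pre_le hm1 {z | ¬ AllNice h r L z}).trans (allnice_prob hδ)
    linarith
  have hG : P.real G ≤ 4 * ν.real (AA h) := by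
    refine (measureReal_union_le _ _).trans ?_
    have a1 := (pre_le hm0 (G2 h i)).trans (G2_prob i)
    have a2 := (pre_le hm1 (G2 h i)).trans (G2_prob i)
    linarith
  refine (int_split (P := P) (M := 16 * (n:ℝ) ^ 6) (c := 40000 * L ^ 6) ((((TT_meas ff_meas).comp hm0.measurable).sub ((TT_meas ff_meas).comp hm1.measurable)).pow_const 2) ?_ (by positivity) B G hGm ?_ ?_).trans
    (add_le_add (mul_le_mul_of_nonneg_left hG (by positivity)) (mul_le_mul_of_nonneg_left hB (by positivity)))
  · intro Z
    have h1 := TT_bdd ff_abs (mix ∅ Z)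
    have h2 := TT_bdd ff_abs (mix {i} Z)
    simp only [Function.comp_apply, Pi.sub_apply]
    rw [abs_of_nonneg (sq_nonneg _), ← sq_abs]
    have h3 : |TT ff (mix ∅ Z) - TT ff (mix {i} Z)| ≤ 4 * n ^ 3 := by
      refine (abs_sub _ _).trans ?_
      calc _ ≤ 2 * (n:ℝ) * n ^ 2 + 2 * n * n ^ 2 := add_le_add h1 h2
        _ = _ := by ring
    calc _ ≤ (4 * (n:ℝ) ^ 3) ^ 2 := pow_le_pow_left₀ (abs_nonneg _) h3 2
      _ = _ := by ring
  · intro Z hZ _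
    simp only [hBd, Set.mem_union, Set.mem_preimage, Set.mem_ofPred_eq, not_or, not_not] at hZ
    have h3 := TT_diff (i := i) H hL (fun k hk => sg_off Z i k hk) hZ.1 hZ.2
    simp only [Function.comp_apply, Pi.sub_apply]
    rw [← sq_abs]
    calc _ ≤ (200 * L ^ 3) ^ 2 := pow_le_pow_left₀ (abs_nonneg _) h3 2
      _ = _ := by ring
  · intro Z hZ hG
    simp only [hBd, Set.mem_union, Set.mem_preimage, Set.mem_ofPred_eq, not_or, not_not] at hZ
    simp only [hGd, G2, AA, Set.mem_union, Set.mem_preimage, Set.mem_ofPred_eq, not_or] at hG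
    simp only [Function.comp_apply, Pi.sub_apply]
    rw [TT_zero (i := i) H (fun k hk => sg_off Z i k hk) hZ.1 hZ.2 hG.1.1 hG.1.2 hG.2.1 hG.2.2]; simp

theorem var_bd (H : HR h r) (hL : 1 ≤ L) (hδ : (Measure.pi fun _ : Fin n => ν).real {x | ¬ Nice h r L x} ≤ δ) :
    ∫ x, ff x ^ 2 ∂(Measure.pi fun _ : Fin n => ν) - (∫ x, ff x ∂(Measure.pi fun _ : Fin n => ν)) ^ 2 ≤
     1/2 * (n * (9 * L ^ 2 * (2 * ν.real (AA h)) + 4 * n ^ 2 * ((2 * n + 1) * δ))) := by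
  refine (efron_stein ν ff ff_meas n ff_abs).trans (mul_le_mul_of_nonneg_left ?_ (by norm_num))
  refine (Finset.sum_le_card_nsmul _ _ _ fun j _ => db_sq H hL hδ j).trans (by rw [nsmul_eq_mul]; simp only [Finset.card_univ, Fintype.card_fin]; rfl)

theorem varTT_bd (H : HR h r) (hL : 1 ≤ L) (hδ : (Measure.pi fun _ : Fin n => ν).real {x | ¬ Nice h r L x} ≤ δ) :
    ∫ z, TT ff z ^ 2 ∂(Measure.pi fun _ : Fin n => ν.prod ν) - (∫ z, TT ff z ∂(Measure.pi fun _ : Fin n => ν.prod ν)) ^ 2 ≤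
     1/2 * (n * (40000 * L ^ 6 * (4 * ν.real (AA h)) + 16 * n ^ 6 * (2 * ((2 * n + 1) * δ)))) := by
  refine (efron_stein (ν.prod ν) (TT ff) (TT_meas ff_meas) _ (TT_bdd ff_abs)).trans (mul_le_mul_of_nonneg_left ?_ (by norm_num))
  refine (Finset.sum_le_card_nsmul _ _ _ fun j _ => TT_sq H hL hδ j).trans (by rw [nsmul_eq_mul]; simp only [Finset.card_univ, Fintype.card_fin]; rfl)

theorem e_bd (H : HR h r) (hL : 1 ≤ L) (hδ : (Measure.pi fun _ : Fin n => ν).real {x | ¬ Nice h r L x} ≤ δ) :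
    ∑ j : Fin n, ∫ z, |da ff j z| * db ff j z ^ 2 ∂(Measure.pi fun _ : Fin n => ν.prod ν) ≤
     n * (27 * L ^ 3 * (2 * ν.real (AA h)) + 8 * n ^ 3 * ((2 * n + 1) * δ)) := by
  refine (Finset.sum_le_card_nsmul _ _ _ fun j _ => dab_bd H hL hδ j).trans (by rw [nsmul_eq_mul]; simp only [Finset.card_univ, Fintype.card_fin]; rfl)
end bounds
end CP

namespace CP
open MeasureTheory Filter Topology

noncomputable def al (β : ℝ) : ℝ := 1 / (2 * β + 3)
noncomputable def uu (β : ℝ) (n : ℕ) : ℝ := (n:ℝ) ^ al β * (Real.log n) ^ (1 - al β)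

lemma al_pos {β : ℝ} (hβ : 0 ≤ β) : 0 < al β := by unfold al; positivity
lemma al_le {β : ℝ} (hβ : 0 ≤ β) : al β ≤ 1/3 := by
  unfold al
  rw [div_le_div_iff₀ (by positivity) (by norm_num)]; linarith

noncomputable def vv (β : ℝ) (n : ℕ) : ℝ := ∫ x, ff x ^ 2 ∂betaPi β n - (∫ x, ff x ∂betaPi β n) ^ 2

structure Pack (β C : ℝ) (n : ℕ) (h r L : ℝ) : Prop where
  H : HR h r
  bad : (betaPi β n).real {x | ¬ Nice h r L x} ≤ 1 / (n:ℝ) ^ 10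
  nA : n * (betaMeasure β).real (AA h) ≤ C * uu β n
  A2 : (betaMeasure β).real (AA h) ≤ 1 / 2

structure Ups (β C : ℝ) (n : ℕ) : Prop where
  one : 1 ≤ uu β n
  lone : 1 ≤ Real.log n
  pk : ∃ h r L, Pack β C n h r L
  v : vv β n ≤ C * (uu β n * Real.log n ^ 2)
  vT : ∫ z, TT ff z ^ 2 ∂(Measure.pi fun _ : Fin n => (betaMeasure β).prod (betaMeasure β)) -
    (∫ z, TT ff z ∂(Measure.pi fun _ : Fin n => (betaMeasure β).prod (betaMeasure β))) ^ 2 ≤ C * (uu β n * Real.log n ^ 6)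
  e : ∑ j : Fin n, ∫ z, |da ff j z| * db ff j z ^ 2 ∂(Measure.pi fun _ : Fin n => (betaMeasure β).prod (betaMeasure β)) ≤
     C * (uu β n * Real.log n ^ 3)

lemma AA_real {β : ℝ} (hβ : 0 ≤ β) (h : ℝ) (h0 : 0 ≤ h) (h1 : h ≤ 1) : (betaMeasure β).real (AA h) ≤ (2 * h) ^ (β + 1) := by
  rw [measureReal_def, AA, annulus hβ (1 - h) (by linarith) (by linarith), ENNReal.toReal_ofReal (by
    apply Real.rpow_nonneg; nlinarith)]
  apply Real.rpow_le_rpow (by nlinarith) (by nlinarith) (by linarith)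

theorem ups {β : ℝ} (hβ : 0 ≤ β) : ∃ C : ℝ, 0 < C ∧ ∀ᶠ n : ℕ in atTop, Ups β C n := by
  obtain ⟨K, K2, hK, hK2, hev⟩ := nice_prob hβ
  have hal := al_pos hβ
  have hal2 := al_le hβ
  set C1 := (10:ℝ) ^ (β + 1) * K ^ (1 - al β) with hC1
  have hC1p : 0 < C1 := by positivity
  set C := C1 * (80000 * (K2 + 1) ^ 6) + 48 with hC
  have hp6 : 1 ≤ (K2 + 1) ^ 6 := one_le_pow₀ (by linarith)
  have hC1C : C1 ≤ C := by nlinarith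
  refine ⟨C, by positivity, ?_⟩
  have e1 := (tt_tendsto (K := K) hβ).eventually_le_const (show (0:ℝ) < 1/20 by norm_num)
  have e2 := log_tendsto.eventually_ge_atTop 1
  filter_upwards [hev, e1, e2, eventually_ge_atTop 1] with n ⟨ht0, _, hL, hbad⟩ ht hl hn
  have := bm_prob hβ
  have hn1 : (1:ℝ) ≤ n := by exact_mod_cast hn
  have hn0 : (0:ℝ) < n := by linarith
  set t := tt β K n with htd
  set l := Real.log n with hld
  have hu1 : 1 ≤ uu β n := by
    unfold uu
    have a1 : 1 ≤ (n:ℝ) ^ al β := Real.one_le_rpow hn1 hal.le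
    have a2 : 1 ≤ l ^ (1 - al β) := Real.one_le_rpow hl (by linarith)
    nlinarith
  set u := uu β n with hu
  have H : HR (5 * t) (2 * √(10 * t)) := ⟨by linarith, by positivity, by rw [mul_pow, Real.sq_sqrt (by linarith)]; linarith⟩
  set a := (betaMeasure β).real (AA (5 * t)) with ha
  have hal' : a ≤ (10 * t) ^ (β + 1) := by
    have := AA_real hβ (5 * t) (by linarith) (by linarith)
    rwa [show 2 * (5 * t) = 10 * t by ring] at this
  have ha0 : 0 ≤ a := measureReal_nonneg
  have hA2 : a ≤ 1/2 := by
    refine hal'.trans ?_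
    calc (10 * t) ^ (β + 1) ≤ (10 * t) ^ (1:ℝ) := Real.rpow_le_rpow_of_exponent_ge (by linarith) (by linarith) (by linarith)
      _ ≤ 1/2 := by rw [Real.rpow_one]; linarith
  have hnA : n * a ≤ C1 * u := by
    have hw : 0 ≤ K * (l / n) := by positivity
    have h1 : t ^ (β + 1) = (K * (l / n)) ^ (1 - al β) := by
      rw [htd, tt, ← Real.rpow_mul hw]
      congr 1
      unfold al; field_simp; ring
    have h2 : (10 * t) ^ (β + 1) = C1 * (l ^ (1 - al β) / n ^ (1 - al β)) := by
      rw [Real.mul_rpow (by norm_num) ht0.le, h1, Real.mul_rpow hK.le (by positivity), Real.div_rpow (by linarith) hn0.le, hC1]; ring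
    have h3 : (n:ℝ) ^ (1 - al β) = n / n ^ al β := by rw [Real.rpow_sub hn0, Real.rpow_one]
    calc n * a ≤ n * (10 * t) ^ (β + 1) := by gcongr
      _ = C1 * u := by
        rw [h2, h3, hu, uu]
        have : (n:ℝ) ^ al β ≠ 0 := (Real.rpow_pos_of_pos hn0 _).ne'
        field_simp
        rfl
  have hC' : ∀ (c : ℝ) (k : ℕ), 0 ≤ c → c ≤ 80000 → k ≤ 6 → ∀ b : ℝ, b ≤ 48 → c * (K2 * l) ^ k * (n * a) + b ≤ C * (u * l ^ k) := by
    intro c k hc hc2 hk b hb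
    have g1 : 1 ≤ u * l ^ k := by
      have := one_le_pow₀ hl (n := k)
      nlinarith
    have g2 : K2 ^ k ≤ (K2 + 1) ^ 6 := (pow_le_pow_left₀ hK2.le (by linarith) k).trans (pow_le_pow_right₀ (by linarith) hk)
    have g3 : c * (K2 * l) ^ k * (n * a) ≤ 80000 * ((K2 + 1) ^ 6 * l ^ k) * (C1 * u) := by
      rw [mul_pow]; gcongr
    rw [hC]
    nlinarith
  have hbb : ∀ k ≤ 6, (n:ℝ) * (n ^ k * ((2 * n + 1) * (1 / n ^ 10))) ≤ 3 := by
    intro k hk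
    have e : (n:ℝ) * (n ^ k * ((2 * n + 1) * (1 / n ^ 10))) = n ^ (k+1) * (2 * n + 1) / n ^ 10 := by rw [pow_succ]; ring
    rw [e, div_le_iff₀ (by positivity)]
    calc (n:ℝ) ^ (k+1) * (2 * n + 1) ≤ n ^ 7 * (3 * n) := by
          gcongr
          · omega
          · linarith
      _ = 3 * n ^ 8 := by ring
      _ ≤ 3 * n ^ 10 := by gcongr; norm_num
  refine ⟨hu1, hl, ⟨_, _, _, H, hbad, hnA.trans (by gcongr), hA2⟩, ?_, ?_, ?_⟩
  · refine (var_bd H hL hbad).trans (le_trans (le_of_eq ?_) (hC' 9 2 (by norm_num) (by norm_num) (by norm_num) (2 * (n * (n ^ 2 * ((2 * n + 1) * (1 / n ^ 10))))) ?_))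
    · ring
    · have := hbb 2 (by norm_num); linarith
  · refine (varTT_bd H hL hbad).trans (le_trans (le_of_eq ?_) (hC' 80000 6 (by norm_num) (by norm_num) (by norm_num) (16 * (n * (n ^ 6 * ((2 * n + 1) * (1 / n ^ 10))))) ?_))
    · ring
    · have := hbb 6 (by norm_num); linarith
  · refine (e_bd H hL hbad).trans (le_trans (le_of_eq ?_) (hC' 54 3 (by norm_num) (by norm_num) (by norm_num) (8 * (n * (n ^ 3 * ((2 * n + 1) * (1 / n ^ 10))))) ?_))
    · ring
    · have := hbb 3 (by norm_num); linarith
end CP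

namespace CP
open MeasureTheory Filter Topology

def VS {n : ℕ} (x : Fin n → EE) (i : Fin n) : Prop :=
  ∃ a : ℝ, ∀ j, j ≠ i → x j 1 - x i 1 < a * (x j 0 - x i 0)

lemma vert_iff {n : ℕ} (x : Fin n → EE) (i : Fin n) : Vert x i ↔ VS x i := by
  constructor
  · rintro ⟨u, hu, h⟩
    refine ⟨-(u 0) / u 1, fun j hj => ?_⟩
    have := h j hj
    rw [inner2, inner2] at this
    rw [div_mul_eq_mul_div, lt_div_iff₀ hu]
    nlinarith
  · rintro ⟨a, h⟩
    refine ⟨!₂[-a, 1], by simp, fun j hj => ?_⟩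
    have := h j hj
    rw [inner2, inner2]
    simp
    linarith

noncomputable def slp (p q : EE) : ℝ := (q 1 - p 1) / (q 0 - p 0)
def Below (p q : EE) : Set EE := {y | y 1 - p 1 < slp p q * (y 0 - p 0)}

def Edge {n : ℕ} (x : Fin n → EE) (j i : Fin n) : Prop :=
  x j 0 < x i 0 ∧ ∀ k, k ≠ j → k ≠ i → x k ∈ Below (x j) (x i)

def cr (p q y : EE) : ℝ := (y 1 - p 1) * (q 0 - p 0) - (q 1 - p 1) * (y 0 - p 0)

structure GP {n : ℕ} (x : Fin n → EE) : Prop where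
  ne : ∀ i j, i ≠ j → x i 0 ≠ x j 0
  cr : ∀ i j k, i ≠ j → k ≠ i → k ≠ j → cr (x i) (x j) (x k) ≠ 0

lemma left_vert {n : ℕ} {x : Fin n → EE} {i : Fin n} (h : ∀ j, j ≠ i → x i 0 < x j 0) : VS x i := by
  obtain ⟨M, hM⟩ := (Set.finite_range fun j => slp (x i) (x j)).bddAbove
  refine ⟨M + 1, fun j hj => ?_⟩
  have h1 : slp (x i) (x j) ≤ M := hM ⟨j, rfl⟩
  have h2 := h j hj
  rw [← div_lt_iff₀ (by linarith)]
  unfold slp at h1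
  linarith

lemma edge_vert {n : ℕ} {x : Fin n → EE} {j i : Fin n} (h : Edge x j i) : VS x i := by
  obtain ⟨h1, h2⟩ := h
  set s := slp (x j) (x i) with hs
  have hsl : x i 1 - x j 1 = s * (x i 0 - x j 0) := by
    rw [hs, slp, div_mul_cancel₀]; linarith
  have hev : ∀ᶠ ε : ℝ in 𝓝[>] 0, ∀ k, k ≠ i → x k 1 - x i 1 < (s - ε) * (x k 0 - x i 0) := by
    rw [eventually_all]
    intro k
    by_cases hki : k = i
    · exact Eventually.of_forall fun _ h => absurd hki h
    by_cases hkj : k = j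
    · subst hkj
      filter_upwards [self_mem_nhdsWithin] with ε hε _
      have : 0 < ε := hε
      nlinarith
    · have hk : x k 1 - x j 1 < s * (x k 0 - x j 0) := h2 k hkj hki
      have hk' : x k 1 - x i 1 < (s - 0) * (x k 0 - x i 0) := by nlinarith
      have hc : Continuous fun ε : ℝ => (s - ε) * (x k 0 - x i 0) := by fun_prop
      have := (hc.tendsto 0).eventually_const_lt hk'
      exact (this.filter_mono nhdsWithin_le_nhds).mono fun ε h _ => h
  obtain ⟨ε, hε⟩ := hev.exists
  exact ⟨s - ε, hε⟩

lemma vert_edge {n : ℕ} {x : Fin n → EE} {i : Fin n} (hg : GP x) (hv : VS x i) (hl : ∃ j, x j 0 < x i 0) : ∃ j, Edge x j i := by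
  classical
  obtain ⟨a, ha⟩ := hv
  obtain ⟨j, hj, hmin⟩ := Finset.exists_min_image (Finset.univ.filter fun j => x j 0 < x i 0) (fun j => slp (x j) (x i))
    (by obtain ⟨j, hj⟩ := hl; exact ⟨j, by simp [hj]⟩)
  have hj' : x j 0 < x i 0 := by simpa using hj
  have hji : j ≠ i := by rintro rfl; exact lt_irrefl _ hj'
  refine ⟨j, hj', fun k hkj hki => ?_⟩
  set s := slp (x j) (x i) with hs
  have hsl : x i 1 - x j 1 = s * (x i 0 - x j 0) := by
    rw [hs, slp, div_mul_cancel₀]; linarith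
  have has : a < s := by
    have := ha j hji
    by_contra hc
    nlinarith
  change x k 1 - x j 1 < s * (x k 0 - x j 0)
  rcases lt_or_gt_of_ne (hg.ne k i hki) with h | h
  · have hm := hmin k (by simp [h])
    have hks : x i 1 - x k 1 = slp (x k) (x i) * (x i 0 - x k 0) := by
      rw [slp, div_mul_cancel₀]; linarith
    have hle : x k 1 - x j 1 ≤ s * (x k 0 - x j 0) := by nlinarith
    refine lt_of_le_of_ne hle fun he => hg.cr j i k hji hkj hki ?_
    unfold cr
    rw [he, hsl]; ring
  · have := ha k hki
    nlinarith

lemma edge_unique {n : ℕ} {x : Fin n → EE} {i j j' : Fin n} (h : Edge x j i) (h' : Edge x j' i) : j = j' := by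
  by_contra hne
  have h1 := h.1
  have h1' := h'.1
  have hji : j ≠ i := by rintro rfl; exact lt_irrefl _ h1
  have hji' : j' ≠ i := by rintro rfl; exact lt_irrefl _ h1'
  have a1 : x j' 1 - x j 1 < slp (x j) (x i) * (x j' 0 - x j 0) := h.2 j' (Ne.symm hne) hji'
  have a2 : x j 1 - x j' 1 < slp (x j') (x i) * (x j 0 - x j' 0) := h'.2 j hne hji
  have e1 : x i 1 - x j 1 = slp (x j) (x i) * (x i 0 - x j 0) := by rw [slp, div_mul_cancel₀]; linarith
  have e2 : x i 1 - x j' 1 = slp (x j') (x i) * (x i 0 - x j' 0) := by rw [slp, div_mul_cancel₀]; linarith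
  set s := slp (x j) (x i)
  set s' := slp (x j') (x i)
  have b1 : s < s' := by
    by_contra hc
    nlinarith
  nlinarith

open Classical in
theorem ff_edges {n : ℕ} (hn : 0 < n) {x : Fin n → EE} (hg : GP x) :
    ff x = 1 + ∑ i, ∑ j, (if Edge x j i then (1:ℝ) else 0) := by
  obtain ⟨i0, _, h0⟩ := Finset.exists_min_image (Finset.univ : Finset (Fin n)) (fun j => x j 0) ⟨⟨0, hn⟩, Finset.mem_univ _⟩
  have h0' : ∀ j, j ≠ i0 → x i0 0 < x j 0 := fun j hj =>
    lt_of_le_of_ne (h0 j (Finset.mem_univ _)) (hg.ne _ _ (Ne.symm hj))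
  have key : ∀ i, vf x i = (if i = i0 then (1:ℝ) else 0) + ∑ j, (if Edge x j i then (1:ℝ) else 0) := by
    intro i
    by_cases hi : i = i0
    · subst hi
      have hv : Vert x i := (vert_iff x i).2 (left_vert h0')
      have : ∀ j, ¬ Edge x j i := fun j hj => absurd (h0 j (Finset.mem_univ _)) (not_le.2 hj.1)
      simp [vf, hv, this]
    · rw [if_neg hi, zero_add]
      by_cases hv : Vert x i
      · obtain ⟨j, hj⟩ := vert_edge hg ((vert_iff x i).1 hv) ⟨i0, h0' i hi⟩
        rw [Finset.sum_eq_single j (fun k _ hk => if_neg fun he => hk (edge_unique he hj)) (by simp), if_pos hj]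
        simp [vf, hv]
      · have : ∀ j, ¬ Edge x j i := fun j hj => hv ((vert_iff x i).2 (edge_vert hj))
        simp [vf, hv, this]
  unfold ff
  rw [Finset.sum_congr rfl fun i _ => key i, Finset.sum_add_distrib]
  simp
end CP

namespace CP
open MeasureTheory Filter Topology
open scoped ENNReal

section gen
variable {m : ℕ} {α : Type*} [MeasurableSpace α] (ν : Measure α) [IsProbabilityMeasure ν]

lemma split_at (k : Fin (m+1)) (S : Set (α × (Fin m → α))) (hS : MeasurableSet S) :
    (Measure.pi fun _ : Fin (m+1) => ν) {x | (x k, fun j => x (k.succAbove j)) ∈ S} = (ν.prod (Measure.pi fun _ : Fin m => ν)) S := by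
  have h := (measurePreserving_piFinSuccAbove (fun _ : Fin (m+1) => ν) k).measure_preimage hS.nullMeasurableSet
  rw [← h]
  rfl
end gen

lemma line_null (β c s : ℝ) (p0 : ℝ) : betaMeasure β {y : EE | y 1 = c + s * (y 0 - p0)} = 0 := by
  apply bm_ac β
  have hm : MeasurableSet {y : EE | y 1 = c + s * (y 0 - p0)} := measurableSet_eq_fun (by fun_prop) (by fun_prop)
  rw [← lintegral_indicator_one hm, lint_E _ (measurable_one.indicator hm)]
  have : ∀ a : ℝ, ∫⁻ b : ℝ, Set.indicator {y : EE | y 1 = c + s * (y 0 - p0)} (1 : EE → ℝ≥0∞) !₂[a, b] = 0 := by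
    intro a
    have e : (fun b : ℝ => Set.indicator {y : EE | y 1 = c + s * (y 0 - p0)} (1 : EE → ℝ≥0∞) !₂[a, b]) = Set.indicator {c + s * (a - p0)} 1 := by
      funext b
      by_cases hb : b = c + s * (a - p0) <;> simp [Set.indicator, hb]
    rw [e, lintegral_indicator_one (measurableSet_singleton _)]
    simp
  simp only [this, lintegral_zero]

lemma vline_null (β c : ℝ) : betaMeasure β {y : EE | y 0 = c} = 0 := by
  apply bm_ac β
  have hm : MeasurableSet {y : EE | y 0 = c} := measurableSet_eq_fun (by fun_prop) (by fun_prop)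
  rw [← lintegral_indicator_one hm, lint_E _ (measurable_one.indicator hm)]
  have : ∀ᵐ a : ℝ, ∫⁻ b : ℝ, Set.indicator {y : EE | y 0 = c} (1 : EE → ℝ≥0∞) !₂[a, b] = 0 := by
    filter_upwards [measure_eq_zero_iff_ae_notMem.1 (Real.volume_singleton (a := c))] with a ha
    have ha' : a ≠ c := ha
    simp [Set.indicator, ha']
  rw [lintegral_congr_ae this, lintegral_zero]

lemma ne_ae {β : ℝ} (hβ : 0 ≤ β) {n : ℕ} (i j : Fin n) (hij : i ≠ j) : ∀ᵐ x ∂betaPi β n, x i 0 ≠ x j 0 := by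
  have := bm_prob hβ
  obtain _ | m := n
  · exact i.elim0
  obtain ⟨j', rfl⟩ := Fin.exists_succAbove_eq (Ne.symm hij)
  set S : Set (EE × (Fin m → EE)) := {q | q.1 0 = q.2 j' 0} with hS
  have hm : MeasurableSet S := measurableSet_eq_fun (by fun_prop) (by fun_prop)
  have h := split_at (betaMeasure β) i S hm
  rw [ae_iff]
  simp only [not_not]
  refine Eq.trans h ?_
  rw [Measure.prod_apply_symm hm]
  refine (lintegral_congr fun y => ?_).trans lintegral_zero
  exact vline_null β (y j' 0)

lemma cr_ae {β : ℝ} (hβ : 0 ≤ β) {n : ℕ} (i j k : Fin n) (hij : i ≠ j) (hki : k ≠ i) (hkj : k ≠ j) :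
    ∀ᵐ x ∂betaPi β n, cr (x i) (x j) (x k) ≠ 0 := by
  have := bm_prob hβ
  obtain _ | m := n
  · exact i.elim0
  obtain ⟨j', rfl⟩ := Fin.exists_succAbove_eq (Ne.symm hkj)
  obtain ⟨i', rfl⟩ := Fin.exists_succAbove_eq (Ne.symm hki)
  set S : Set (EE × (Fin m → EE)) := {q | q.2 i' 0 ≠ q.2 j' 0 ∧ cr (q.2 i') (q.2 j') q.1 = 0} with hS
  have hm : MeasurableSet S := by
    apply MeasurableSet.inter
    · exact (measurableSet_eq_fun (f := fun q : EE × (Fin m → EE) => q.2 i' 0) (g := fun q : EE × (Fin m → EE) => q.2 j' 0) (by fun_prop) (by fun_prop)).compl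
    · unfold cr
      exact measurableSet_eq_fun (by fun_prop) (by fun_prop)
  have h := split_at (betaMeasure β) k S hm
  have h0 : (Measure.pi fun _ : Fin (m+1) => betaMeasure β) {x | (x k, fun j => x (k.succAbove j)) ∈ S} = 0 := by
    rw [h, Measure.prod_apply_symm hm]
    refine (lintegral_congr fun y => ?_).trans lintegral_zero
    by_cases hy : y i' 0 = y j' 0
    · have : (fun x => (x, y)) ⁻¹' S = ∅ := by ext p; simp [hS, hy]
      rw [this]; simp
    · refine measure_mono_null ?_ (line_null β (y i' 1) ((y j' 1 - y i' 1) / (y j' 0 - y i' 0)) (y i' 0))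
      rintro p ⟨_, hp⟩
      have hd : y j' 0 - y i' 0 ≠ 0 := sub_ne_zero.2 (Ne.symm hy)
      simp only [cr] at hp
      simp only [Set.mem_ofPred_eq]
      field_simp
      linarith
  filter_upwards [ne_ae hβ _ _ hij, measure_eq_zero_iff_ae_notMem.1 h0] with x hx hx2 hc
  exact hx2 ⟨hx, hc⟩

lemma gp_ae {β : ℝ} (hβ : 0 ≤ β) (n : ℕ) : ∀ᵐ x ∂betaPi β n, GP x := by
  have h1 : ∀ᵐ x ∂betaPi β n, ∀ i j, i ≠ j → x i 0 ≠ x j 0 := by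
    rw [ae_all_iff]; intro i
    rw [ae_all_iff]; intro j
    by_cases h : i = j
    · exact Eventually.of_forall fun _ h' => absurd h h'
    · exact (ne_ae hβ i j h).mono fun x hx _ => hx
  have h2 : ∀ᵐ x ∂betaPi β n, ∀ i j k, i ≠ j → k ≠ i → k ≠ j → cr (x i) (x j) (x k) ≠ 0 := by
    rw [ae_all_iff]; intro i
    rw [ae_all_iff]; intro j
    rw [ae_all_iff]; intro k
    by_cases h : i ≠ j ∧ k ≠ i ∧ k ≠ j
    · exact (cr_ae hβ i j k h.1 h.2.1 h.2.2).mono fun x hx _ _ _ => hx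
    · exact Eventually.of_forall fun _ a b c => absurd ⟨a, b, c⟩ h
  filter_upwards [h1, h2] with x a b using ⟨a, b⟩

lemma up_ae {β : ℝ} (hβ : 0 ≤ β) (n : ℕ) : ∀ᵐ x ∂betaPi β n, upCount x = ff x := by
  filter_upwards [gp_ae hβ n] with x hx
  refine upCount_eq x fun i j hij => ?_
  by_contra hne
  exact hx.ne i j hne (by rw [hij])

lemma below_meas {X : Type*} [MeasurableSpace X] {f g k : X → EE} (hf : Measurable f) (hg : Measurable g) (hk : Measurable k) :
    MeasurableSet {x | k x ∈ Below (f x) (g x)} := by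
  simp only [Below, slp, Set.mem_ofPred_eq]
  apply measurableSet_lt <;> fun_prop

open Classical in
lemma edge_prob {β : ℝ} (hβ : 0 ≤ β) {m : ℕ} (j i : Fin (m+2)) (hij : i ≠ j) :
    betaPi β (m+2) {x | Edge x j i} = ∫⁻ p, ∫⁻ q, (if p 0 < q 0 then (betaMeasure β (Below p q)) ^ m else 0) ∂betaMeasure β ∂betaMeasure β := by
  have := bm_prob hβ
  obtain ⟨i', rfl⟩ := Fin.exists_succAbove_eq hij
  set S : Set (EE × (Fin (m+1) → EE)) := {q | q.1 0 < q.2 i' 0 ∧ ∀ k : Fin m, q.2 (i'.succAbove k) ∈ Below q.1 (q.2 i')} with hS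
  have hm : MeasurableSet S := by
    have h1 : MeasurableSet {q : EE × (Fin (m+1) → EE) | q.1 0 < q.2 i' 0} := measurableSet_lt (by fun_prop) (by fun_prop)
    have h2 : MeasurableSet {q : EE × (Fin (m+1) → EE) | ∀ k : Fin m, q.2 (i'.succAbove k) ∈ Below q.1 (q.2 i')} := by
      rw [Set.ofPred_forall]
      exact MeasurableSet.iInter fun k => below_meas (by fun_prop) (by fun_prop) (by fun_prop)
    exact h1.inter h2
  have e : {x : Fin (m+2) → EE | Edge x j (j.succAbove i')} = {x | (x j, fun k => x (j.succAbove k)) ∈ S} := by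
    ext x
    simp only [Edge, hS, Set.mem_ofPred_eq]
    refine and_congr_right fun _ => ⟨fun h k => h _ (Fin.succAbove_ne _ _) fun hk => ?_, fun h k hkj hki => ?_⟩
    · exact Fin.succAbove_ne _ _ (Fin.succAbove_right_injective hk)
    · obtain ⟨k', rfl⟩ := Fin.exists_succAbove_eq hkj
      have : k' ≠ i' := fun h => hki (by rw [h])
      obtain ⟨k'', rfl⟩ := Fin.exists_succAbove_eq this
      exact h k''
  rw [e]
  refine (split_at (betaMeasure β) j S hm).trans ?_
  rw [Measure.prod_apply hm]
  refine lintegral_congr fun p => ?_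
  set S' : Set (EE × (Fin m → EE)) := {q | p 0 < q.1 0 ∧ ∀ k : Fin m, q.2 k ∈ Below p q.1} with hS'
  have hm' : MeasurableSet S' := by
    have h1 : MeasurableSet {q : EE × (Fin m → EE) | p 0 < q.1 0} := measurableSet_lt (by fun_prop) (by fun_prop)
    have h2 : MeasurableSet {q : EE × (Fin m → EE) | ∀ k : Fin m, q.2 k ∈ Below p q.1} := by
      rw [Set.ofPred_forall]
      exact MeasurableSet.iInter fun k => below_meas (by fun_prop) (by fun_prop) (by fun_prop)
    exact h1.inter h2
  refine (split_at (betaMeasure β) i' S' hm').trans ?_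
  rw [Measure.prod_apply hm']
  refine lintegral_congr fun q => ?_
  by_cases h : p 0 < q 0
  · rw [if_pos h]
    have : Prod.mk q ⁻¹' S' = Set.pi Set.univ fun _ : Fin m => Below p q := by
      ext w; simp [hS', h]
    rw [this, Measure.pi_pi]; simp
  · rw [if_neg h]
    have : Prod.mk q ⁻¹' S' = ∅ := by
      ext w; simp [hS', h]
    rw [this]; simp

end CP

namespace CP
open MeasureTheory Filter Topology
open scoped ENNReal

lemma swap4 (Φ : ℝ → ℝ → ℝ → ℝ → ℝ≥0∞)
    (h : Measurable fun p : (ℝ × ℝ) × (ℝ × ℝ) => Φ p.1.1 p.1.2 p.2.1 p.2.2) :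
    ∫⁻ x, ∫⁻ y, ∫⁻ a, ∫⁻ t, Φ x y a t = ∫⁻ a, ∫⁻ t, ∫⁻ x, ∫⁻ y, Φ x y a t := by
  have e1 : ∀ x y, ∫⁻ a, ∫⁻ t, Φ x y a t = ∫⁻ q : ℝ × ℝ, Φ x y q.1 q.2 := fun x y =>
    lintegral_lintegral (h.comp (measurable_prodMk_left (x := (x, y)))).aemeasurable
  have e2 : ∀ a t, ∫⁻ x, ∫⁻ y, Φ x y a t = ∫⁻ q : ℝ × ℝ, Φ q.1 q.2 a t := fun a t =>
    lintegral_lintegral (h.comp (measurable_prodMk_right (y := (a, t)))).aemeasurable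
  simp_rw [e1, e2]
  have m1 : Measurable fun p : ℝ × ℝ => ∫⁻ q : ℝ × ℝ, Φ p.1 p.2 q.1 q.2 := h.lintegral_prod_right'
  have m2 : Measurable fun q : ℝ × ℝ => ∫⁻ p : ℝ × ℝ, Φ p.1 p.2 q.1 q.2 := h.lintegral_prod_left'
  rw [lintegral_lintegral (f := fun x y => ∫⁻ q : ℝ × ℝ, Φ x y q.1 q.2) m1.aemeasurable,
    lintegral_lintegral (f := fun a t => ∫⁻ q : ℝ × ℝ, Φ q.1 q.2 a t) m2.aemeasurable]
  exact lintegral_lintegral_swap (f := fun p q : ℝ × ℝ => Φ p.1 p.2 q.1 q.2) h.aemeasurable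

open Classical in
lemma bp_core (W H : ℝ → ℝ≥0∞) (hW : Measurable W) (hH : Measurable H) (hfin : ∀ s, W s ≠ ⊤) :
    ∫⁻ x₁ : ℝ, ∫⁻ y₁ : ℝ, W (x₁^2+y₁^2) * ∫⁻ x₂ : ℝ, ∫⁻ y₂ : ℝ, W (x₂^2+y₂^2) *
      (if x₁ < x₂ then H ((y₁ - (y₂-y₁)/(x₂-x₁)*x₁)/√(1+((y₂-y₁)/(x₂-x₁))^2)) else 0)
    = ∫⁻ a : ℝ, ∫⁻ t : ℝ, ∫⁻ x₁ : ℝ, ∫⁻ x₂ : ℝ, ENNReal.ofReal √(1+a^2) * (ENNReal.ofReal (x₂-x₁) *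
      (W (x₁^2+(a*x₁+√(1+a^2)*t)^2) * (W (x₂^2+(a*x₂+√(1+a^2)*t)^2) * H t))) := by
  rw [← swap4 (fun x₁ x₂ a t => ENNReal.ofReal √(1+a^2) * (ENNReal.ofReal (x₂-x₁) *
      (W (x₁^2+(a*x₁+√(1+a^2)*t)^2) * (W (x₂^2+(a*x₂+√(1+a^2)*t)^2) * H t)))) (by fun_prop)]
  refine lintegral_congr fun x₁ => ?_
  have s1 : ∀ y₁ : ℝ, W (x₁^2+y₁^2) * ∫⁻ x₂ : ℝ, ∫⁻ y₂ : ℝ, W (x₂^2+y₂^2) *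
      (if x₁ < x₂ then H ((y₁ - (y₂-y₁)/(x₂-x₁)*x₁)/√(1+((y₂-y₁)/(x₂-x₁))^2)) else 0)
      = ∫⁻ x₂ : ℝ, ∫⁻ a : ℝ, W (x₁^2+y₁^2) * (ENNReal.ofReal (x₂-x₁) * (W (x₂^2+(y₁+(x₂-x₁)*a)^2) *
        H ((y₁ - a * x₁)/√(1+a^2)))) := by
    intro y₁
    rw [← lintegral_const_mul' _ _ (hfin _)]
    refine lintegral_congr fun x₂ => ?_
    rw [← lintegral_const_mul' _ _ (hfin _)]
    by_cases hx : x₁ < x₂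
    · simp only [if_pos hx]
      have hd : 0 < x₂ - x₁ := by linarith
      rw [lint_affine _ (x₂-x₁) y₁ hd.ne']
      refine lintegral_congr fun a => ?_
      rw [abs_of_pos hd]
      have : (y₁ + (x₂-x₁)*a - y₁)/(x₂-x₁) = a := by field_simp; ring
      rw [this]
      ring
    · have : ENNReal.ofReal (x₂-x₁) = 0 := ENNReal.ofReal_eq_zero.2 (by linarith)
      simp [if_neg hx, this]
  simp_rw [s1]
  have mm : Measurable fun p : (ℝ × ℝ) × ℝ => W (x₁^2+p.1.1^2) * (ENNReal.ofReal (p.1.2-x₁) * (W (p.1.2^2+(p.1.1+(p.1.2-x₁)*p.2)^2) *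
        H ((p.1.1 - p.2 * x₁)/√(1+p.2^2)))) := by fun_prop
  rw [lintegral_lintegral_swap]
  swap
  · exact mm.lintegral_prod_right'.aemeasurable
  refine lintegral_congr fun x₂ => ?_
  rw [lintegral_lintegral_swap]
  swap
  · refine Measurable.aemeasurable ?_
    exact mm.comp (by fun_prop : Measurable fun p : ℝ × ℝ => ((p.1, x₂), p.2))
  refine lintegral_congr fun a => ?_
  have hr : 0 < √(1+a^2) := Real.sqrt_pos.2 (by positivity)
  rw [lint_affine _ (√(1+a^2)) (a*x₁) hr.ne']
  refine lintegral_congr fun t => ?_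
  rw [abs_of_pos hr]
  have e1 : (a * x₁ + √(1 + a ^ 2) * t - a * x₁) / √(1 + a ^ 2) = t := by field_simp; ring
  have e2 : a * x₁ + √(1 + a ^ 2) * t + (x₂ - x₁) * a = a * x₂ + √(1 + a ^ 2) * t := by ring
  rw [e1, e2]
  ring

noncomputable def K2 (β : ℝ) : ℝ≥0∞ := ∫⁻ s : ℝ, ∫⁻ r : ℝ, ENNReal.ofReal (r - s) *
  (ENNReal.ofReal (rden β (s^2)) * ENNReal.ofReal (rden β (r^2)))

lemma quad (a t x s : ℝ) (ht : t^2 < 1) (hx : x = -(a*t/√(1+a^2)) + √(1-t^2)/√(1+a^2)*s) :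
    x^2+(a*x+√(1+a^2)*t)^2 = 1 - (1-t^2) + (1-t^2)*s^2 := by
  have hr : 0 < √(1+a^2) := Real.sqrt_pos.2 (by positivity)
  have h1 : √(1+a^2)^2 = 1+a^2 := Real.sq_sqrt (by positivity)
  have h2 : √(1-t^2)^2 = 1-t^2 := Real.sq_sqrt (by linarith)
  have h3 : √(1+a^2) * x = -(a*t) + √(1-t^2)*s := by rw [hx]; field_simp
  have h4 : x^2+(a*x+√(1+a^2)*t)^2 = (√(1+a^2) * x)^2 + 2*a*t*(√(1+a^2) * x) + √(1+a^2)^2*t^2 := by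
    rw [mul_pow, h1]; nlinarith [h1]
  rw [h4, h3, h1]
  nlinarith [h2]

lemma inner_val {β : ℝ} (a t : ℝ) (ht : t^2 < 1) (h : ℝ≥0∞) (hh : h ≠ ⊤) :
    ∫⁻ x₁ : ℝ, ∫⁻ x₂ : ℝ, ENNReal.ofReal √(1+a^2) * (ENNReal.ofReal (x₂-x₁) *
      (ENNReal.ofReal (rden β (x₁^2+(a*x₁+√(1+a^2)*t)^2)) * (ENNReal.ofReal (rden β (x₂^2+(a*x₂+√(1+a^2)*t)^2)) * h)))
    = ENNReal.ofReal ((1+a^2)⁻¹) * (ENNReal.ofReal ((1-t^2)^(2*β+3/2)) * h * K2 β) := by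
  have hr : 0 < √(1+a^2) := Real.sqrt_pos.2 (by positivity)
  have hR : 0 < 1 - t^2 := by linarith
  have hq : 0 < √(1-t^2) := Real.sqrt_pos.2 hR
  set l := √(1-t^2)/√(1+a^2) with hl
  have hl0 : 0 < l := by positivity
  rw [lint_affine _ l (-(a*t/√(1+a^2))) hl0.ne', K2]
  have hc : ENNReal.ofReal ((1-t^2)^(2*β+3/2)) * h ≠ ⊤ := ENNReal.mul_ne_top ENNReal.ofReal_ne_top hh
  rw [← lintegral_const_mul' _ _ hc, ← lintegral_const_mul' _ _ ENNReal.ofReal_ne_top]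
  refine lintegral_congr fun s => ?_
  rw [lint_affine _ l (-(a*t/√(1+a^2))) hl0.ne', ← lintegral_const_mul' _ _ ENNReal.ofReal_ne_top,
    ← lintegral_const_mul' _ _ hc, ← lintegral_const_mul' _ _ ENNReal.ofReal_ne_top]
  refine lintegral_congr fun r => ?_
  rw [quad a t _ s ht rfl, quad a t _ r ht rfl, rden_slice hR, rden_slice hR]
  have e : -(a * t / √(1 + a ^ 2)) + l * r - (-(a * t / √(1 + a ^ 2)) + l * s) = l * (r - s) := by ring
  rw [e, abs_of_pos hl0, ENNReal.ofReal_mul hl0.le, ENNReal.ofReal_mul (by positivity), ENNReal.ofReal_mul (by positivity)]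
  have key : ENNReal.ofReal l * ENNReal.ofReal l * ENNReal.ofReal √(1+a^2) * ENNReal.ofReal l * ENNReal.ofReal ((1-t^2)^β) * ENNReal.ofReal ((1-t^2)^β)
      = ENNReal.ofReal ((1+a^2)⁻¹) * ENNReal.ofReal ((1-t^2)^(2*β+3/2)) := by
    rw [← ENNReal.ofReal_mul (by positivity), ← ENNReal.ofReal_mul (by positivity), ← ENNReal.ofReal_mul (by positivity), ← ENNReal.ofReal_mul (by positivity), ← ENNReal.ofReal_mul (by positivity), ← ENNReal.ofReal_mul (by positivity)]
    congr 1
    have h1 : √(1+a^2)^2 = 1+a^2 := Real.sq_sqrt (by positivity)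
    have h2 : (1-t^2)^(2*β+3/2) = (1-t^2)^β * (1-t^2)^β * √(1-t^2)^3 := by
      generalize 1 - t^2 = R at hR
      rw [Real.sqrt_eq_rpow, ← Real.rpow_natCast, ← Real.rpow_mul hR.le, ← Real.rpow_add hR, ← Real.rpow_add hR]
      congr 1; push_cast; ring
    have h3 : (1+a^2)⁻¹ = (√(1+a^2)^2)⁻¹ := by rw [h1]
    rw [h2, h3, hl]
    field_simp
  calc _ = (ENNReal.ofReal l * ENNReal.ofReal l * ENNReal.ofReal √(1+a^2) * ENNReal.ofReal l * ENNReal.ofReal ((1-t^2)^β) * ENNReal.ofReal ((1-t^2)^β)) * (h * (ENNReal.ofReal (r-s) * (ENNReal.ofReal (rden β (s^2)) * ENNReal.ofReal (rden β (r^2))))) := by ring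
    _ = _ := by rw [key]; ring

lemma inner_zero {β : ℝ} (a t : ℝ) (ht : 1 < t^2) (x : ℝ) : rden β (x^2+(a*x+√(1+a^2)*t)^2) = 0 := by
  have h1 : √(1+a^2)^2 = 1+a^2 := Real.sq_sqrt (by positivity)
  unfold rden
  rw [if_neg]
  push Not
  nlinarith [sq_nonneg (√(1+a^2)*x + a*t)]

noncomputable def tpar (p q : EE) : ℝ := (p 1 - slp p q * p 0)/√(1+(slp p q)^2)

noncomputable def Hc (β : ℝ) (m : ℕ) (t : ℝ) : ℝ≥0∞ := ENNReal.ofReal (1 - capm β (1-t)) ^ m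

lemma Hc_meas {β : ℝ} (hβ : 0 ≤ β) (m : ℕ) : Measurable (Hc β m) := by
  have := (capm_mono hβ).measurable
  unfold Hc
  fun_prop

lemma below_prob {β : ℝ} (hβ : 0 ≤ β) (p q : EE) : betaMeasure β (Below p q) = ENNReal.ofReal (1 - capm β (1 - tpar p q)) := by
  have := bm_prob hβ
  set a := slp p q with ha
  have hr : 0 < √(1+a^2) := Real.sqrt_pos.2 (by positivity)
  have h1 : √(1+a^2)^2 = 1+a^2 := Real.sq_sqrt (by positivity)
  set e : EE := !₂[-a/√(1+a^2), 1/√(1+a^2)] with he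
  have hn : ‖e‖ = 1 := by
    have : ‖e‖^2 = 1 := by
      rw [normsq]; simp [he]; field_simp; rw [h1]; ring
    nlinarith [norm_nonneg e]
  have hm : MeasurableSet (Below p q) := below_meas measurable_const measurable_const measurable_id
  have hc : (Below p q)ᶜ = {x | tpar p q ≤ inner ℝ x e} := by
    ext x
    simp only [Below, Set.mem_compl_iff, Set.mem_ofPred_eq, not_lt, inner2, he, tpar, ← ha]
    simp only [Matrix.cons_val_zero, Matrix.cons_val_one]
    rw [show x 0 * (-a / √(1 + a ^ 2)) + x 1 * (1 / √(1 + a ^ 2)) = (x 1 - a * x 0)/√(1+a^2) by ring,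
      div_le_div_iff_of_pos_right hr]
    constructor <;> intro h <;> linarith
  have h2 := cap_rot β (tpar p q) e hn
  rw [← hc] at h2
  have h3 : capm β (1 - tpar p q) = (betaMeasure β).real (Below p q)ᶜ := by
    rw [capm, measureReal_def, measureReal_def, h2]; simp
  rw [h3, probReal_compl_eq_one_sub hm]
  simp

open Classical in
noncomputable def JJ (β : ℝ) (m : ℕ) : ℝ≥0∞ := ∫⁻ p, ∫⁻ q, (if p 0 < q 0 then (betaMeasure β (Below p q)) ^ m else 0) ∂betaMeasure β ∂betaMeasure β

noncomputable def II (β : ℝ) (m : ℕ) : ℝ≥0∞ :=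
  ∫⁻ t : ℝ, if t^2 < 1 then ENNReal.ofReal ((1-t^2)^(2*β+3/2)) * Hc β m t else 0

noncomputable def KA : ℝ≥0∞ := ∫⁻ a : ℝ, ENNReal.ofReal ((1+a^2)⁻¹)

lemma JJ_eq {β : ℝ} (hβ : 0 ≤ β) (hK : K2 β ≠ ⊤) (m : ℕ) : JJ β m = KA * (II β m * K2 β) := by
  classical
  have hHm := Hc_meas hβ m
  have e1 : ∀ p q : EE, (if p 0 < q 0 then (betaMeasure β (Below p q)) ^ m else 0) = if p 0 < q 0 then Hc β m (tpar p q) else 0 := by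
    intro p q
    rw [below_prob hβ, Hc]
  have hF : Measurable fun z : EE × EE => if z.1 0 < z.2 0 then Hc β m (tpar z.1 z.2) else 0 := by
    refine Measurable.ite (measurableSet_lt (by fun_prop) (by fun_prop)) (hHm.comp ?_) measurable_const
    unfold tpar slp
    fun_prop
  unfold JJ
  simp_rw [e1]
  rw [bm_lint β _ hF.lintegral_prod_right']
  have e2 : ∀ p : EE, ∫⁻ q, (if p 0 < q 0 then Hc β m (tpar p q) else 0) ∂betaMeasure β = _ := fun p =>
    bm_lint β _ (hF.comp measurable_prodMk_left)
  rw [lintegral_congr fun a => lintegral_congr fun b => congrArg (ENNReal.ofReal (rden β (a^2+b^2)) * ·) (e2 !₂[a,b])]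
  have hfin : ∀ s, ENNReal.ofReal (rden β s) ≠ ⊤ := fun s => ENNReal.ofReal_ne_top
  have h := bp_core (fun s => ENNReal.ofReal (rden β s)) (Hc β m) (rden_meas β).ennreal_ofReal hHm hfin
  simp only [Function.comp_def, tpar, slp, PiLp.toLp_apply, Matrix.cons_val_zero, Matrix.cons_val_one]
  refine h.trans ?_
  unfold KA
  rw [← lintegral_mul_const _ (by fun_prop)]
  refine lintegral_congr fun a => ?_
  unfold II
  rw [← lintegral_mul_const' _ _ hK, ← lintegral_const_mul' _ _ ENNReal.ofReal_ne_top]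
  refine lintegral_congr_ae ?_
  have hae : ∀ᵐ t : ℝ, t ≠ 1 ∧ t ≠ -1 := by
    have h1 : ∀ᵐ t : ℝ, t ≠ 1 := by simp [ae_iff]
    have h2 : ∀ᵐ t : ℝ, t ≠ -1 := by simp [ae_iff]
    exact h1.and h2
  filter_upwards [hae] with t ht
  have hH : Hc β m t ≠ ⊤ := ENNReal.pow_ne_top ENNReal.ofReal_ne_top
  by_cases h1 : t^2 < 1
  · rw [if_pos h1]
    exact inner_val a t h1 _ hH
  · have h2 : 1 < t^2 := by
      rcases (not_lt.1 h1).lt_or_eq with h | h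
      · exact h
      · exfalso
        have : (t-1)*(t+1) = 0 := by linarith
        rcases mul_eq_zero.1 this with h | h
        · exact ht.1 (by linarith)
        · exact ht.2 (by linarith)
    rw [if_neg h1]
    simp [inner_zero a t h2]

lemma K2_lt {β : ℝ} (hβ : 0 ≤ β) : K2 β ≠ ⊤ := by
  have hk := (kk_lt_top hβ).ne
  have h : K2 β ≤ 2 * (kk β * kk β) := by
    unfold K2 kk
    rw [← lintegral_mul_const _ (by have := rden_meas β; fun_prop), ← lintegral_const_mul' _ _ (by simp)]
    refine lintegral_mono fun s => ?_
    simp only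
    rw [← lintegral_const_mul' _ _ ENNReal.ofReal_ne_top, ← lintegral_const_mul' _ _ (by simp)]
    refine lintegral_mono fun r => ?_
    simp only
    by_cases hs : s^2 ≤ 1 ∧ r^2 ≤ 1
    · refine mul_le_mul_left ?_ _
      have h1 := abs_le.1 <| abs_le_of_sq_le_sq (a := s) (b := 1) (by linarith [hs.1]) (by norm_num)
      have h2 := abs_le.1 <| abs_le_of_sq_le_sq (a := r) (b := 1) (by linarith [hs.2]) (by norm_num)
      exact (ENNReal.ofReal_le_ofReal (show r - s ≤ 2 by linarith [h1.1, h2.2])).trans (by simp)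
    · have : rden β (s^2) = 0 ∨ rden β (r^2) = 0 := by
        rw [not_and_or] at hs
        exact hs.imp (fun h => by unfold rden; rw [if_neg h]) (fun h => by unfold rden; rw [if_neg h])
      rcases this with h | h <;> simp [h]
  exact ne_top_of_le_ne_top (ENNReal.mul_ne_top (by simp) (ENNReal.mul_ne_top hk hk)) h

lemma K2_pos {β : ℝ} (hβ : 0 ≤ β) : K2 β ≠ 0 := by
  have hr := rden_meas β
  intro h0
  unfold K2 at h0
  rw [lintegral_eq_zero_iff (by
    have : Measurable fun p : ℝ × ℝ => ENNReal.ofReal (p.2 - p.1) * (ENNReal.ofReal (rden β (p.1^2)) * ENNReal.ofReal (rden β (p.2^2))) := by fun_prop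
    exact this.lintegral_prod_right')] at h0
  have : ∀ᵐ s : ℝ, s ∉ Set.Ioo (-1:ℝ) 0 := by
    filter_upwards [h0] with s hs hs1
    simp only [Pi.zero_apply] at hs
    rw [lintegral_eq_zero_iff (by fun_prop)] at hs
    have h2 : ∀ᵐ r : ℝ, r ∉ Set.Ioo (0:ℝ) 1 := by
      filter_upwards [hs] with r hr hr1
      have p1 : 0 < rden β (s^2) := by
        unfold rden
        have : s^2 < 1 := by nlinarith [hs1.1, hs1.2]
        rw [if_pos this.le]
        have : 0 < 1 - s^2 := by linarith
        positivity
      have p2 : 0 < rden β (r^2) := by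
        unfold rden
        have : r^2 < 1 := by nlinarith [hr1.1, hr1.2]
        rw [if_pos this.le]
        have : 0 < 1 - r^2 := by linarith
        positivity
      have p3 : 0 < r - s := by linarith [hs1.2, hr1.1]
      simp at hr
      grind
    have h3 := measure_eq_zero_iff_ae_notMem.2 h2
    simp [Real.volume_Ioo] at h3
  have h3 := measure_eq_zero_iff_ae_notMem.2 this
  simp [Real.volume_Ioo] at h3

lemma KA_lt : KA ≠ ⊤ := by
  have := integrable_inv_one_add_sq
  rw [← lintegral_ofReal_ne_top_iff_integrable this.aestronglyMeasurable (Eventually.of_forall fun x => by positivity)] at this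
  exact this

lemma KA_pos : KA ≠ 0 := by
  unfold KA
  rw [Ne, lintegral_eq_zero_iff (by fun_prop)]
  intro h
  have : ∀ᵐ x : ℝ, False := by
    filter_upwards [h] with x hx
    have : 0 < (1+x^2)⁻¹ := by positivity
    simp at hx
    nlinarith [sq_nonneg x]
  simp [ae_iff] at this

end CP

namespace CP
open MeasureTheory Filter Topology
open scoped ENNReal

noncomputable def hh (β : ℝ) (m : ℕ) : ℝ := (m:ℝ) ^ (-(1/(β+3/2)))

noncomputable def FF (β : ℝ) (m : ℕ) (v : ℝ) : ℝ≥0∞ :=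
  if 0 < v ∧ hh β m * v < 2 then ENNReal.ofReal (v^(2*β+3/2) * (2 - hh β m * v)^(2*β+3/2) * (1 - capm β (hh β m * v))^m) else 0

lemma hh_pos {β : ℝ} {m : ℕ} (hm : 0 < m) : 0 < hh β m := by
  unfold hh
  have : (0:ℝ) < m := by exact_mod_cast hm
  positivity

lemma II_scale {β : ℝ} (hβ : 0 ≤ β) {m : ℕ} (hm : 0 < m) :
    II β m = ENNReal.ofReal ((m:ℝ)^(-(2 - al β))) * ∫⁻ v, FF β m v := by
  have hp := hh_pos (β := β) hm
  have hm' : (0:ℝ) < m := by exact_mod_cast hm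
  unfold II
  rw [lint_affine _ (-hh β m) 1 (by simpa using hp.ne'), ← lintegral_const_mul' _ _ ENNReal.ofReal_ne_top]
  refine lintegral_congr fun v => ?_
  rw [abs_neg, abs_of_pos hp]
  set h := hh β m with hh'
  have hiff : (1 + -h*v)^2 < 1 ↔ (0 < v ∧ h * v < 2) := by
    constructor
    · intro H
      have h1 : 0 < h*v := by nlinarith
      have h2 : 0 < v := by
        by_contra hv
        push Not at hv
        nlinarith [mul_nonneg hp.le (neg_nonneg.2 hv)]
      exact ⟨h2, by nlinarith⟩
    · rintro ⟨h1, h2⟩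
      have := mul_pos hp h1
      nlinarith
  unfold FF
  rw [← hh']
  by_cases hc : 0 < v ∧ h * v < 2
  · rw [if_pos hc, if_pos (hiff.2 hc)]
    have h1 := capm_le_one hβ (h * v)
    have h2 : 0 < 2 - h*v := by linarith [hc.2]
    have h3 : 0 < v := hc.1
    rw [Hc, ← ENNReal.ofReal_pow (by rw [show 1 - (1 + -h*v) = h*v by ring]; linarith), ← ENNReal.ofReal_mul (by rw [show 1 - (1 + -h * v) ^ 2 = (h*v)*(2-h*v) by ring]; positivity), ← ENNReal.ofReal_mul hp.le, ← ENNReal.ofReal_mul (by positivity)]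
    congr 1
    rw [show 1 - (1 + -h*v) = h*v by ring, show 1 - (1 + -h * v) ^ 2 = (h*v)*(2-h*v) by ring,
      Real.mul_rpow (by positivity) h2.le, Real.mul_rpow hp.le h3.le]
    have : (m:ℝ)^(-(2 - al β)) = h * h^(2*β+3/2) := by
      rw [hh', hh, ← Real.rpow_mul hm'.le, ← Real.rpow_add hm']
      congr 1
      unfold al
      have : β + 3/2 ≠ 0 := by positivity
      have : 2*β + 3 ≠ 0 := by positivity
      field_simp
      ring
    rw [this]; ring
  · rw [if_neg hc, if_neg (fun h => hc (hiff.1 h))]; simp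

noncomputable def FL (β : ℝ) (v : ℝ) : ℝ≥0∞ :=
  if 0 < v then ENNReal.ofReal (v^(2*β+3/2) * 2^(2*β+3/2) * Real.exp (-(2^(β+1/2)*k1 β*v^(β+3/2)))) else 0

noncomputable def FB (β : ℝ) (v : ℝ) : ℝ≥0∞ :=
  if 0 < v then ENNReal.ofReal (2^(2*β+3/2) * (v^(2*β+3/2) * Real.exp (-(c0 β)*v^(β+3/2)))) else 0

lemma hh_tendsto {β : ℝ} (hβ : 0 ≤ β) : Tendsto (hh β) atTop (𝓝 0) := by
  unfold hh
  exact (tendsto_rpow_neg_atTop (by positivity)).comp tendsto_natCast_atTop_atTop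

lemma hh_pow {β : ℝ} (hβ : 0 ≤ β) {m : ℕ} (hm : 0 < m) {v : ℝ} (hv : 0 ≤ v) :
    (m:ℝ) * (hh β m * v)^(β+3/2) = v^(β+3/2) := by
  have hm' : (0:ℝ) < m := by exact_mod_cast hm
  rw [Real.mul_rpow (hh_pos hm).le hv, hh, ← Real.rpow_mul hm'.le]
  have : -(1 / (β + 3 / 2)) * (β + 3 / 2) = -1 := by
    have : β + 3/2 ≠ 0 := by positivity
    field_simp
  rw [this, Real.rpow_neg_one]; field_simp

lemma FF_le {β : ℝ} (hβ : 0 ≤ β) {m : ℕ} (hm : 0 < m) (v : ℝ) : FF β m v ≤ FB β v := by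
  unfold FF FB
  by_cases hc : 0 < v ∧ hh β m * v < 2
  · rw [if_pos hc, if_pos hc.1]
    apply ENNReal.ofReal_le_ofReal
    have hp := hh_pos (β := β) hm
    have h3 : 0 < v := hc.1
    have h2 : 0 < 2 - hh β m * v := by linarith [hc.2]
    have h4 : (2 - hh β m * v)^(2*β+3/2) ≤ 2^(2*β+3/2) :=
      Real.rpow_le_rpow h2.le (by have := mul_pos hp h3; linarith) (by positivity)
    have h5 : (1 - capm β (hh β m * v))^m ≤ Real.exp (-(c0 β)*v^(β+3/2)) := by
      have h6 := capm_lb hβ (hh β m * v) (by positivity) hc.2.le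
      calc (1 - capm β (hh β m * v))^m ≤ (Real.exp (-(capm β (hh β m * v))))^m := by
            refine pow_le_pow_left₀ (by linarith [capm_le_one hβ (hh β m * v)]) ?_ _
            have := Real.add_one_le_exp (-(capm β (hh β m * v)))
            linarith
        _ = Real.exp (-((m:ℝ) * capm β (hh β m * v))) := by rw [← Real.exp_nat_mul]; ring_nf
        _ ≤ _ := by
            apply Real.exp_le_exp.2
            have := mul_le_mul_of_nonneg_left h6 (Nat.cast_nonneg (α := ℝ) m)
            rw [← hh_pow hβ hm h3.le]
            linarith
    have h7 : 0 ≤ 1 - capm β (hh β m * v) := by linarith [capm_le_one hβ (hh β m * v)]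
    calc _ ≤ v^(2*β+3/2) * 2^(2*β+3/2) * Real.exp (-(c0 β)*v^(β+3/2)) := by gcongr
      _ = _ := by ring
  · rw [if_neg hc]; exact zero_le

lemma FF_lim {β : ℝ} (hβ : 0 ≤ β) (v : ℝ) : Tendsto (fun m => FF β m v) atTop (𝓝 (FL β v)) := by
  by_cases hv : 0 < v
  swap
  · have : (fun m => FF β m v) = fun _ => 0 := by
      ext m; unfold FF; rw [if_neg (fun h => hv h.1)]
    rw [this, FL, if_neg hv]; exact tendsto_const_nhds
  have hs : Tendsto (fun m => hh β m * v) atTop (𝓝 0) := by simpa using (hh_tendsto hβ).mul_const v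
  have hev : ∀ᶠ m in atTop, hh β m * v < 2 := hs.eventually_lt_const (by norm_num)
  rw [FL, if_pos hv]
  have h2s : Tendsto (fun m => 2 - hh β m * v) atTop (𝓝 2) := by simpa using hs.const_sub 2
  have hcap : Tendsto (fun m : ℕ => (m:ℝ) * (-(capm β (hh β m * v)))) atTop (𝓝 (-(2^(β+1/2)*k1 β*v^(β+3/2)))) := by
    have : Tendsto (fun m : ℕ => (m:ℝ) * ((capm β (hh β m * v)))) atTop (𝓝 ((2^(β+1/2)*k1 β*v^(β+3/2)))) := by
      refine tendsto_of_tendsto_of_tendsto_of_le_of_le' (g := fun m => (2 - hh β m * v)^(β+1/2) * k1 β * v^(β+3/2)) (h := fun _ => 2^(β+1/2)*k1 β*v^(β+3/2)) ?_ tendsto_const_nhds ?_ ?_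
      · exact ((h2s.rpow_const (Or.inl (by norm_num))).mul_const _).mul_const _
      · filter_upwards [hev, eventually_gt_atTop 0] with m h1 hm
        have := capm_ge hβ (hh β m * v) (mul_pos (hh_pos hm) hv).le h1.le
        have := mul_le_mul_of_nonneg_left this (Nat.cast_nonneg (α := ℝ) m)
        refine le_trans (le_of_eq ?_) this
        rw [← hh_pow hβ hm hv.le]; ring
      · filter_upwards [hev, eventually_gt_atTop 0] with m h1 hm
        have := capm_le hβ (hh β m * v) (mul_pos (hh_pos hm) hv).le h1.le
        have := mul_le_mul_of_nonneg_left this (Nat.cast_nonneg (α := ℝ) m)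
        refine le_trans this (le_of_eq ?_)
        rw [← hh_pow hβ hm hv.le]; ring
    simpa using this.neg
  have hpow := Real.tendsto_one_add_pow_exp_of_tendsto hcap
  have := ENNReal.tendsto_ofReal ((tendsto_const_nhds (x := v^(2*β+3/2))).mul (h2s.rpow_const (p := 2*β+3/2) (Or.inl (by norm_num))) |>.mul hpow)
  refine this.congr' ?_
  filter_upwards [hev] with m hm
  rw [FF, if_pos ⟨hv, hm⟩]
  simp only [sub_eq_add_neg]

lemma FB_fin {β : ℝ} (hβ : 0 ≤ β) : ∫⁻ v, FB β v ≠ ⊤ := by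
  have hi := integrableOn_rpow_mul_exp_neg_mul_rpow (p := β+3/2) (s := 2*β+3/2) (b := c0 β) (by linarith) (by linarith) (c0_pos hβ)
  have hi2 := (hi.const_mul ((2:ℝ)^(2*β+3/2))).lintegral_lt_top
  have : ∫⁻ v, FB β v = ∫⁻ v in Set.Ioi (0:ℝ), ENNReal.ofReal (2^(2*β+3/2) * (v^(2*β+3/2) * Real.exp (-(c0 β)*v^(β+3/2)))) := by
    rw [← lintegral_indicator measurableSet_Ioi]
    refine lintegral_congr fun v => ?_
    simp [FB, Set.indicator]
  rw [this]
  exact hi2.ne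

lemma FF_meas {β : ℝ} (hβ : 0 ≤ β) (m : ℕ) : Measurable (FF β m) := by
  have := (capm_mono hβ).measurable
  unfold FF
  refine Measurable.ite ?_ (by fun_prop) measurable_const
  have h1 : MeasurableSet {v : ℝ | 0 < v} := measurableSet_Ioi
  have h2 : MeasurableSet {v : ℝ | hh β m * v < 2} := measurableSet_lt (by fun_prop) (by fun_prop)
  exact h1.inter h2

lemma FF_int_lim {β : ℝ} (hβ : 0 ≤ β) : Tendsto (fun m => ∫⁻ v, FF β m v) atTop (𝓝 (∫⁻ v, FL β v)) := by
  rw [← tendsto_add_atTop_iff_nat 1]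
  refine tendsto_lintegral_of_dominated_convergence (FB β) (fun m => FF_meas hβ _) (fun m => Eventually.of_forall fun v => FF_le hβ (Nat.succ_pos m) v) (FB_fin hβ) (Eventually.of_forall fun v => ?_)
  exact (tendsto_add_atTop_iff_nat (f := fun m => FF β m v) 1).2 (FF_lim hβ v)

lemma FL_fin {β : ℝ} (hβ : 0 ≤ β) : ∫⁻ v, FL β v ≠ ⊤ := by
  refine ne_top_of_le_ne_top (FB_fin hβ) (lintegral_mono fun v => ?_)
  refine le_of_tendsto (FF_lim hβ v) ?_
  filter_upwards [eventually_gt_atTop 0] with m hm using FF_le hβ hm v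

lemma FL_pos {β : ℝ} : ∫⁻ v, FL β v ≠ 0 := by
  have hm : Measurable (FL β) := by
    unfold FL
    exact Measurable.ite measurableSet_Ioi (by fun_prop) measurable_const
  rw [Ne, lintegral_eq_zero_iff hm]
  intro h
  have h2 : ∀ᵐ v : ℝ, v ∉ Set.Ioo (0:ℝ) 1 := by
    filter_upwards [h] with v hv hv1
    have h0 : 0 < v := hv1.1
    rw [FL, if_pos h0] at hv
    have : 0 < v^(2*β+3/2) * 2^(2*β+3/2) * Real.exp (-(2^(β+1/2)*k1 β*v^(β+3/2))) := by positivity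
    simp only [Pi.zero_apply, ENNReal.ofReal_eq_zero] at hv
    linarith
  have h3 := measure_eq_zero_iff_ae_notMem.2 h2
  simp [Real.volume_Ioo] at h3

noncomputable def jj (β : ℝ) (m : ℕ) : ℝ := (JJ β m).toReal

lemma jj_lim {β : ℝ} (hβ : 0 ≤ β) : ∃ κ > 0, Tendsto (fun m : ℕ => jj β m * (m:ℝ)^(2 - al β)) atTop (𝓝 κ) := by
  refine ⟨KA.toReal * ((∫⁻ v, FL β v).toReal * (K2 β).toReal), ?_, ?_⟩
  · have h1 := ENNReal.toReal_pos KA_pos KA_lt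
    have h2 := ENNReal.toReal_pos (FL_pos (β := β)) (FL_fin hβ)
    have h3 := ENNReal.toReal_pos (K2_pos hβ) (K2_lt hβ)
    positivity
  · have h1 := (ENNReal.tendsto_toReal (FL_fin hβ)).comp (FF_int_lim hβ)
    refine ((h1.mul_const (K2 β).toReal).const_mul KA.toReal).congr' ?_
    filter_upwards [eventually_gt_atTop 0] with m hm
    have hm' : (0:ℝ) < m := by exact_mod_cast hm
    rw [jj, JJ_eq hβ (K2_lt hβ), II_scale hβ hm]
    simp only [ENNReal.toReal_mul, Function.comp]
    rw [ENNReal.toReal_ofReal (by positivity), Real.rpow_neg hm'.le]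
    field_simp

lemma JJ_conv {β : ℝ} (hβ : 0 ≤ β) (m : ℕ) : JJ β (m+1) + JJ β (m+1) ≤ JJ β m + JJ β (m+2) := by
  classical
  have hm : ∀ k, Measurable fun t : ℝ => if t^2 < 1 then ENNReal.ofReal ((1-t^2)^(2*β+3/2)) * Hc β k t else 0 := fun k => by
    have := Hc_meas hβ k
    exact Measurable.ite (measurableSet_lt (by fun_prop) (by fun_prop)) (by fun_prop) measurable_const
  have : II β (m+1) + II β (m+1) ≤ II β m + II β (m+2) := by
    unfold II
    rw [← lintegral_add_left (hm _), ← lintegral_add_left (hm _)]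
    refine lintegral_mono fun t => ?_
    simp only
    split_ifs
    · rw [← mul_add, ← mul_add]
      refine mul_le_mul_right ?_ _
      unfold Hc
      have h1 : 0 ≤ 1 - capm β (1-t) := by linarith [capm_le_one hβ (1-t)]
      set r := 1 - capm β (1-t)
      rw [← ENNReal.ofReal_pow h1, ← ENNReal.ofReal_pow h1, ← ENNReal.ofReal_pow h1, ← ENNReal.ofReal_add (by positivity) (by positivity), ← ENNReal.ofReal_add (by positivity) (by positivity)]
      apply ENNReal.ofReal_le_ofReal
      have : r^m + r^(m+2) - (r^(m+1)+r^(m+1)) = r^m*(r-1)^2 := by ring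
      have : 0 ≤ r^m*(r-1)^2 := by positivity
      linarith
    · simp
  rw [JJ_eq hβ (K2_lt hβ), JJ_eq hβ (K2_lt hβ), JJ_eq hβ (K2_lt hβ)]
  calc _ = KA * ((II β (m+1) + II β (m+1)) * K2 β) := by ring
    _ ≤ KA * ((II β m + II β (m+2)) * K2 β) := by gcongr
    _ = _ := by ring

lemma JJ_fin {β : ℝ} (hβ : 0 ≤ β) (m : ℕ) : JJ β m ≠ ⊤ := by
  have := bm_prob hβ
  have h : JJ β m ≤ ∫⁻ p, ∫⁻ q, 1 ∂betaMeasure β ∂betaMeasure β := by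
    unfold JJ
    refine lintegral_mono fun p => lintegral_mono fun q => ?_
    simp only
    split_ifs
    · exact pow_le_one₀ (by simp) prob_le_one
    · simp
  refine ne_top_of_le_ne_top ?_ h
  simp

lemma jj_conv {β : ℝ} (hβ : 0 ≤ β) (m : ℕ) : jj β (m+1) - jj β (m+2) ≤ jj β m - jj β (m+1) := by
  have h := ENNReal.toReal_mono (ENNReal.add_ne_top.2 ⟨JJ_fin hβ _, JJ_fin hβ _⟩) (JJ_conv hβ m)
  rw [ENNReal.toReal_add (JJ_fin hβ _) (JJ_fin hβ _), ENNReal.toReal_add (JJ_fin hβ _) (JJ_fin hβ _)] at h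
  unfold jj
  linarith

end CP

namespace CP
open MeasureTheory Filter Topology
open scoped ENNReal

lemma edge_meas {n : ℕ} (j i : Fin n) : MeasurableSet {x : Fin n → EE | Edge x j i} := by
  have h1 : MeasurableSet {x : Fin n → EE | x j 0 < x i 0} := measurableSet_lt (by fun_prop) (by fun_prop)
  have h2 : MeasurableSet {x : Fin n → EE | ∀ k, k ≠ j → k ≠ i → x k ∈ Below (x j) (x i)} := by
    simp only [Set.ofPred_forall]
    exact MeasurableSet.iInter fun k => MeasurableSet.iInter fun _ => MeasurableSet.iInter fun _ =>
      below_meas (by fun_prop) (by fun_prop) (by fun_prop)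
  exact h1.inter h2

noncomputable def mf (β : ℝ) (n : ℕ) : ℝ := ∫ x, ff x ∂betaPi β n

lemma mf_eq {β : ℝ} (hβ : 0 ≤ β) (m : ℕ) : mf β (m+2) = 1 + ((m:ℝ)+2)*((m:ℝ)+1)*jj β m := by
  classical
  have := bm_prob hβ
  have := pi_prob hβ (m+2)
  have h1 : mf β (m+2) = ∫ x, (1 + ∑ i : Fin (m+2), ∑ j : Fin (m+2), Set.indicator {x : Fin (m+2) → EE | Edge x j i} (fun _ => (1:ℝ)) x) ∂betaPi β (m+2) := by
    refine integral_congr_ae ?_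
    filter_upwards [gp_ae hβ (m+2)] with x hx
    rw [ff_edges (by omega) hx]
    simp only [Set.indicator, Set.mem_ofPred_eq]
  have hi : ∀ i j : Fin (m+2), Integrable (fun x => Set.indicator {x : Fin (m+2) → EE | Edge x j i} (fun _ => (1:ℝ)) x) (betaPi β (m+2)) := fun i j =>
    (integrable_const (1:ℝ)).indicator (edge_meas j i)
  have hP : ∀ i j : Fin (m+2), ∫ x, Set.indicator {x : Fin (m+2) → EE | Edge x j i} (fun _ => (1:ℝ)) x ∂betaPi β (m+2) = if i = j then 0 else jj β m := by
    intro i j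
    rw [integral_indicator (edge_meas j i)]
    simp only [integral_const, smul_eq_mul, mul_one, measureReal_def, Measure.restrict_apply MeasurableSet.univ, Set.univ_inter]
    split_ifs with h
    · subst h
      have : {x : Fin (m+2) → EE | Edge x i i} = ∅ := by
        ext x; simp [Edge]
      rw [this]; simp
    · rw [edge_prob hβ j i h, jj, JJ]
  rw [h1, integral_add (integrable_const _) (integrable_finsetSum _ fun i _ => integrable_finsetSum _ fun j _ => hi i j),
    integral_finsetSum _ (fun i _ => integrable_finsetSum _ fun j _ => hi i j)]
  have h2 : ∀ i : Fin (m+2), ∫ x, (∑ j : Fin (m+2), Set.indicator {x : Fin (m+2) → EE | Edge x j i} (fun _ => (1:ℝ)) x) ∂betaPi β (m+2) = ((m:ℝ)+1) * jj β m := by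
    intro i
    rw [integral_finsetSum _ (fun j _ => hi i j)]
    simp_rw [hP]
    rw [← Finset.add_sum_erase _ _ (Finset.mem_univ i)]
    rw [Finset.sum_congr rfl (g := fun _ => jj β m) (fun j hj => by rw [if_neg (Finset.ne_of_mem_erase hj).symm])]
    simp
  simp_rw [h2]
  simp
  ring

lemma mean_lim {β : ℝ} (hβ : 0 ≤ β) : ∃ c > 0, Tendsto (fun n : ℕ => mf β n / (n:ℝ)^(al β)) atTop (𝓝 c) := by
  obtain ⟨κ, hκ, hl⟩ := jj_lim hβ
  refine ⟨κ, hκ, ?_⟩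
  rw [← tendsto_add_atTop_iff_nat 2]
  have ha := al_pos hβ
  have hc : Tendsto (fun m : ℕ => (m:ℝ)) atTop atTop := tendsto_natCast_atTop_atTop
  have hinv : Tendsto (fun m : ℕ => ((m:ℝ))⁻¹) atTop (𝓝 0) := tendsto_inv_atTop_zero.comp hc
  have h2 : Tendsto (fun m : ℕ => ((m:ℝ)+2)/m) atTop (𝓝 1) := by
    have : Tendsto (fun m : ℕ => 1 + 2 * ((m:ℝ))⁻¹) atTop (𝓝 (1+2*0)) := (hinv.const_mul 2).const_add 1
    rw [mul_zero, add_zero] at this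
    refine this.congr' ?_
    filter_upwards [eventually_gt_atTop 0] with m hm
    have : (0:ℝ) < m := by exact_mod_cast hm
    field_simp
  have h1 : Tendsto (fun m : ℕ => ((m:ℝ)+1)/m) atTop (𝓝 1) := by
    have : Tendsto (fun m : ℕ => 1 + ((m:ℝ))⁻¹) atTop (𝓝 (1+0)) := hinv.const_add 1
    rw [add_zero] at this
    refine this.congr' ?_
    filter_upwards [eventually_gt_atTop 0] with m hm
    have : (0:ℝ) < m := by exact_mod_cast hm
    field_simp
  have h0 : Tendsto (fun m : ℕ => ((m:ℝ))^(-(al β))) atTop (𝓝 0) := (tendsto_rpow_neg_atTop ha).comp hc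
  have h3 : Tendsto (fun m : ℕ => (((m:ℝ)+2)/m)^(-(al β))) atTop (𝓝 (1^(-(al β)))) := h2.rpow_const (Or.inl (by norm_num))
  rw [Real.one_rpow] at h3
  have H := (h0.add ((h2.mul h1).mul hl)).mul h3
  rw [show (0 + 1*1*κ)*1 = κ by ring] at H
  refine H.congr' ?_
  filter_upwards [eventually_gt_atTop 0] with m hm
  have hm' : (0:ℝ) < m := by exact_mod_cast hm
  rw [mf_eq hβ]
  push_cast
  rw [Real.div_rpow (by positivity) hm'.le, Real.rpow_neg hm'.le, Real.rpow_neg (by positivity : (0:ℝ) ≤ (m:ℝ)+2), Real.rpow_sub hm', Real.rpow_two]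
  have : 0 < (m:ℝ)^(al β) := by positivity
  have : 0 < ((m:ℝ)+2)^(al β) := by positivity
  field_simp

lemma conv_diff (j : ℕ → ℝ) (p κ : ℝ) (hp1 : 0 < p) (hp : p < 2) (hκ : 0 < κ)
    (conv : ∀ m, j (m+1) - j (m+2) ≤ j m - j (m+1))
    (lim : Tendsto (fun m : ℕ => j m * (m:ℝ)^p) atTop (𝓝 κ)) :
    ∃ c > 0, ∀ᶠ n : ℕ in atTop, c * (n:ℝ)^(-p) ≤ 2 * j (n+1) - (n+1) * (j n - j (n+1)) := by
  obtain ⟨ε, hε0, hε1, hε⟩ : ∃ ε : ℝ, 0 < ε ∧ ε < 1 ∧ ((1-ε)^(-p) - 1)/ε < 2 := by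
    have hd : HasDerivAt (fun e : ℝ => (1-e)^(-p)) p 0 := by
      have := ((hasDerivAt_id (0:ℝ)).const_sub 1).rpow_const (p := -p) (Or.inl (by norm_num))
      refine this.congr_deriv ?_
      simp
    have hs := hd.tendsto_slope_zero_right
    have he := hs.eventually_lt_const hp
    have h1 : ∀ᶠ e : ℝ in 𝓝[>] 0, e < 1 := nhdsWithin_le_nhds (eventually_lt_nhds one_pos)
    obtain ⟨e, h1, h2, h3⟩ := (he.and (h1.and self_mem_nhdsWithin)).exists
    refine ⟨e, h3, h2, ?_⟩
    simp only [zero_add, sub_zero, Real.one_rpow, smul_eq_mul] at h1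
    rwa [div_eq_inv_mul]
  have hanti : Antitone fun m => j m - j (m+1) := antitone_nat_of_succ_le conv
  have hc : Tendsto (fun m : ℕ => (m:ℝ)) atTop atTop := tendsto_natCast_atTop_atTop
  have hinv : Tendsto (fun m : ℕ => ((m:ℝ))⁻¹) atTop (𝓝 0) := tendsto_inv_atTop_zero.comp hc
  set k : ℕ → ℕ := fun n => ⌊ε * (n:ℝ)⌋₊ with hk
  have hkn : ∀ n, k n ≤ n := fun n => by
    have : ε * (n:ℝ) ≤ n := by nlinarith [Nat.cast_nonneg (α := ℝ) n]
    simpa using Nat.floor_le_floor this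
  have hklim : Tendsto (fun n => (k n : ℝ)/n) atTop (𝓝 ε) := (tendsto_nat_floor_mul_div_atTop hε0.le).comp hc
  have hsum : ∀ n l : ℕ, l ≤ n → (l:ℝ) * (j n - j (n+1)) ≤ j (n-l) - j n := by
    intro n l
    induction l with
    | zero => intro _; simp
    | succ l ih =>
      intro hl
      have h1 := ih (by omega)
      have h2 := hanti (show n - (l+1) ≤ n by omega)
      simp only at h2
      rw [show n - (l+1) + 1 = n - l by omega] at h2
      push_cast
      linarith
  have hnk : Tendsto (fun n => n - k n) atTop atTop := by
    have : Tendsto (fun n : ℕ => (1-ε) * (n:ℝ)) atTop atTop := hc.const_mul_atTop (by linarith)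
    rw [← tendsto_natCast_atTop_iff (R := ℝ)]
    refine tendsto_atTop_mono (fun n => ?_) this
    rw [Nat.cast_sub (hkn n)]
    have := Nat.floor_le (show 0 ≤ ε * (n:ℝ) by positivity)
    simp only [hk]
    linarith
  have hratio : Tendsto (fun n => ((n - k n : ℕ) : ℝ)/n) atTop (𝓝 (1-ε)) := by
    refine (hklim.const_sub 1).congr' ?_
    filter_upwards [eventually_gt_atTop 0] with m hm
    have : (0:ℝ) < m := by exact_mod_cast hm
    rw [Nat.cast_sub (hkn m)]
    field_simp
  have l1 : Tendsto (fun n => j (n - k n) * (n:ℝ)^p) atTop (𝓝 (κ * (1-ε)^(-p))) := by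
    refine ((lim.comp hnk).mul (hratio.rpow_const (p := -p) (Or.inl (by linarith)))).congr' ?_
    filter_upwards [eventually_gt_atTop 0, hnk.eventually_gt_atTop 0] with m hm hm2
    have h1 : (0:ℝ) < m := by exact_mod_cast hm
    have h2 : (0:ℝ) < ((m - k m : ℕ):ℝ) := by exact_mod_cast hm2
    simp only [Function.comp]
    rw [Real.div_rpow h2.le h1.le, Real.rpow_neg h2.le, Real.rpow_neg h1.le]
    field_simp
  have l2 : Tendsto (fun n : ℕ => ((n:ℝ)+1)/(k n)) atTop (𝓝 (1/ε)) := by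
    have a1 : Tendsto (fun n : ℕ => (1 + ((n:ℝ))⁻¹) / ((k n : ℝ)/n)) atTop (𝓝 ((1+0)/ε)) := (hinv.const_add 1).div hklim hε0.ne'
    rw [add_zero] at a1
    refine a1.congr' ?_
    filter_upwards [eventually_gt_atTop 0] with m hm
    have : (0:ℝ) < m := by exact_mod_cast hm
    field_simp
  have l3 : Tendsto (fun n : ℕ => j (n+1) * (n:ℝ)^p) atTop (𝓝 κ) := by
    have a1 := (tendsto_add_atTop_iff_nat 1).2 lim
    have a2 : Tendsto (fun n : ℕ => (1 + ((n:ℝ))⁻¹)^(-p)) atTop (𝓝 ((1+0)^(-p))) := (hinv.const_add 1).rpow_const (Or.inl (by norm_num))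
    rw [add_zero, Real.one_rpow] at a2
    have a3 := a1.mul a2
    rw [mul_one] at a3
    refine a3.congr' ?_
    filter_upwards [eventually_gt_atTop 0] with m hm
    have h1 : (0:ℝ) < m := by exact_mod_cast hm
    rw [show 1 + (m:ℝ)⁻¹ = (m+1)/m by field_simp, Real.div_rpow (by positivity) h1.le, Real.rpow_neg (by positivity), Real.rpow_neg h1.le]
    push_cast
    have : 0 < ((m:ℝ)+1)^p := by positivity
    field_simp
  have l4 := (l3.const_mul 2).sub (l2.mul (l1.sub lim))
  set K := 2 * κ - 1/ε*(κ * (1-ε)^(-p) - κ) with hK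
  have hKpos : 0 < K := by
    have : K = κ * (2 - ((1-ε)^(-p) - 1)/ε) := by rw [hK]; ring
    rw [this]
    exact mul_pos hκ (by linarith)
  refine ⟨K/2, by positivity, ?_⟩
  have l5 := l4.eventually_const_lt (show K/2 < K by linarith)
  have hkpos : ∀ᶠ n in atTop, 0 < (k n : ℝ)/n := hklim.eventually_const_lt hε0
  filter_upwards [l5, eventually_gt_atTop 0, hkpos] with n hn hn0 hkn0
  have h1 : (0:ℝ) < n := by exact_mod_cast hn0
  have h2 : (0:ℝ) < k n := by
    by_contra h
    have : (k n : ℝ)/n ≤ 0 := div_nonpos_of_nonpos_of_nonneg (not_lt.1 h) h1.le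
    linarith
  have h3 := hsum n (k n) (hkn n)
  have hpn : 0 < (n:ℝ)^p := by positivity
  have h4 : ((n:ℝ)+1) * (j n - j (n+1)) ≤ ((n:ℝ)+1)/(k n) * (j (n - k n) - j n) := by
    rw [div_mul_eq_mul_div, le_div_iff₀ h2]
    nlinarith
  rw [Real.rpow_neg h1.le, ← div_eq_mul_inv, div_le_iff₀ hpn]
  have h5 := mul_le_mul_of_nonneg_right h4 hpn.le
  linarith

lemma mf_diff {β : ℝ} (hβ : 0 ≤ β) : ∃ c > 0, ∀ᶠ n : ℕ in atTop, c * (n:ℝ)^(al β - 1) ≤ mf β (n+1) - mf β n := by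
  obtain ⟨κ, hκ, hl⟩ := jj_lim hβ
  have ha := al_pos hβ
  have ha2 := al_le hβ
  obtain ⟨c, hc, h⟩ := conv_diff (jj β) (2 - al β) κ (by linarith) (by linarith) hκ (jj_conv hβ) hl
  refine ⟨c, hc, ?_⟩
  obtain ⟨N, hN⟩ := eventually_atTop.1 h
  filter_upwards [eventually_ge_atTop (N+3)] with n hn
  obtain ⟨m, rfl⟩ := Nat.exists_eq_add_of_le' (show 2 ≤ n by omega)
  have h1 := hN m (by omega)
  rw [show m + 2 + 1 = (m+1)+2 by ring, mf_eq hβ, mf_eq hβ]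
  have hm : (0:ℝ) < m := by
    have : 0 < m := by omega
    exact_mod_cast this
  push_cast
  have h2 : ((m:ℝ)+2)^(al β - 1) ≤ ((m:ℝ)+2) * (m:ℝ)^(-(2 - al β)) := by
    calc ((m:ℝ)+2)^(al β - 1) = ((m:ℝ)+2) * ((m:ℝ)+2)^(-(2 - al β)) := by
          rw [show al β - 1 = 1 + (-(2 - al β)) by ring, Real.rpow_add (by positivity), Real.rpow_one]
      _ ≤ _ := by
          refine mul_le_mul_of_nonneg_left ?_ (by positivity)
          exact Real.rpow_le_rpow_of_nonpos hm (by linarith) (by linarith)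
  have h3 := mul_le_mul_of_nonneg_left h2 hc.le
  have h4 := mul_le_mul_of_nonneg_left h1 (show 0 ≤ (m:ℝ)+2 by positivity)
  linarith

end CP

namespace CP
open MeasureTheory Filter Topology
open scoped ENNReal

lemma ff_del {n : ℕ} (x : Fin (n+1) → EE) (i : Fin (n+1)) : ff x ≤ ff (fun j => x (i.succAbove j)) + vf x i := by
  unfold ff
  rw [Fin.sum_univ_succAbove _ i, add_comm]
  gcongr with j _
  unfold vf
  by_cases h : Vert x (i.succAbove j)
  · have : Vert (fun j => x (i.succAbove j)) j := by
      obtain ⟨u, hu, h⟩ := h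
      exact ⟨u, hu, fun k hk => h _ fun he => hk (Fin.succAbove_right_injective he)⟩
    rw [if_pos h, if_pos this]
  · rw [if_neg h]; split_ifs <;> norm_num

lemma split_int {n : ℕ} {α : Type*} [MeasurableSpace α] (ν : Measure α) [IsProbabilityMeasure ν] (i : Fin (n+1)) (F : (Fin n → α) → ℝ) (g : α → ℝ) :
    ∫ x, F (fun j => x (i.succAbove j)) * g (x i) ∂(Measure.pi fun _ : Fin (n+1) => ν)
      = (∫ y, F y ∂(Measure.pi fun _ : Fin n => ν)) * ∫ p, g p ∂ν := by
  have h := (measurePreserving_piFinSuccAbove (fun _ : Fin (n+1) => ν) i)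
  have h2 := h.integral_comp' (fun q : α × (Fin n → α) => g q.1 * F q.2)
  rw [integral_prod_mul] at h2
  rw [mul_comm, ← h2]
  refine integral_congr_ae (Eventually.of_forall fun x => ?_)
  exact mul_comm _ _

lemma coord_int {n : ℕ} {α : Type*} [MeasurableSpace α] (ν : Measure α) [IsProbabilityMeasure ν] (i : Fin n) {g : α → ℝ} (hg : Measurable g) :
    ∫ x, g (x i) ∂(Measure.pi fun _ : Fin n => ν) = ∫ p, g p ∂ν := by
  have h := measurePreserving_eval (fun _ : Fin n => ν) i
  have h2 := integral_map (μ := Measure.pi fun _ : Fin n => ν) h.measurable.aemeasurable (f := g) hg.aestronglyMeasurable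
  rw [h.map_eq] at h2
  exact h2.symm

lemma cov_le {Ω : Type*} [MeasurableSpace Ω] (P : Measure Ω) [IsProbabilityMeasure P] (f g : Ω → ℝ) (hf : Measurable f) (hg : Measurable g)
    (Cf Cg : ℝ) (hfb : ∀ x, |f x| ≤ Cf) (hgb : ∀ x, |g x| ≤ Cg) (τ : ℝ) :
    2 * τ * (∫ x, f x * g x ∂P - (∫ x, f x ∂P) * ∫ x, g x ∂P) - τ^2 * (∫ x, g x ^ 2 ∂P - (∫ x, g x ∂P)^2)
      ≤ ∫ x, f x ^ 2 ∂P - (∫ x, f x ∂P)^2 := by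
  have m1 : MemLp f 2 P := MemLp.of_bound hf.aestronglyMeasurable Cf (Eventually.of_forall hfb)
  have m2 : MemLp g 2 P := MemLp.of_bound hg.aestronglyMeasurable Cg (Eventually.of_forall hgb)
  have v := ProbabilityTheory.variance_sub m1 (m2.const_mul τ)
  have nn := ProbabilityTheory.variance_nonneg (f - fun x => τ * g x) P
  rw [v, ProbabilityTheory.variance_const_mul, ProbabilityTheory.covariance_const_mul_right, ProbabilityTheory.variance_eq_sub m1,
    ProbabilityTheory.variance_eq_sub m2, ProbabilityTheory.covariance_eq_sub m1 m2] at nn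
  simp only [Pi.pow_apply, Pi.mul_apply] at nn
  linarith

noncomputable def SS {n : ℕ} (h : ℝ) (x : Fin n → EE) : ℝ := ∑ i, (AA h).indicator (fun _ => (1:ℝ)) (x i)

lemma ind_meas (h : ℝ) : Measurable ((AA h).indicator (fun _ => (1:ℝ))) := measurable_const.indicator (AA_meas h)

lemma ind_bd (h : ℝ) (p : EE) : 0 ≤ (AA h).indicator (fun _ => (1:ℝ)) p ∧ (AA h).indicator (fun _ => (1:ℝ)) p ≤ 1 := by
  by_cases hp : p ∈ AA h <;> simp [hp]

lemma SS_meas {n : ℕ} (h : ℝ) : Measurable (SS h : (Fin n → EE) → ℝ) := by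
  have := ind_meas h
  unfold SS
  fun_prop

lemma SS_bd {n : ℕ} (h : ℝ) (x : Fin n → EE) : |SS h x| ≤ n := by
  unfold SS
  refine (Finset.abs_sum_le_sum_abs _ _).trans ?_
  refine (Finset.sum_le_sum fun i _ => (abs_of_nonneg (ind_bd h (x i)).1).le.trans (ind_bd h (x i)).2).trans ?_
  simp

lemma ind_int {β : ℝ} (hβ : 0 ≤ β) (h : ℝ) : ∫ p, (AA h).indicator (fun _ => (1:ℝ)) p ∂betaMeasure β = (betaMeasure β).real (AA h) := by
  have := bm_prob hβ
  rw [integral_indicator (AA_meas h)]; simp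

lemma SS_var {β : ℝ} (hβ : 0 ≤ β) (n : ℕ) (h : ℝ) :
    ∫ x, SS h x ^ 2 ∂betaPi β n - (∫ x, SS h x ∂betaPi β n)^2 ≤ n * (betaMeasure β).real (AA h) := by
  have := bm_prob hβ
  refine (efron_stein (betaMeasure β) (SS h) (SS_meas h) n (SS_bd h)).trans ?_
  have hj : ∀ j : Fin n, ∫ z, (SS h (mix ∅ z) - SS h (mix {j} z)) ^ 2 ∂(Measure.pi fun _ : Fin n => (betaMeasure β).prod (betaMeasure β)) ≤ 2 * (betaMeasure β).real (AA h) := by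
    intro j
    have hI := ind_meas h
    have hG : ∫ z, ((AA h).indicator (fun _ => (1:ℝ)) (z j).1 + (AA h).indicator (fun _ => (1:ℝ)) (z j).2) ∂(Measure.pi fun _ : Fin n => (betaMeasure β).prod (betaMeasure β)) = 2 * (betaMeasure β).real (AA h) := by
      rw [coord_int ((betaMeasure β).prod (betaMeasure β)) j (g := fun p => (AA h).indicator (fun _ => (1:ℝ)) p.1 + (AA h).indicator (fun _ => (1:ℝ)) p.2) (by fun_prop)]
      have i1 : Integrable ((AA h).indicator (fun _ => (1:ℝ))) (betaMeasure β) := (integrable_const _).indicator (AA_meas h)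
      rw [integral_add (i1.comp_fst _) (i1.comp_snd _), integral_fun_fst, integral_fun_snd, ind_int hβ]
      simp; ring
    rw [← hG]
    refine integral_mono_of_nonneg (Eventually.of_forall fun z => sq_nonneg _) (bdd_int (Measurable.aestronglyMeasurable (by fun_prop)) 2 fun z => ?_) (Eventually.of_forall fun z => ?_)
    · rw [Real.norm_eq_abs, abs_le]
      constructor <;> linarith [ind_bd h (z j).1, ind_bd h (z j).2]
    · simp only
      have e : SS h (mix ∅ z) - SS h (mix {j} z) = (AA h).indicator (fun _ => (1:ℝ)) (z j).1 - (AA h).indicator (fun _ => (1:ℝ)) (z j).2 := by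
        unfold SS
        rw [← Finset.sum_sub_distrib, Finset.sum_eq_single j]
        · simp [mix]
        · intro b _ hb; simp [mix, hb]
        · simp
      rw [e]
      have h1 := ind_bd h (z j).1
      have h2 := ind_bd h (z j).2
      nlinarith [mul_nonneg h1.1 h2.1]
  calc _ ≤ (1/2:ℝ) * ∑ j : Fin n, 2 * (betaMeasure β).real (AA h) := by
        gcongr with j _; exact hj j
    _ = _ := by simp; ring

lemma cov_SS {β : ℝ} (hβ : 0 ≤ β) (n : ℕ) (h r L : ℝ) (hA : (betaMeasure β).real (AA h) ≤ 1/2) (hd : 0 ≤ mf β (n+1) - mf β n) :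
    ((n:ℝ)+1) * (1/2 * (mf β (n+1) - mf β n) - (betaPi β (n+1)).real {x | ¬ Nice h r L x}) ≤
    ∫ x, ff x * SS h x ∂betaPi β (n+1) - (∫ x, ff x ∂betaPi β (n+1)) * ∫ x, SS h x ∂betaPi β (n+1) := by
  have := bm_prob hβ
  have := pi_prob hβ (n+1)
  have := pi_prob hβ n
  set a := (betaMeasure β).real (AA h) with ha
  set B := (betaPi β (n+1)).real {x | ¬ Nice h r L x} with hB
  set I : EE → ℝ := (AA h).indicator (fun _ => (1:ℝ)) with hI
  have hIm : Measurable I := ind_meas h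
  have hIb := ind_bd h
  have hfi : Integrable (fun x : Fin (n+1) → EE => ff x) (betaPi β (n+1)) := bdd_int ff_meas.aestronglyMeasurable _ ff_abs
  have hfIi : ∀ i, Integrable (fun x : Fin (n+1) → EE => ff x * I (x i)) (betaPi β (n+1)) := fun i =>
    bdd_int (ff_meas.mul (hIm.comp (measurable_pi_apply i))).aestronglyMeasurable ((n+1 : ℕ):ℝ) (fun x => by
      rw [norm_mul, Real.norm_eq_abs, Real.norm_eq_abs, abs_of_nonneg (hIb _).1]
      exact (mul_le_mul (ff_abs x) (hIb _).2 (hIb _).1 (by positivity)).trans (by simp))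
  have hIi : ∀ i, Integrable (fun x : Fin (n+1) → EE => I (x i)) (betaPi β (n+1)) := fun i =>
    bdd_int (hIm.comp (measurable_pi_apply i)).aestronglyMeasurable 1 (fun x => by
      rw [Real.norm_eq_abs, abs_of_nonneg (hIb _).1]; exact (hIb _).2)
  have hES : ∫ x, SS h x ∂betaPi β (n+1) = ((n:ℝ)+1) * a := by
    unfold SS
    rw [integral_finsetSum _ fun i _ => hIi i]
    have : ∀ i : Fin (n+1), ∫ x, I (x i) ∂betaPi β (n+1) = a := fun i =>
      (coord_int (betaMeasure β) i hIm).trans (ind_int hβ h)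
    simp_rw [this]; simp
  have hEfS : ∫ x, ff x * SS h x ∂betaPi β (n+1) = ∑ i, ∫ x, ff x * I (x i) ∂betaPi β (n+1) := by
    rw [← integral_finsetSum _ fun i _ => hfIi i]
    refine integral_congr_ae (Eventually.of_forall fun x => ?_)
    simp only [SS, Finset.mul_sum, hI]
  have hone : ∀ i : Fin (n+1), mf β (n+1) - (1-a) * mf β n - B ≤ ∫ x, ff x * I (x i) ∂betaPi β (n+1) := by
    intro i
    set F : (Fin (n+1) → EE) → ℝ := fun x => ff (fun j => x (i.succAbove j)) * (1 - I (x i)) with hF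
    have hFm : Measurable F := by
      have := ff_meas (n := n)
      exact (this.comp (by fun_prop)).mul (by fun_prop)
    have hFi : Integrable F (betaPi β (n+1)) := bdd_int hFm.aestronglyMeasurable n (fun x => by
      rw [norm_mul, Real.norm_eq_abs, Real.norm_eq_abs, abs_of_nonneg (by linarith [(hIb (x i)).2] : 0 ≤ 1 - I (x i))]
      exact (mul_le_mul (ff_abs _) (by linarith [(hIb (x i)).1] : 1 - I (x i) ≤ 1) (by linarith [(hIb (x i)).2]) (by positivity)).trans (by simp))
    have hEF : ∫ x, F x ∂betaPi β (n+1) = (1-a) * mf β n := by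
      refine (split_int (betaMeasure β) i (fun y => ff y) (fun p => 1 - I p)).trans ?_
      rw [integral_sub (integrable_const _) ((integrable_const _).indicator (AA_meas h)), ind_int hβ]
      simp [mf, ← ha, mul_comm, betaPi]
    set E : Set (Fin (n+1) → EE) := {x | Vert x i} ∩ {x | x i ∉ AA h} with hE
    have hE2 : MeasurableSet {x : Fin (n+1) → EE | x i ∈ AA h} := (measurable_pi_apply (X := fun _ : Fin (n+1) => EE) i) (AA_meas h)
    have hEm : MeasurableSet E := (vert_open i).measurableSet.inter hE2.compl
    have hPE : (betaPi β (n+1)).real E ≤ B := measureReal_mono (fun x hx hn => hx.2 (vert_A hn hx.1))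
    have hpt : ∀ x, ff x ≤ ff x * I (x i) + (F x + E.indicator (fun _ => (1:ℝ)) x) := by
      intro x
      by_cases hx : x i ∈ AA h
      · have hh : I (x i) = 1 := by simp [hI, hx]
        have : x ∉ E := fun h => h.2 hx
        simp [hF, hh, this]
      · have hh : I (x i) = 0 := by simp [hI, hx]
        have h1 := ff_del x i
        have h2 : vf x i = E.indicator (fun _ => (1:ℝ)) x := by
          unfold vf
          by_cases hv : Vert x i
          · have : x ∈ E := ⟨hv, hx⟩
            simp [hv, this]
          · have : x ∉ E := fun h => hv h.1
            simp [hv, this]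
        simp only [hF, hh]
        linarith
    have hEi : Integrable (E.indicator (fun _ => (1:ℝ))) (betaPi β (n+1)) := (integrable_const _).indicator hEm
    have h3 := integral_mono hfi ((hfIi i).add (hFi.add hEi)) hpt
    rw [integral_add' (hfIi i) (hFi.add hEi), integral_add' hFi hEi, hEF, integral_indicator hEm] at h3
    simp at h3
    unfold mf at *
    linarith
  have hsum := Finset.sum_le_sum fun i (_ : i ∈ Finset.univ) => hone i
  rw [← hEfS] at hsum
  rw [hES]
  simp only [Finset.sum_const, Finset.card_univ, Fintype.card_fin, nsmul_eq_mul] at hsum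
  push_cast at hsum
  change _ ≤ _ - mf β (n+1) * _
  refine le_trans ?_ (sub_le_sub_right hsum _)
  have h5 : ((n:ℝ)+1) * (mf β (n+1) - (1-a) * mf β n - B) - mf β (n+1) * (((n:ℝ)+1)*a) = ((n:ℝ)+1) * ((1-a) * (mf β (n+1) - mf β n) - B) := by ring
  rw [h5]
  gcongr
  linarith

end CP

namespace CP
open MeasureTheory Filter Topology
open scoped ENNReal

theorem var_lower {β : ℝ} (hβ : 0 ≤ β) : ∃ c > 0, ∀ᶠ n : ℕ in atTop, c * ((n:ℝ)^(al β) / Real.log n) ≤ vv β n := by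
  obtain ⟨c, hc, h1⟩ := mf_diff hβ
  obtain ⟨C, hC, h2⟩ := ups hβ
  have ha := al_pos hβ
  have ha2 := al_le hβ
  refine ⟨c^2/(16*C), by positivity, ?_⟩
  have h2' := (tendsto_add_atTop_nat 1).eventually h2
  have hinv : Tendsto (fun m : ℕ => ((m:ℝ))⁻¹) atTop (𝓝 0) := tendsto_inv_atTop_zero.comp tendsto_natCast_atTop_atTop
  have h3 : ∀ᶠ m : ℕ in atTop, ((m:ℝ))⁻¹ < c/4 := hinv.eventually_lt_const (by positivity)
  have key : ∀ᶠ n : ℕ in atTop, c^2/(16*C) * (((n+1:ℕ):ℝ)^(al β) / Real.log ((n+1:ℕ):ℝ)) ≤ vv β (n+1) := by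
    filter_upwards [h1, h2', (tendsto_add_atTop_nat 1).eventually h3, eventually_gt_atTop 0] with n d1 U d3 hn0
    have := pi_prob hβ (n+1)
    have hn : (0:ℝ) < n := by exact_mod_cast hn0
    obtain ⟨h, r, L, pk⟩ := U.pk
    have hd0 : 0 ≤ mf β (n+1) - mf β n := le_trans (by positivity) d1
    have cv := cov_SS hβ n h r L pk.A2 hd0
    have hbad := pk.bad
    set N : ℝ := ((n+1:ℕ):ℝ) with hN
    have hNn : N = n + 1 := by rw [hN]; push_cast; ring
    have hN1 : 1 ≤ N := by rw [hNn]; linarith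
    set B := (betaPi β (n+1)).real {x | ¬ Nice h r L x}
    set D := c/4 * N^(al β) with hD
    have hDpos : 0 < D := by positivity
    have hNa : 1 ≤ N^(al β) := Real.one_le_rpow hN1 ha.le
    have hcov : D ≤ ∫ x, ff x * SS h x ∂betaPi β (n+1) - (∫ x, ff x ∂betaPi β (n+1)) * ∫ x, SS h x ∂betaPi β (n+1) := by
      refine le_trans ?_ cv
      rw [← hNn]
      have e1 : c * N^(al β - 1) ≤ mf β (n+1) - mf β n := by
        refine le_trans ?_ d1
        refine mul_le_mul_of_nonneg_left ?_ hc.le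
        exact Real.rpow_le_rpow_of_nonpos hn (by linarith) (by linarith)
      have e2 : N * N^(al β - 1) = N^(al β) := by
        rw [← Real.rpow_one_add' (by linarith) (by linarith)]; congr 1; ring
      have e3 : N * B ≤ c/4 := by
        have : N * B ≤ N * (1/N^10) := mul_le_mul_of_nonneg_left hbad (by linarith)
        have e4 : N * (1/N^10) ≤ N⁻¹ := by
          rw [mul_one_div, div_le_iff₀ (by positivity), show N⁻¹ * N^10 = N * N^8 by field_simp]
          have := one_le_pow₀ hN1 (n := 8)
          nlinarith
        linarith
      have e5 := mul_le_mul_of_nonneg_left e1 (show 0 ≤ N by linarith)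
      have e6 : c/4 ≤ c/4 * N^(al β) := by nlinarith
      rw [hD]
      nlinarith
    have hv := SS_var hβ (n+1) h
    have hv2 := hv.trans pk.nA
    set u := uu β (n+1) with hu
    have hu1 := U.one
    have hupos : 0 < C * u := by positivity
    have fin := cov_le (betaPi β (n+1)) ff (SS h) ff_meas (SS_meas h) _ _ ff_abs (SS_bd h) (D/(C*u))
    have g1 : 2 * (D/(C*u)) * D - (D/(C*u))^2 * (C*u) ≤ vv β (n+1) := by
      refine le_trans ?_ fin
      gcongr
    have g2 : 2 * (D/(C*u)) * D - (D/(C*u))^2 * (C*u) = D^2/(C*u) := by field_simp; ring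
    rw [g2] at g1
    refine le_trans ?_ g1
    have hl := U.lone
    have hlp : 0 < Real.log N := by linarith
    have hu2 : u ≤ N^(al β) * Real.log N := by
      rw [hu, uu]
      gcongr
      calc Real.log N ^ (1 - al β) ≤ Real.log N ^ (1:ℝ) := Real.rpow_le_rpow_of_exponent_le hl (by linarith)
        _ = _ := Real.rpow_one _
    have hNp : 0 < N^(al β) := by positivity
    have hup : 0 < u := by linarith
    calc c^2/(16*C) * (N^(al β) / Real.log N) = D^2/(C*(N^(al β) * Real.log N)) := by
          rw [hD]; field_simp; ring
      _ ≤ D^2/(C*u) := by gcongr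
  obtain ⟨N, hN⟩ := eventually_atTop.1 key
  filter_upwards [eventually_ge_atTop (N+1)] with n hn
  obtain ⟨m, rfl⟩ := Nat.exists_eq_add_of_le' (show 1 ≤ n by omega)
  exact hN m (by omega)

end CP

namespace CP
open MeasureTheory Filter Topology
open scoped ENNReal

lemma meanUp_eq {β : ℝ} (hβ : 0 ≤ β) (n : ℕ) : meanUp β n = mf β n := integral_congr_ae (up_ae hβ n)

lemma varUp_eq {β : ℝ} (hβ : 0 ≤ β) (n : ℕ) : varUp β n = vv β n := by
  unfold varUp vv
  rw [meanUp_eq hβ]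
  congr 1
  refine integral_congr_ae ?_
  filter_upwards [up_ae hβ n] with x hx
  rw [hx]

lemma logpow {a : ℝ} (ha : 0 < a) (k : ℕ) : Tendsto (fun n : ℕ => Real.log n ^ k / (n:ℝ) ^ a) atTop (𝓝 0) := by
  have h := (isLittleO_log_rpow_rpow_atTop (k:ℝ) ha).tendsto_div_nhds_zero
  have h2 := h.comp tendsto_natCast_atTop_atTop
  simpa [Function.comp_def, Real.rpow_natCast] using h2

lemma uu_le {β C : ℝ} {n : ℕ} (hβ : 0 ≤ β) (U : Ups β C n) : uu β n ≤ (n:ℝ)^(al β) * Real.log n := by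
  unfold uu
  refine mul_le_mul_of_nonneg_left ?_ (by positivity)
  calc Real.log n ^ (1 - al β) ≤ Real.log n ^ (1:ℝ) :=
        Real.rpow_le_rpow_of_exponent_le U.lone (by linarith [al_pos hβ])
    _ = _ := Real.rpow_one _

theorem clt {β : ℝ} (hβ : 0 ≤ β) : Tendsto (fun n : ℕ => ⨆ z : ℝ, |(betaPi β n {x | (ff x - mf β n) / √(vv β n) ≤ z}).toReal -
    (ProbabilityTheory.gaussianReal 0 1 (Set.Iic z)).toReal|) atTop (𝓝 0) := by
  have : ∀ n, IsProbabilityMeasure (betaPi β n) := pi_prob hβ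
  have hν := bm_prob hβ
  refine clt_of_char (fun n => betaPi β n) (fun n x => (ff x - mf β n) / √(vv β n)) (fun n => (ff_meas.sub_const _).div_const _) fun t => ?_
  obtain ⟨c, hc, h1⟩ := var_lower hβ
  obtain ⟨C, hC, h2⟩ := ups hβ
  have ha := al_pos hβ
  rw [tendsto_iff_norm_sub_tendsto_zero]
  set K := C / c^2 + C^2/c^3 with hK
  have hlim : Tendsto (fun n : ℕ => (|t| + 3/2*t^2) * |t| * √(K * (Real.log n ^ 11 / (n:ℝ)^(al β)))) atTop (𝓝 0) := by
    have := (((logpow ha 11).const_mul K).sqrt).const_mul ((|t| + 3/2*t^2) * |t|)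
    simpa using this
  refine squeeze_zero' (Eventually.of_forall fun _ => norm_nonneg _) ?_ hlim
  filter_upwards [h1, h2, eventually_gt_atTop 0] with n d1 U hn0
  have hn : (0:ℝ) < n := by exact_mod_cast hn0
  have hu := uu_le hβ U
  have hu1 := U.one
  have hl := U.lone
  have hvT := U.vT
  have he := U.e
  set l := Real.log n
  set y := (n:ℝ)^(al β) with hy
  have hy0 : 0 < y := by positivity
  have hl0 : 0 < l := by linarith
  have hV : 0 < vv β n := lt_of_lt_of_le (by positivity) d1
  set V := vv β n with hVd
  have hb := char_bound (betaMeasure β) ff ff_meas n ff_abs (√V) _ _ (Real.sqrt_pos.2 hV) (by rw [Real.sq_sqrt hV.le]; rfl) hvT he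
    (mf β n) rfl t
  refine hb.trans ?_
  have hc2 : 0 < C / c^2 := by positivity
  have hc3 : 0 < C^2 / c^3 := by positivity
  have hl9 : l^9 ≤ l^11 := pow_le_pow_right₀ hl (by norm_num)
  have A : √(C * (uu β n * l^6)) / √V^2 ≤ √(K * (l^11 / y)) := by
    rw [Real.sq_sqrt hV.le]
    apply Real.le_sqrt_of_sq_le
    rw [div_pow, Real.sq_sqrt (by positivity)]
    calc C * (uu β n * l^6) / V^2 ≤ C * ((y*l) * l^6) / (c * (y/l))^2 := by gcongr
      _ = C/c^2 * (l^9/y) := by field_simp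
      _ ≤ K * (l^11/y) := by gcongr; linarith
  have B : C * (uu β n * l^3) / √V^3 ≤ √(K * (l^11 / y)) := by
    apply Real.le_sqrt_of_sq_le
    have e1 : (√V^3)^2 = V^3 := by rw [← pow_mul, mul_comm, pow_mul, Real.sq_sqrt hV.le]
    rw [div_pow, e1]
    calc (C * (uu β n * l^3))^2 / V^3 ≤ (C * ((y*l) * l^3))^2 / (c * (y/l))^3 := by gcongr
      _ = C^2/c^3 * (l^11/y) := by field_simp
      _ ≤ K * (l^11/y) := by gcongr; linarith
  calc _ = (|t| * (√(C * (uu β n * l^6)) / √V^2) + 3/2*t^2 * (C * (uu β n * l^3) / √V^3)) * |t| := by ring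
    _ ≤ (|t| * √(K * (l^11 / y)) + 3/2*t^2 * √(K * (l^11 / y))) * |t| := by gcongr
    _ = _ := by ring

theorem lower {β : ℝ} (hβ : 0 ≤ β) (a : ℝ) (ha : 0 < a) : ∃ c > 0, ∀ᶠ n : ℕ in atTop, c * (n:ℝ)^(al β - a) ≤ vv β n := by
  obtain ⟨c, hc, h1⟩ := var_lower hβ
  refine ⟨c, hc, ?_⟩
  filter_upwards [h1, (logpow ha 1).eventually_le_const zero_lt_one, log_tendsto.eventually_ge_atTop 1, eventually_gt_atTop 0] with n d1 d2 d3 hn0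
  have hn : (0:ℝ) < n := by exact_mod_cast hn0
  refine le_trans ?_ d1
  rw [Real.rpow_sub hn]
  rw [pow_one, div_le_one (by positivity)] at d2
  have : 0 < Real.log n := by linarith
  gcongr

theorem upper {β : ℝ} (hβ : 0 ≤ β) : ∃ c > 0, ∀ᶠ n : ℕ in atTop, vv β n ≤ c * Real.log n ^ (3 - al β) * (n:ℝ)^(al β) := by
  obtain ⟨C, hC, h2⟩ := ups hβ
  refine ⟨C, hC, ?_⟩
  filter_upwards [h2] with n U
  refine U.v.trans (le_of_eq ?_)
  have hl : 0 < Real.log n := by linarith [U.lone]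
  have : Real.log n ^ (3 - al β) = Real.log n ^ (1 - al β) * Real.log n ^ 2 := by
    rw [← Real.rpow_natCast, ← Real.rpow_add hl]
    congr 1
    push_cast; ring
  rw [this, uu]
  ring

end CP

theorem coherent_path_length_clt (d : ℕ) (hd : 4 ≤ d)
    (β : ℝ) (hβ : β = (d : ℝ) / 2 - 2) :
    (Filter.Tendsto
      (fun n : ℕ =>
        ⨆ z : ℝ,
          |(betaPi β n {ω |
              (upCount ω - meanUp β n) / Real.sqrt (varUp β n) ≤ z}).toReal -
            ((ProbabilityTheory.gaussianReal 0 1) (Set.Iic z)).toReal|)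
      Filter.atTop (nhds 0)) ∧
    (∃ c : ℝ, 0 < c ∧
      Filter.Tendsto (fun n : ℕ => meanUp β n / (n : ℝ) ^ (1 / ((d : ℝ) - 1)))
        Filter.atTop (nhds c)) ∧
    (∀ a : ℝ, 0 < a → ∃ c' : ℝ, 0 < c' ∧ ∃ N : ℕ, ∀ n : ℕ, N ≤ n →
      c' * (n : ℝ) ^ (1 / ((d : ℝ) - 1) - a) ≤ varUp β n) ∧
    (∃ c'' : ℝ, 0 < c'' ∧ ∃ N' : ℕ, ∀ n : ℕ, N' ≤ n →
      varUp β n ≤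
        c'' * Real.log n ^ (3 - 1 / ((d : ℝ) - 1)) * (n : ℝ) ^ (1 / ((d : ℝ) - 1))) := by
  have hd4 : (4:ℝ) ≤ d := by exact_mod_cast hd
  have h0 : 0 ≤ β := by rw [hβ]; linarith
  have hal : 1 / ((d : ℝ) - 1) = CP.al β := by
    unfold CP.al; rw [hβ]; congr 1; ring
  rw [hal]
  simp only [CP.meanUp_eq h0, CP.varUp_eq h0]
  refine ⟨?_, ?_, ?_, ?_⟩
  · have h := CP.clt h0
    refine h.congr fun n => ?_
    congr 1
    funext z
    have : betaPi β n {x | (CP.ff x - CP.mf β n) / √(CP.vv β n) ≤ z} =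
        betaPi β n {x | (upCount x - CP.mf β n) / √(CP.vv β n) ≤ z} := by
      apply MeasureTheory.measure_congr
      filter_upwards [CP.up_ae h0 n] with x hx
      apply propext
      change (CP.ff x - CP.mf β n) / √(CP.vv β n) ≤ z ↔ (upCount x - CP.mf β n) / √(CP.vv β n) ≤ z
      rw [hx]
    rw [this]
  · exact CP.mean_lim h0
  · intro a ha
    obtain ⟨c, hc, h⟩ := CP.lower h0 a ha
    obtain ⟨N, hN⟩ := Filter.eventually_atTop.1 h
    exact ⟨c, hc, N, hN⟩
  · obtain ⟨c, hc, h⟩ := CP.upper h0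
    obtain ⟨N, hN⟩ := Filter.eventually_atTop.1 h
    exact ⟨c, hc, N, hN⟩
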